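/- Fix a real number u. As x → ∞, (1/x)·#{n : 1 < n ≤ x and ω(n − φ(n)) − log log x ≤ u·√(log log x)} tends to (1/√(2π)) ∫_{−∞}^{u} e^{−t²/2} dt (where the value n = 1, for which n − φ(n) = 0, may be ignored). -/

import Mathlib

namespace CototientLaw

section

open Finset

/-- The elementary symmetric sum of degree `k` of `f` over `A`. -/
def esum {ι R : Type*} [CommSemiring R] (f : ι → R) (A : Finset ι) (k : ℕ) : R :=
  ∑ S ∈ A.powersetCard k, ∏ i ∈ S, f i

theorem esum_zero {ι R : Type*} [CommSemiring R] (f : ι → R) (A : Finset ι) :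
    esum f A 0 = 1 := by
  simp [esum]

theorem esum_empty_succ {ι R : Type*} [CommSemiring R] (f : ι → R) (k : ℕ) :
    esum f ∅ (k + 1) = 0 := by
  rw [esum, powersetCard_eq_empty.2 (by simp), sum_empty]

theorem esum_insert {ι R : Type*} [DecidableEq ι] [CommSemiring R] (f : ι → R) {A : Finset ι}
    {a : ι} (ha : a ∉ A) (k : ℕ) :
    esum f (insert a A) (k + 1) = esum f A (k + 1) + f a * esum f A k := by
  unfold esum
  have hnot : ∀ S ∈ A.powersetCard k, a ∉ S := fun S hS h =>
    ha ((mem_powersetCard.1 hS).1 h)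
  rw [powersetCard_succ_insert ha, sum_union, sum_image, mul_sum]
  · congr 1
    exact sum_congr rfl fun S hS => prod_insert (hnot S hS)
  · intro S hS T hT h
    have := congrArg (fun U => U.erase a) h
    simpa [erase_insert (hnot S hS), erase_insert (hnot T hT)] using this
  · rw [disjoint_left]
    intro S hS hS'
    obtain ⟨T, -, rfl⟩ := mem_image.1 hS'
    exact ha ((mem_powersetCard.1 hS).1 (mem_insert_self _ _))

theorem esum_mono {ι : Type*} {f g : ι → ℝ} {A : Finset ι} (hf : ∀ i ∈ A, 0 ≤ f i)
    (hfg : ∀ i ∈ A, f i ≤ g i) (k : ℕ) : esum f A k ≤ esum g A k :=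
  sum_le_sum fun _ hS => prod_le_prod (fun i hi => hf i ((mem_powersetCard.1 hS).1 hi))
    fun i hi => hfg i ((mem_powersetCard.1 hS).1 hi)

theorem factorial_mul_esum_le {ι : Type*} [DecidableEq ι] {f : ι → ℝ} (A : Finset ι)
    (hf : ∀ i ∈ A, 0 ≤ f i) (k : ℕ) : k.factorial * esum f A k ≤ (∑ i ∈ A, f i) ^ k := by
  induction A using Finset.induction_on generalizing k with
  | empty =>
    cases k with
    | zero => simp [esum]
    | succ k => simp [esum_empty_succ]
  | insert a A ha ih =>
    have hA : ∀ i ∈ A, 0 ≤ f i := fun i hi => hf i (mem_insert_of_mem hi)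
    have hfa := hf a (mem_insert_self _ _)
    cases k with
    | zero => simp [esum_zero]
    | succ k =>
      have h1 := ih hA (k + 1)
      have h2 := ih hA k
      have hs : 0 ≤ ∑ i ∈ A, f i := sum_nonneg hA
      rw [esum_insert f ha, sum_insert ha]
      have h3 : (∑ i ∈ A, f i) ^ (k + 1) + (k + 1) * f a * (∑ i ∈ A, f i) ^ k
          ≤ (f a + ∑ i ∈ A, f i) ^ (k + 1) := by
        generalize (∑ i ∈ A, f i) = s at hs
        clear h1 h2 ih
        induction k with
        | zero => simp; linarith
        | succ k ihk =>
          rw [pow_succ (f a + s)]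
          refine le_trans ?_ (mul_le_mul_of_nonneg_right ihk (by positivity))
          push_cast
          have : 0 ≤ (k + 1) * f a ^ 2 * s ^ k := by positivity
          ring_nf at this ⊢
          nlinarith [this]
      rw [Nat.factorial_succ] at h1 ⊢
      push_cast at h1 ⊢
      have h4 := mul_le_mul_of_nonneg_left h2 (show 0 ≤ ((k : ℝ) + 1) * f a by positivity)
      nlinarith [h1, h3, h4]

theorem norm_prod_one_add_sub_sum_le {ι : Type*} [DecidableEq ι] (A : Finset ι) (w : ι → ℂ)
    (hw : ∀ i ∈ A, ‖1 + w i‖ ≤ 1) (k : ℕ) :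
    ‖∏ i ∈ A, (1 + w i) - ∑ j ∈ range k, esum w A j‖ ≤ esum (fun i => ‖w i‖) A k := by
  induction A using Finset.induction_on generalizing k with
  | empty =>
    cases k with
    | zero => simp [esum]
    | succ k =>
      rw [sum_range_succ']
      simp [esum_empty_succ, esum_zero]
  | insert a A ha ih =>
    have hA : ∀ i ∈ A, ‖1 + w i‖ ≤ 1 := fun i hi => hw i (mem_insert_of_mem hi)
    cases k with
    | zero =>
      simp only [range_zero, sum_empty, sub_zero, esum_zero, norm_prod]
      exact prod_le_one (fun _ _ => norm_nonneg _) hw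
    | succ k =>
      rw [esum_insert _ ha, sum_range_succ', prod_insert ha]
      simp only [esum_insert w ha, esum_zero, sum_add_distrib, ← mul_sum]
      have e : (1 + w a) * ∏ i ∈ A, (1 + w i)
          - (∑ j ∈ range k, esum w A (j + 1) + w a * ∑ j ∈ range k, esum w A j + 1)
          = (∏ i ∈ A, (1 + w i) - ∑ j ∈ range (k + 1), esum w A j)
            + w a * (∏ i ∈ A, (1 + w i) - ∑ j ∈ range k, esum w A j) := by
        rw [sum_range_succ', esum_zero]; ring
      rw [e]
      refine (norm_add_le _ _).trans (add_le_add (ih hA _) ?_)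
      rw [norm_mul]
      exact mul_le_mul_of_nonneg_left (ih hA _) (norm_nonneg _)

theorem norm_prod_sub_prod_le {ι : Type*} [DecidableEq ι] (A : Finset ι) (f g : ι → ℂ)
    (hf : ∀ i ∈ A, ‖f i‖ ≤ 1) (hg : ∀ i ∈ A, ‖g i‖ ≤ 1) :
    ‖∏ i ∈ A, f i - ∏ i ∈ A, g i‖ ≤ ∑ i ∈ A, ‖f i - g i‖ := by
  induction A using Finset.induction_on with
  | empty => simp
  | insert a A ha ih =>
    have ihA := ih (fun i hi => hf i (mem_insert_of_mem hi)) fun i hi => hg i (mem_insert_of_mem hi)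
    rw [prod_insert ha, prod_insert ha, sum_insert ha]
    have e : f a * ∏ i ∈ A, f i - g a * ∏ i ∈ A, g i
        = (f a - g a) * ∏ i ∈ A, f i + g a * (∏ i ∈ A, f i - ∏ i ∈ A, g i) := by ring
    rw [e]
    refine (norm_add_le _ _).trans (add_le_add ?_ ?_)
    · rw [norm_mul, norm_prod]
      exact mul_le_of_le_one_right (norm_nonneg _)
        (prod_le_one (fun _ _ => norm_nonneg _) fun i hi => hf i (mem_insert_of_mem hi))
    · rw [norm_mul]
      exact (mul_le_of_le_one_left (norm_nonneg _) (hg a (mem_insert_self _ _))).trans ihA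

theorem sum_Ico_periodic {R : Type*} [AddCommMonoid R] {h : ℕ → R} {d : ℕ}
    (hh : Function.Periodic h d) (A : ℕ) :
    ∑ t ∈ Ico A (A + d), h t = ∑ r ∈ range d, h r := by
  rw [← Nat.image_Ico_mod A d, sum_image]
  · exact sum_congr rfl fun t _ => (hh.map_mod_nat t).symm
  · exact Nat.mod_injOn_Ico A d

theorem sum_range_mul_of_coprime {R : Type*} [CommSemiring R] {f g : ℕ → R} {a b : ℕ}
    (ha : 0 < a) (hb : 0 < b) (hab : a.Coprime b) (hf : Function.Periodic f a)
    (hg : Function.Periodic g b) :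
    ∑ t ∈ range (a * b), f t * g t = (∑ r ∈ range a, f r) * ∑ r ∈ range b, g r := by
  rw [sum_mul_sum, ← sum_product']
  refine sum_nbij (fun t => (t % a, t % b)) ?_ ?_ ?_ ?_
  · intro t _
    simp [Nat.mod_lt _ ha, Nat.mod_lt _ hb]
  · intro t ht u hu h
    simp only [Prod.mk.injEq] at h
    have : t ≡ u [MOD a * b] := (Nat.modEq_and_modEq_iff_modEq_mul hab).1 h
    simp only [coe_range, Set.mem_Iio] at ht hu
    exact Nat.ModEq.eq_of_lt_of_lt this ht hu
  · rintro ⟨r, s⟩ hrs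
    simp only [coe_product, coe_range, Set.mem_prod, Set.mem_Iio] at hrs
    obtain ⟨k, hk⟩ := Nat.chineseRemainder hab r s
    refine ⟨k % (a * b), by simpa using Nat.mod_lt _ (Nat.mul_pos ha hb), ?_⟩
    simp only [Nat.mod_mul_right_mod, Nat.mod_mul_left_mod, Prod.mk.injEq]
    exact ⟨by rw [hk.1, Nat.mod_eq_of_lt hrs.1], by rw [hk.2, Nat.mod_eq_of_lt hrs.2]⟩
  · intro t _
    simp only [hf.map_mod_nat, hg.map_mod_nat]

theorem periodic_prod {R : Type*} [CommSemiring R] {S : Finset ℕ} {h : ℕ → ℕ → R}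
    (hh : ∀ q ∈ S, Function.Periodic (h q) q) :
    Function.Periodic (fun t => ∏ q ∈ S, h q t) (∏ q ∈ S, q) := by
  intro t
  refine prod_congr rfl fun q hq => ?_
  obtain ⟨c, hc⟩ := dvd_prod_of_mem (fun q => q) hq
  have := (hh q hq).nat_mul c t
  simp only [Nat.cast_id] at this
  rw [show (∏ q ∈ S, q) = c * q by rw [hc, mul_comm], this]

theorem sum_range_prod {R : Type*} [CommSemiring R] {S : Finset ℕ} (hS : ∀ q ∈ S, q.Prime)
    {h : ℕ → ℕ → R} (hh : ∀ q ∈ S, Function.Periodic (h q) q) :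
    ∑ t ∈ range (∏ q ∈ S, q), ∏ q ∈ S, h q t = ∏ q ∈ S, ∑ r ∈ range q, h q r := by
  induction S using Finset.induction_on with
  | empty => simp
  | insert p S hp ih =>
    have hS' : ∀ q ∈ S, q.Prime := fun q hq => hS q (mem_insert_of_mem hq)
    have hh' : ∀ q ∈ S, Function.Periodic (h q) q := fun q hq => hh q (mem_insert_of_mem hq)
    rw [prod_insert hp, prod_insert hp, ← ih hS' hh', ← sum_range_mul_of_coprime
      (hS p (mem_insert_self _ _)).pos (prod_pos fun q hq => (hS' q hq).pos) _
      (hh p (mem_insert_self _ _)) (periodic_prod hh')]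
    · exact sum_congr rfl fun t _ => prod_insert hp
    · refine Nat.Coprime.prod_right fun q hq => ?_
      rw [Nat.coprime_primes (hS p (mem_insert_self _ _)) (hS' q hq)]
      rintro rfl
      exact hp hq

theorem norm_sum_Ico_periodic_sub_le {𝕜 : Type*} [RCLike 𝕜] {h : ℕ → 𝕜} {d : ℕ} (hd : 0 < d)
    (hh : Function.Periodic h d) (A T : ℕ) :
    ‖∑ t ∈ Ico A (A + T), h t - T * ((∑ r ∈ range d, h r) / d)‖
      ≤ 2 * ∑ r ∈ range d, ‖h r‖ := by
  have hfull : ∀ k, ∑ t ∈ Ico A (A + d * k), h t = k * ∑ r ∈ range d, h r := by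
    intro k
    induction k with
    | zero => simp
    | succ k ih =>
      rw [← sum_Ico_consecutive h (n := A + d * k) (by omega) (by rw [mul_add]; omega), ih,
        mul_add, mul_one, ← add_assoc, sum_Ico_periodic hh]
      push_cast; ring
  have hnorm : Function.Periodic (fun t => ‖h t‖) d := fun t => by simp only [hh t]
  have hTd := Nat.div_add_mod T d
  have hr := Nat.mod_lt T hd
  set k := T / d
  set r := T % d
  have hdR : (d : 𝕜) ≠ 0 := by exact_mod_cast hd.ne'
  have e : ∑ t ∈ Ico A (A + T), h t - T * ((∑ r ∈ range d, h r) / d)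
      = ∑ t ∈ Ico (A + d * k) (A + T), h t - (r / d : 𝕜) * ∑ r ∈ range d, h r := by
    rw [← sum_Ico_consecutive h (n := A + d * k) (by omega) (by omega), hfull]
    have : (T : 𝕜) = d * k + r := by exact_mod_cast hTd.symm
    rw [this]
    field_simp
    ring
  rw [e, two_mul]
  refine (norm_sub_le _ _).trans (add_le_add ?_ ?_)
  · refine (norm_sum_le _ _).trans ?_
    rw [← sum_Ico_periodic hnorm (A + d * k)]
    exact sum_le_sum_of_subset_of_nonneg (Ico_subset_Ico_right (by omega))
      fun _ _ _ => norm_nonneg _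
  · rw [norm_mul]
    refine (mul_le_of_le_one_left (norm_nonneg _) ?_).trans (norm_sum_le _ _)
    rw [norm_div, RCLike.norm_natCast, RCLike.norm_natCast]
    exact div_le_one_of_le₀ (by exact_mod_cast hr.le) (Nat.cast_nonneg _)

theorem norm_sum_Ico_prod_sub_le {𝕜 : Type*} [RCLike 𝕜] {S : Finset ℕ} (hS : ∀ q ∈ S, q.Prime)
    {h : ℕ → ℕ → 𝕜} (hh : ∀ q ∈ S, Function.Periodic (h q) q) {C : ℝ}
    (hC : ∀ q ∈ S, ∑ r ∈ range q, ‖h q r‖ ≤ C) (A T : ℕ) :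
    ‖∑ t ∈ Ico A (A + T), ∏ q ∈ S, h q t - T * ∏ q ∈ S, ((∑ r ∈ range q, h q r) / q)‖
      ≤ 2 * C ^ S.card := by
  have h1 := norm_sum_Ico_periodic_sub_le (prod_pos fun q hq => (hS q hq).pos)
    (periodic_prod hh) A T
  rw [sum_range_prod hS hh] at h1
  rw [prod_div_distrib, ← Nat.cast_prod]
  refine h1.trans ?_
  simp only [norm_prod]
  have hn : ∀ q ∈ S, Function.Periodic (fun t => ‖h q t‖) q := fun q hq t => by
    simp only [hh q hq t]
  rw [sum_range_prod hS hn, ← prod_const]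
  gcongr with q hq
  exact hC q hq

theorem sum_range_choose_mul_pow_le (n K : ℕ) {C : ℝ} (hC : 0 ≤ C) :
    ∑ j ∈ range (K + 1), (n.choose j : ℝ) * C ^ j ≤ (1 + C * n) ^ K := by
  rw [add_comm 1 (C * n), add_pow]
  refine sum_le_sum fun j hj => ?_
  have hj' : j ≤ K := by simpa [Nat.lt_succ_iff] using hj
  have h1 : (n.choose j : ℝ) ≤ (n : ℝ) ^ j := by exact_mod_cast Nat.choose_le_pow n j
  have h2 : (1 : ℝ) ≤ K.choose j := by exact_mod_cast Nat.choose_pos hj'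
  rw [one_pow, mul_one, mul_pow]
  calc (n.choose j : ℝ) * C ^ j ≤ (n : ℝ) ^ j * C ^ j := by gcongr
    _ = C ^ j * n ^ j * 1 := by ring
    _ ≤ _ := by gcongr

/-- A truncated inclusion–exclusion estimate for the mean value over an interval of a product of
functions with coprime periods. -/
theorem norm_sum_prod_one_add_sub_le {Q : Finset ℕ} (hQ : ∀ q ∈ Q, q.Prime) {g : ℕ → ℕ → ℂ}
    (hper : ∀ q ∈ Q, Function.Periodic (g q) q) (hg : ∀ q ∈ Q, ∀ t, ‖1 + g q t‖ ≤ 1) {C : ℝ}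
    (hC0 : 0 ≤ C) (hC : ∀ q ∈ Q, ∑ r ∈ range q, ‖g q r‖ ≤ C) (K A T : ℕ) :
    ‖∑ t ∈ Ico A (A + T), ∏ q ∈ Q, (1 + g q t)
        - T * ∏ q ∈ Q, (1 + (∑ r ∈ range q, g q r) / q)‖
      ≤ 2 * T * ((C * ∑ q ∈ Q, (1 / q : ℝ)) ^ K / K.factorial) + 2 * (1 + C * Q.card) ^ K := by
  have hsub : ∀ {j S}, S ∈ Q.powersetCard j → S ⊆ Q := fun h => (mem_powersetCard.1 h).1
  set a : ℕ → ℂ := fun q => (∑ r ∈ range q, g q r) / q with ha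
  set b : ℕ → ℝ := fun q => (∑ r ∈ range q, ‖g q r‖) / q with hb
  have hb0 : ∀ q ∈ Q, 0 ≤ b q := fun q _ => by positivity
  have hab : ∀ q ∈ Q, ‖a q‖ ≤ b q := fun q _ => by
    simp only [ha, hb]
    rw [norm_div, Complex.norm_natCast]
    gcongr
    exact norm_sum_le _ _
  have ha1 : ∀ q ∈ Q, ‖1 + a q‖ ≤ 1 := fun q hq => by
    have hq0 : (q : ℂ) ≠ 0 := by exact_mod_cast (hQ q hq).ne_zero
    have hq0' : (0 : ℝ) < q := by exact_mod_cast (hQ q hq).pos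
    have : 1 + a q = (∑ r ∈ range q, (1 + g q r)) / q := by
      rw [ha, sum_add_distrib]; simp; field_simp
    rw [this, norm_div, Complex.norm_natCast, div_le_one hq0']
    refine (norm_sum_le _ _).trans ((sum_le_sum fun r _ => hg q hq r).trans (by simp))
  have hE : esum b Q K ≤ (C * ∑ q ∈ Q, (1 / q : ℝ)) ^ K / K.factorial := by
    rw [le_div_iff₀ (by positivity), mul_comm]
    refine (factorial_mul_esum_le Q hb0 K).trans ?_
    refine pow_le_pow_left₀ (sum_nonneg hb0) ?_ K
    rw [mul_sum]
    refine sum_le_sum fun q hq => ?_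
    simp only [hb]
    rw [mul_one_div]
    gcongr
    exact hC q hq
  have h1 : ‖∑ t ∈ Ico A (A + T), ∏ q ∈ Q, (1 + g q t)
      - ∑ t ∈ Ico A (A + T), ∑ j ∈ range K, esum (fun q => g q t) Q j‖
      ≤ T * esum b Q K + 2 * (Q.card.choose K * C ^ K) := by
    rw [← sum_sub_distrib]
    refine (norm_sum_le _ _).trans ((sum_le_sum fun t _ =>
      norm_prod_one_add_sub_sum_le Q _ (fun q hq => hg q hq t) K).trans ?_)
    unfold esum
    rw [sum_comm, mul_sum]
    have : ∀ S ∈ Q.powersetCard K, ∑ t ∈ Ico A (A + T), ∏ q ∈ S, ‖g q t‖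
        ≤ T * ∏ q ∈ S, b q + 2 * C ^ K := fun S hS => by
      have := norm_sum_Ico_prod_sub_le (𝕜 := ℝ) (S := S) (fun q hq => hQ q (hsub hS hq))
        (h := fun q t => ‖g q t‖) (fun q hq t => by simp only [hper q (hsub hS hq) t])
        (C := C) (fun q hq => by simpa using hC q (hsub hS hq)) A T
      rw [Real.norm_eq_abs, (mem_powersetCard.1 hS).2] at this
      linarith [(abs_le.1 this).2]
    refine (sum_le_sum this).trans ?_
    rw [sum_add_distrib, sum_const, card_powersetCard, nsmul_eq_mul]
    linarith
  have h2 : ‖∑ t ∈ Ico A (A + T), ∑ j ∈ range K, esum (fun q => g q t) Q j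
      - T * ∑ j ∈ range K, esum a Q j‖ ≤ 2 * ∑ j ∈ range K, (Q.card.choose j * C ^ j) := by
    rw [sum_comm, mul_sum, ← sum_sub_distrib, mul_sum]
    refine (norm_sum_le _ _).trans (sum_le_sum fun j _ => ?_)
    unfold esum
    rw [sum_comm, mul_sum, ← sum_sub_distrib]
    refine (norm_sum_le _ _).trans ((sum_le_sum fun S hS => ?_).trans_eq
      (b := ∑ S ∈ Q.powersetCard j, 2 * C ^ j) ?_)
    · have := norm_sum_Ico_prod_sub_le (𝕜 := ℂ) (S := S) (fun q hq => hQ q (hsub hS hq))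
        (h := g) (fun q hq => hper q (hsub hS hq))
        (C := C) (fun q hq => hC q (hsub hS hq)) A T
      rwa [(mem_powersetCard.1 hS).2] at this
    · rw [sum_const, card_powersetCard, nsmul_eq_mul]; ring
  have h3 : ‖(T : ℂ) * ∑ j ∈ range K, esum a Q j - T * ∏ q ∈ Q, (1 + a q)‖ ≤ T * esum b Q K := by
    rw [← mul_sub, norm_mul, Complex.norm_natCast, norm_sub_rev]
    gcongr
    exact (norm_prod_one_add_sub_sum_le Q a ha1 K).trans
      (esum_mono (fun _ _ => norm_nonneg _) hab K)
  have h4 := sum_range_choose_mul_pow_le Q.card K hC0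
  rw [sum_range_succ] at h4
  calc _ ≤ _ := (norm_sub_le_norm_sub_add_norm_sub _ _ _).trans
        (add_le_add_right ((norm_sub_le_norm_sub_add_norm_sub _ _ _).trans
          (add_le_add h2 h3)) _)
    _ ≤ _ := add_le_add_left h1 _
    _ ≤ 2 * T * esum b Q K + 2 * (1 + C * Q.card) ^ K := by linarith
    _ ≤ _ := by gcongr

theorem log_factorial_eq_sum_primesLE (n : ℕ) :
    Real.log n.factorial = ∑ p ∈ n.primesLE, (n.factorial.factorization p : ℝ) * Real.log p := by
  rw [Real.log_nat_eq_sum_factorization, Finsupp.sum]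
  refine sum_subset (fun p hp => ?_) fun p _ hp => ?_
  · have hp' : p ∈ n.factorial.primeFactors := by simpa using hp
    have := Nat.prime_of_mem_primeFactors hp'
    exact Nat.mem_primesLE.2 ⟨(this.dvd_factorial).1 (Nat.dvd_of_mem_primeFactors hp'), this⟩
  · simp [Finsupp.notMem_support_iff.1 hp]

theorem log_div_mul_pred_le {n : ℕ} (hn : 2 ≤ n) :
    Real.log n / (n * (n - 1)) ≤ 4 * (1 / (n : ℝ) ^ (3 / 2 : ℝ)) := by
  have hn' : (2 : ℝ) ≤ n := by exact_mod_cast hn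
  have h1 : Real.log n ≤ (n : ℝ) ^ (1 / 2 : ℝ) / (1 / 2) :=
    Real.log_le_rpow_div (by linarith) (by norm_num)
  have h2 : (n : ℝ) ^ (1 / 2 : ℝ) * (n : ℝ) ^ (3 / 2 : ℝ) = n ^ 2 := by
    rw [← Real.rpow_add (by linarith)]; norm_num
  have h3 : 0 < (n : ℝ) ^ (3 / 2 : ℝ) := by positivity
  rw [mul_one_div, div_le_div_iff₀ (by nlinarith) h3]
  calc Real.log n * (n : ℝ) ^ (3 / 2 : ℝ)
      ≤ (n : ℝ) ^ (1 / 2 : ℝ) / (1 / 2) * (n : ℝ) ^ (3 / 2 : ℝ) := by gcongr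
    _ = 2 * (n : ℝ) ^ 2 := by rw [← h2]; ring
    _ ≤ 4 * (n * (n - 1)) := by nlinarith

/-- Mertens' first theorem. -/
theorem exists_abs_sum_log_div_sub_log_le :
    ∃ C : ℝ, 0 ≤ C ∧ ∀ n : ℕ, 1 ≤ n → |∑ p ∈ n.primesLE, Real.log p / p - Real.log n| ≤ C := by
  have hs : Summable fun n : ℕ => 1 / (n : ℝ) ^ (3 / 2 : ℝ) :=
    Real.summable_one_div_nat_rpow.2 (by norm_num)
  refine ⟨Real.log 4 + 1 + 4 * ∑' n : ℕ, 1 / (n : ℝ) ^ (3 / 2 : ℝ), ?_, fun n hn => ?_⟩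
  · have : 0 ≤ ∑' n : ℕ, 1 / (n : ℝ) ^ (3 / 2 : ℝ) := tsum_nonneg fun n => by positivity
    have := Real.log_nonneg (show (1 : ℝ) ≤ 4 by norm_num)
    linarith
  have hS : ∑ p ∈ n.primesLE, 1 / (p : ℝ) ^ (3 / 2 : ℝ) ≤ ∑' n : ℕ, 1 / (n : ℝ) ^ (3 / 2 : ℝ) :=
    hs.sum_le_tsum _ fun n _ => by positivity
  have hS0 : 0 ≤ ∑ p ∈ n.primesLE, 1 / (p : ℝ) ^ (3 / 2 : ℝ) := sum_nonneg fun n _ => by positivity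
  have hn' : (0 : ℝ) < n := by exact_mod_cast hn
  have hl4 := Real.log_nonneg (show (1 : ℝ) ≤ 4 by norm_num)
  have hlog0 : ∀ p ∈ n.primesLE, 0 ≤ Real.log p := fun p _ => Real.log_natCast_nonneg p
  have hfac := log_factorial_eq_sum_primesLE n
  have hup : Real.log n.factorial ≤ n * Real.log n := by
    rw [← Real.log_pow]
    exact Real.log_le_log (by positivity) (by exact_mod_cast n.factorial_le_pow)
  have hlow : n * Real.log n - n ≤ Real.log n.factorial := by
    have := Stirling.le_log_factorial_stirling (n := n) (by omega)
    have h1 := Real.log_natCast_nonneg n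
    have h2 : 0 ≤ Real.log (2 * Real.pi) := Real.log_nonneg (by nlinarith [Real.pi_gt_three])
    linarith
  have hth : ∑ p ∈ n.primesLE, Real.log p ≤ Real.log 4 * n := by
    rw [← Chebyshev.theta_eq_sum_primesLE_log]
    exact Chebyshev.theta_le_log4_mul_x hn'.le
  rw [abs_le]
  constructor
  · have h1 : Real.log n.factorial
        ≤ n * (∑ p ∈ n.primesLE, Real.log p / p
            + 4 * ∑ p ∈ n.primesLE, 1 / (p : ℝ) ^ (3 / 2 : ℝ)) := by
      rw [hfac, mul_sum, ← sum_add_distrib, mul_sum]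
      refine sum_le_sum fun p hp => ?_
      have hpp := Nat.prime_of_mem_primesLE hp
      have hp2 : (2 : ℝ) ≤ p := by exact_mod_cast hpp.two_le
      have h3 : (n.factorial.factorization p : ℝ) ≤ n / (p - 1) := by
        have := Nat.factorization_factorial_le_div_pred hpp n
        calc (n.factorial.factorization p : ℝ) ≤ ((n / (p - 1) : ℕ) : ℝ) := by exact_mod_cast this
          _ ≤ (n : ℝ) / ((p - 1 : ℕ) : ℝ) := Nat.cast_div_le
          _ = _ := by rw [Nat.cast_sub hpp.one_le]; simp
      have h4 := log_div_mul_pred_le hpp.two_le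
      calc _ ≤ n / (p - 1) * Real.log p := mul_le_mul_of_nonneg_right h3 (hlog0 p hp)
        _ = n * (Real.log p / p + Real.log p / (p * (p - 1))) := by
          have : (p : ℝ) - 1 ≠ 0 := by linarith
          field_simp; ring
        _ ≤ _ := by gcongr
    have h2 : Real.log n - 1
        ≤ ∑ p ∈ n.primesLE, Real.log p / p + 4 * ∑ p ∈ n.primesLE, 1 / (p : ℝ) ^ (3 / 2 : ℝ) := by
      refine le_of_mul_le_mul_left ?_ hn'
      linarith
    linarith
  · have h1 : n * ∑ p ∈ n.primesLE, Real.log p / p - ∑ p ∈ n.primesLE, Real.log p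
        ≤ Real.log n.factorial := by
      rw [hfac, mul_sum, ← sum_sub_distrib]
      refine sum_le_sum fun p hp => ?_
      obtain ⟨hpn, hpp⟩ := Nat.mem_primesLE.1 hp
      have h3 : n / p ≤ n.factorial.factorization p := by
        rw [Nat.factorization_factorial hpp (Nat.lt_add_one _)]
        have : 1 ∈ Ico 1 (Nat.log p n + 1) := by
          have := Nat.log_pos hpp.one_lt hpn
          exact mem_Ico.2 ⟨le_rfl, by omega⟩
        simpa using single_le_sum (f := fun i => n / p ^ i) (fun _ _ => Nat.zero_le _) this
      have h4 : (n : ℝ) / p - 1 ≤ n.factorial.factorization p := by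
        have h5 : (n : ℝ) / p < (n / p : ℕ) + 1 := by
          rw [← Nat.floor_div_eq_div (K := ℝ)]
          exact Nat.lt_floor_add_one _
        have : ((n / p : ℕ) : ℝ) ≤ n.factorial.factorization p := by exact_mod_cast h3
        linarith
      calc _ = ((n : ℝ) / p - 1) * Real.log p := by ring
        _ ≤ _ := mul_le_mul_of_nonneg_right h4 (hlog0 p hp)
    have h2 : ∑ p ∈ n.primesLE, Real.log p / p ≤ Real.log n + Real.log 4 := by
      refine le_of_mul_le_mul_left ?_ hn'
      linarith
    linarith

theorem sum_primesLE_succ (f : ℕ → ℝ) (n : ℕ) :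
    ∑ p ∈ (n + 1).primesLE, f p
      = ∑ p ∈ n.primesLE, f p + if (n + 1).Prime then f (n + 1) else 0 := by
  simp only [Nat.primesLE_eq_filter_range, sum_filter]
  rw [sum_range_succ]

/-- Mertens' second theorem. -/
theorem exists_abs_sum_inv_sub_log_log_le :
    ∃ C : ℝ, 0 ≤ C ∧ ∀ n : ℕ, 2 ≤ n →
      |∑ p ∈ n.primesLE, 1 / (p : ℝ) - Real.log (Real.log n)| ≤ C := by
  obtain ⟨C, hC0, hC⟩ := exists_abs_sum_log_div_sub_log_le
  have hl2 : 1 / 2 ≤ Real.log 2 := by linarith [Real.log_two_gt_d9]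
  set A : ℕ → ℝ := fun n => ∑ p ∈ n.primesLE, Real.log p / p with hA
  set S : ℕ → ℝ := fun n => ∑ p ∈ n.primesLE, 1 / (p : ℝ) with hS
  set D : ℕ → ℝ := fun n => S n - A n / Real.log n - Real.log (Real.log n) with hD
  have key : ∀ n : ℕ, 2 ≤ n →
      |D n| ≤ |D 2| + C * (1 / Real.log 2 - 1 / Real.log n) + 4 * (1 - 1 / ((n : ℝ) - 1)) := by
    intro n hn
    induction n, hn using Nat.le_induction with
    | base => norm_num
    | succ n hn ih =>
      have hn' : (2 : ℝ) ≤ n := by exact_mod_cast hn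
      set l := Real.log n with hl
      set l' := Real.log (n + 1) with hl'
      have hll : Real.log 2 ≤ l := Real.log_le_log (by norm_num) hn'
      have hll' : l ≤ l' := Real.log_le_log (by linarith) (by linarith)
      have hdiff : l' - l ≤ 1 / n := by
        rw [hl, hl', ← Real.log_div (by linarith) (by linarith)]
        refine (Real.log_le_sub_one_of_pos (by positivity)).trans_eq ?_
        field_simp; ring
      have hl0 : 0 < l := by linarith
      have hl0' : 0 < l' := by linarith
      have hstep : D (n + 1) - D n = A n * (1 / l - 1 / l') - (Real.log l' - Real.log l) := by
        simp only [hD, hS, hA, sum_primesLE_succ]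
        push_cast
        rw [← hl, ← hl']
        split_ifs
        · field_simp; ring
        · field_simp; ring
      have e1 : |(A n - l) * (1 / l - 1 / l')| ≤ C * (1 / l - 1 / l') := by
        have h0 : 0 ≤ 1 / l - 1 / l' := sub_nonneg.2 (one_div_le_one_div_of_le hl0 hll')
        rw [abs_mul, abs_of_nonneg h0]
        exact mul_le_mul_of_nonneg_right (hC n (by omega)) h0
      have e2 : |l * (1 / l - 1 / l') - (Real.log l' - Real.log l)| ≤ 4 * (1 / (n : ℝ)) ^ 2 := by
        have a1 : Real.log l' - Real.log l ≤ l' / l - 1 := by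
          rw [← Real.log_div hl0'.ne' hl0.ne']
          exact Real.log_le_sub_one_of_pos (by positivity)
        have a2 : 1 - l / l' ≤ Real.log l' - Real.log l := by
          have := Real.log_le_sub_one_of_pos (show 0 < l / l' by positivity)
          rw [Real.log_div hl0.ne' hl0'.ne'] at this
          linarith
        have a3 : l * (1 / l - 1 / l') = 1 - l / l' := by field_simp
        have a4 : (l' / l - 1) - (1 - l / l') = (l' - l) ^ 2 / (l * l') := by
          field_simp
        have a5 : (l' - l) ^ 2 / (l * l') ≤ 4 * (1 / (n : ℝ)) ^ 2 := by
          rw [div_le_iff₀ (by positivity)]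
          have h5 : (l' - l) ^ 2 ≤ (1 / (n : ℝ)) ^ 2 :=
            pow_le_pow_left₀ (by linarith) hdiff 2
          have h6 : 1 / 4 ≤ l * l' := by nlinarith
          nlinarith [sq_nonneg (1 / (n : ℝ))]
        rw [a3, abs_le]
        constructor <;> linarith
      have e3 : (1 / (n : ℝ)) ^ 2 ≤ 1 / ((n : ℝ) - 1) - 1 / n := by
        have : (n : ℝ) - 1 ≠ 0 := by linarith
        rw [show 1 / ((n : ℝ) - 1) - 1 / n = 1 / ((n - 1) * n) by field_simp; ring, div_pow,
          one_pow]
        exact one_div_le_one_div_of_le (by nlinarith) (by nlinarith)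
      have e4 : D (n + 1) = D n + ((A n - l) * (1 / l - 1 / l')
          + (l * (1 / l - 1 / l') - (Real.log l' - Real.log l))) := by
        linear_combination hstep
      have e5 := abs_add_le (D n) ((A n - l) * (1 / l - 1 / l')
          + (l * (1 / l - 1 / l') - (Real.log l' - Real.log l)))
      have e6 := abs_add_le ((A n - l) * (1 / l - 1 / l'))
          (l * (1 / l - 1 / l') - (Real.log l' - Real.log l))
      rw [← e4] at e5
      push_cast
      rw [← hl', add_sub_cancel_right]
      linarith
  refine ⟨|D 2| + C * (1 / Real.log 2) + 4 + (1 + C / Real.log 2), by positivity, fun n hn => ?_⟩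
  have hn' : (2 : ℝ) ≤ n := by exact_mod_cast hn
  have hll : Real.log 2 ≤ Real.log n := Real.log_le_log (by norm_num) hn'
  have hl0 : Real.log n ≠ 0 := by linarith
  have h1 := key n hn
  have h2 : |A n / Real.log n| ≤ 1 + C / Real.log 2 := by
    rw [show A n / Real.log n = 1 + (A n - Real.log n) / Real.log n by field_simp; ring]
    refine (abs_add_le _ _).trans ?_
    rw [abs_one, abs_div, abs_of_pos (show 0 < Real.log n by linarith)]
    gcongr
    exact hC n (by omega)
  have h3 : 0 ≤ C * (1 / Real.log n) := by positivity
  have h4 : 0 ≤ 1 / ((n : ℝ) - 1) := by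
    have : (0 : ℝ) ≤ n - 1 := by linarith
    positivity
  have h5 : S n - Real.log (Real.log n) = D n + A n / Real.log n := by simp only [hD]; ring
  change |S n - Real.log (Real.log n)| ≤ _
  rw [h5]
  refine (abs_add_le _ _).trans ?_
  linarith

/-- The primes in the interval `(a, b]`. -/
noncomputable def primesIoc (a b : ℝ) : Finset ℕ := {p ∈ Ioc ⌊a⌋₊ ⌊b⌋₊ | p.Prime}

theorem mem_primesIoc {a b : ℝ} (ha : 0 ≤ a) (hb : 0 ≤ b) {p : ℕ} :
    p ∈ primesIoc a b ↔ (a < p ∧ (p : ℝ) ≤ b) ∧ p.Prime := by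
  rw [primesIoc, mem_filter, mem_Ioc, Nat.floor_lt ha, Nat.le_floor_iff hb]

theorem prime_of_mem_primesIoc {a b : ℝ} {p : ℕ} (hp : p ∈ primesIoc a b) : p.Prime :=
  (mem_filter.1 hp).2

theorem card_primesIoc_le {a b : ℝ} (hb : 0 ≤ b) : ((primesIoc a b).card : ℝ) ≤ b := by
  refine le_trans ?_ (Nat.floor_le hb)
  have := card_filter_le (Ioc ⌊a⌋₊ ⌊b⌋₊) Nat.Prime
  rw [Nat.card_Ioc] at this
  exact_mod_cast this.trans (Nat.sub_le _ _)

theorem abs_log_log_sub_log_log_floor_le {x : ℝ} (hx : 2 ≤ x) :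
    |Real.log (Real.log x) - Real.log (Real.log ⌊x⌋₊)| ≤ Real.log 2 := by
  have h2 : 2 ≤ ⌊x⌋₊ := Nat.le_floor (by exact_mod_cast hx)
  have h2' : (2 : ℝ) ≤ ⌊x⌋₊ := by exact_mod_cast h2
  have hle := Nat.floor_le (show 0 ≤ x by linarith)
  have hlt := Nat.lt_floor_add_one x
  have hl2 : 0 < Real.log 2 := Real.log_pos (by norm_num)
  have ha : Real.log 2 ≤ Real.log ⌊x⌋₊ := Real.log_le_log (by norm_num) h2'
  have hb : Real.log ⌊x⌋₊ ≤ Real.log x := Real.log_le_log (by linarith) hle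
  have hc : Real.log x ≤ 2 * Real.log ⌊x⌋₊ := by
    have : Real.log x ≤ Real.log (2 * ⌊x⌋₊) := Real.log_le_log (by linarith) (by linarith)
    rw [Real.log_mul (by norm_num) (by linarith)] at this
    linarith
  have hd : Real.log (Real.log ⌊x⌋₊) ≤ Real.log (Real.log x) := Real.log_le_log (by linarith) hb
  have he : Real.log (Real.log x) ≤ Real.log (2 * Real.log ⌊x⌋₊) :=
    Real.log_le_log (by linarith) hc
  rw [Real.log_mul (by norm_num) (by linarith)] at he
  rw [abs_le]
  constructor <;> linarith

theorem exists_abs_sum_primesIoc_zero_le :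
    ∃ C : ℝ, 0 ≤ C ∧ ∀ b : ℝ, 2 ≤ b →
      |∑ p ∈ primesIoc 0 b, 1 / (p : ℝ) - Real.log (Real.log b)| ≤ C := by
  obtain ⟨C, hC0, hC⟩ := exists_abs_sum_inv_sub_log_log_le
  refine ⟨C + Real.log 2, add_nonneg hC0 (Real.log_nonneg (by norm_num)), fun b hb => ?_⟩
  have h2 : 2 ≤ ⌊b⌋₊ := Nat.le_floor (by exact_mod_cast hb)
  have h := hC _ h2
  have h' := abs_log_log_sub_log_log_floor_le hb
  have : primesIoc 0 b = Nat.primesLE ⌊b⌋₊ := by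
    rw [primesIoc, Nat.floor_zero, Nat.primesLE_eq_filter_Ioc_zero]
  rw [this]
  rw [abs_le] at *
  constructor <;> linarith [h.1, h.2, h'.1, h'.2]

theorem exists_abs_sum_primesIoc_le :
    ∃ C : ℝ, 0 ≤ C ∧ ∀ a b : ℝ, 2 ≤ a → a ≤ b →
      |∑ p ∈ primesIoc a b, 1 / (p : ℝ) - (Real.log (Real.log b) - Real.log (Real.log a))|
        ≤ C := by
  obtain ⟨C, hC0, hC⟩ := exists_abs_sum_primesIoc_zero_le
  refine ⟨2 * C, by positivity, fun a b ha hab => ?_⟩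
  have h1 := hC a ha
  have h2 := hC b (ha.trans hab)
  have hsum : ∑ p ∈ primesIoc 0 b, 1 / (p : ℝ)
      = ∑ p ∈ primesIoc 0 a, 1 / (p : ℝ) + ∑ p ∈ primesIoc a b, 1 / (p : ℝ) := by
    simp only [primesIoc, sum_filter, Nat.floor_zero]
    rw [sum_Ioc_consecutive _ (Nat.zero_le _) (Nat.floor_mono hab)]
  rw [abs_le] at *
  constructor <;> linarith [h1.1, h1.2, h2.1, h2.2]

theorem prod_sub_one_mul_prod_ne {A B : Finset ℕ} (hA : ∀ p ∈ A, p.Prime) (hB : ∀ p ∈ B, p.Prime)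
    (hAB : Disjoint A B) {P : ℕ} (hP : P ∈ A) (hmax : ∀ p ∈ A, p ≤ P) :
    (∏ p ∈ A, (p - 1)) * ∏ p ∈ B, p ≠ (∏ p ∈ B, (p - 1)) * ∏ p ∈ A, p := by
  intro h
  have hPp := hA P hP
  have hdvd : P ∣ (∏ p ∈ A, (p - 1)) * ∏ p ∈ B, p :=
    h ▸ (dvd_prod_of_mem (fun p => p) hP).mul_left _
  rcases hPp.dvd_mul.1 hdvd with h1 | h1
  · obtain ⟨p, hp, hd⟩ := (hPp.prime.dvd_finsetProd_iff _).1 h1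
    have := Nat.le_of_dvd (by have := (hA p hp).two_le; omega) hd
    have := hmax p hp
    have := (hA p hp).two_le
    omega
  · obtain ⟨p, hp, hd⟩ := (hPp.prime.dvd_finsetProd_iff _).1 h1
    have := (Nat.prime_dvd_prime_iff_eq hPp (hB p hp)).1 hd
    exact disjoint_left.1 hAB hP (this ▸ hp)

theorem eq_of_prod_sub_one_mul_prod_eq {A B : Finset ℕ} (hA : ∀ p ∈ A, p.Prime)
    (hB : ∀ p ∈ B, p.Prime)
    (h : (∏ p ∈ A, (p - 1)) * ∏ p ∈ B, p = (∏ p ∈ B, (p - 1)) * ∏ p ∈ A, p) : A = B := by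
  have hC : (∏ p ∈ A ∩ B, (p - 1)) * ∏ p ∈ A ∩ B, p ≠ 0 := by
    refine mul_ne_zero (prod_ne_zero_iff.2 fun p hp => ?_) (prod_ne_zero_iff.2 fun p hp => ?_)
    · have := (hA p (mem_inter.1 hp).1).two_le; omega
    · exact (hA p (mem_inter.1 hp).1).ne_zero
  have h' : (∏ p ∈ A \ B, (p - 1)) * ∏ p ∈ B \ A, p = (∏ p ∈ B \ A, (p - 1)) * ∏ p ∈ A \ B, p := by
    refine mul_left_cancel₀ hC ?_
    have e : ∀ (f : ℕ → ℕ) (S T : Finset ℕ), (∏ p ∈ S ∩ T, f p) * ∏ p ∈ S \ T, f p = ∏ p ∈ S, f p :=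
      fun f S T => prod_inter_mul_prod_sdiff S T f
    have e1 := e (fun p => p - 1) A B
    have e2 := e (fun p => p) A B
    have e3 := e (fun p => p - 1) B A
    have e4 := e (fun p => p) B A
    rw [inter_comm B A] at e3 e4
    rw [← e1, ← e2, ← e3, ← e4] at h
    linarith
  have hA' : ∀ p ∈ A \ B, p.Prime := fun p hp => hA p (mem_sdiff.1 hp).1
  have hB' : ∀ p ∈ B \ A, p.Prime := fun p hp => hB p (mem_sdiff.1 hp).1
  have hd : Disjoint (A \ B) (B \ A) := disjoint_sdiff_sdiff
  have h1 : A \ B = ∅ := by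
    by_contra hne
    obtain ⟨P, hP, hmax⟩ := exists_max_image _ id (nonempty_iff_ne_empty.2 hne)
    exact prod_sub_one_mul_prod_ne hA' hB' hd hP hmax h'
  have h2 : B \ A = ∅ := by
    by_contra hne
    obtain ⟨P, hP, hmax⟩ := exists_max_image _ id (nonempty_iff_ne_empty.2 hne)
    exact prod_sub_one_mul_prod_ne hB' hA' hd.symm hP hmax h'.symm
  exact (sdiff_eq_empty_iff_subset.1 h1).antisymm (sdiff_eq_empty_iff_subset.1 h2)

theorem primeFactors_eq_of_totient_mul_eq {m n : ℕ} (hm : m ≠ 0) (hn : n ≠ 0)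
    (h : m.totient * n = n.totient * m) : m.primeFactors = n.primeFactors := by
  refine eq_of_prod_sub_one_mul_prod_eq (fun p => Nat.prime_of_mem_primeFactors)
    (fun p => Nat.prime_of_mem_primeFactors) ?_
  have h1 := Nat.totient_mul_prod_primeFactors m
  have h2 := Nat.totient_mul_prod_primeFactors n
  refine mul_left_cancel₀ (mul_ne_zero hm hn) ?_
  calc _ = (m * ∏ p ∈ m.primeFactors, (p - 1)) * (n * ∏ p ∈ n.primeFactors, p) := by ring
    _ = (m.totient * n) * ((∏ p ∈ m.primeFactors, p) * ∏ p ∈ n.primeFactors, p) := by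
      rw [← h1]; ring
    _ = (n * ∏ p ∈ n.primeFactors, (p - 1)) * (m * ∏ p ∈ m.primeFactors, p) := by
      rw [h, ← h2]; ring
    _ = _ := by ring

theorem card_filter_primeFactors_eq_le (M : ℕ) :
    ((((Icc 1 M ×ˢ Icc 1 M).filter fun p : ℕ × ℕ => p.1.primeFactors =
      p.2.primeFactors).card : ℕ) : ℝ)
      ≤ Nat.sqrt M * (M * (1 + Real.log M)) := by
  have hsub : (Icc 1 M ×ˢ Icc 1 M).filter (fun p : ℕ × ℕ => p.1.primeFactors = p.2.primeFactors)
      ⊆ (Icc 1 (Nat.sqrt M) ×ˢ (Icc 1 M).sigma fun u => Icc 1 (M / u)).image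
        fun z => (z.2.1 * z.2.2, z.1 ^ 2 * z.2.1) := by
    rintro ⟨m, n⟩ h
    simp only [mem_filter, mem_product, mem_Icc] at h
    obtain ⟨⟨⟨hm1, hmM⟩, hn1, hnM⟩, hr⟩ := h
    obtain ⟨u, s, hsu, hu⟩ := Nat.sq_mul_squarefree n
    have hs0 : s ≠ 0 := by rintro rfl; simp at hsu; omega
    have hu0 : u ≠ 0 := hu.ne_zero
    have hun : u ∣ n := ⟨s ^ 2, by rw [← hsu, mul_comm]⟩
    have hum : u ∣ m := by
      rw [← Nat.prod_primeFactors_of_squarefree hu]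
      refine (prod_dvd_prod_of_subset _ _ _ (Nat.primeFactors_mono hun (by omega))).trans ?_
      rw [← hr]
      exact Nat.prod_primeFactors_dvd m
    obtain ⟨k, rfl⟩ := hum
    have hk0 : k ≠ 0 := by rintro rfl; simp at hm1
    refine mem_image.2 ⟨(s, ⟨u, k⟩), ?_, by simp [hsu]⟩
    simp only [mem_product, mem_sigma, mem_Icc]
    refine ⟨⟨by omega, ?_⟩, ⟨by omega, (Nat.le_of_dvd (by omega) hun).trans hnM⟩, by omega, ?_⟩
    · rw [Nat.le_sqrt']
      exact (Nat.le_of_dvd (by omega) ⟨u, hsu.symm⟩).trans hnM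
    · rw [Nat.le_div_iff_mul_le (by omega), mul_comm]; exact hmM
  have h1 := (card_le_card hsub).trans card_image_le
  rw [card_product, card_sigma] at h1
  simp only [Nat.card_Icc, Nat.add_sub_cancel] at h1
  have h2 : ((∑ u ∈ Icc 1 M, M / u : ℕ) : ℝ) ≤ M * (1 + Real.log M) := by
    have := harmonic_le_one_add_log M
    rw [harmonic_eq_sum_Icc] at this
    push_cast at this ⊢
    refine (sum_le_sum fun u _ => Nat.cast_div_le).trans ?_
    simp only [div_eq_mul_inv]
    rw [← mul_sum]
    gcongr
  calc _ ≤ ((Nat.sqrt M * ∑ u ∈ Icc 1 M, M / u : ℕ) : ℝ) := by exact_mod_cast h1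
    _ ≤ _ := by rw [Nat.cast_mul]; gcongr

/-- A quantity whose prime divisors contain all primes for which the congruences attached to `m`
and `n` interact. -/
def resultant (m n : ℕ) : ℕ :=
  m * (m - m.totient) * (n * (n - n.totient)) * ((m.totient * n : ℤ) - n.totient * m).natAbs

theorem resultant_le {m n X : ℕ} (hm : m ≤ X) (hn : n ≤ X) : resultant m n ≤ X ^ 6 := by
  have h1 : m - m.totient ≤ X := (Nat.sub_le _ _).trans hm
  have h2 : n - n.totient ≤ X := (Nat.sub_le _ _).trans hn
  have h3 : ((m.totient * n : ℤ) - n.totient * m).natAbs ≤ X ^ 2 := by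
    have a1 : m.totient * n ≤ X ^ 2 := by
      rw [sq]; exact Nat.mul_le_mul (m.totient_le.trans hm) hn
    have a2 : n.totient * m ≤ X ^ 2 := by
      rw [sq]; exact Nat.mul_le_mul (n.totient_le.trans hn) hm
    zify at a1 a2 ⊢
    rw [abs_le]
    constructor
    · have : (0 : ℤ) ≤ m.totient * n := by positivity
      linarith
    · have : (0 : ℤ) ≤ n.totient * m := by positivity
      linarith
  calc resultant m n ≤ X * X * (X * X) * X ^ 2 := by unfold resultant; gcongr
    _ = X ^ 6 := by ring

theorem primeFactors_eq_of_resultant_eq_zero {m n : ℕ} (hm : 2 ≤ m) (hn : 2 ≤ n)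
    (h : resultant m n = 0) : m.primeFactors = n.primeFactors := by
  have h1 := Nat.totient_lt m (by omega)
  have h2 := Nat.totient_lt n (by omega)
  simp only [resultant, mul_eq_zero, Int.natAbs_eq_zero, sub_eq_zero] at h
  refine primeFactors_eq_of_totient_mul_eq (by omega) (by omega) ?_
  have : ((m.totient * n : ℤ) = n.totient * m) := by
    rcases h with ((h | h) | h | h) | h <;> first | exact h | omega
  exact_mod_cast this

theorem card_filter_resultant_eq_zero_le (M : ℕ) :
    ((((Icc 1 M ×ˢ Icc 1 M).filter fun p : ℕ × ℕ => resultant p.1 p.2 = 0).card : ℕ) : ℝ)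
      ≤ Nat.sqrt M * (M * (3 + Real.log M)) := by
  have hsub : (Icc 1 M ×ˢ Icc 1 M).filter (fun p : ℕ × ℕ => resultant p.1 p.2 = 0)
      ⊆ ({1} ×ˢ Icc 1 M ∪ Icc 1 M ×ˢ {1})
        ∪ (Icc 1 M ×ˢ Icc 1 M).filter (fun p : ℕ × ℕ => p.1.primeFactors = p.2.primeFactors) := by
    rintro ⟨m, n⟩ h
    simp only [mem_filter, mem_product, mem_Icc, mem_union, mem_singleton] at h ⊢
    rcases eq_or_ne m 1 with hm | hm
    · exact Or.inl (Or.inl ⟨hm, h.1.2⟩)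
    rcases eq_or_ne n 1 with hn | hn
    · exact Or.inl (Or.inr ⟨h.1.1, hn⟩)
    exact Or.inr ⟨h.1, primeFactors_eq_of_resultant_eq_zero (by omega) (by omega) h.2⟩
  have h1 := (card_le_card hsub).trans ((card_union_le _ _).trans
    (add_le_add_left (card_union_le _ _) _))
  rw [card_product, card_product] at h1
  simp only [Nat.card_Icc, Nat.add_sub_cancel, card_singleton, one_mul, mul_one] at h1
  have h2 := card_filter_primeFactors_eq_le M
  have h3 : ((M + M : ℕ) : ℝ) ≤ Nat.sqrt M * (M * 2) := by
    rcases Nat.eq_zero_or_pos M with rfl | hM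
    · simp
    have : (1 : ℝ) ≤ Nat.sqrt M := by exact_mod_cast Nat.sqrt_pos.2 hM
    push_cast
    have hM' : (0 : ℝ) ≤ M := by positivity
    nlinarith
  have h4 : ((((Icc 1 M ×ˢ Icc 1 M).filter fun p : ℕ × ℕ => resultant p.1 p.2 = 0).card : ℕ) : ℝ)
    ≤ ((M + M : ℕ) : ℝ) + ((((Icc 1 M ×ˢ Icc 1 M).filter fun p : ℕ × ℕ =>
      p.1.primeFactors = p.2.primeFactors).card : ℕ) : ℝ) := by exact_mod_cast h1
  refine h4.trans ((add_le_add h3 h2).trans_eq (by ring))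

theorem card_filter_dvd_le {S : Finset ℕ} (hS : ∀ q ∈ S, q.Prime) {H : ℕ} (hH : H ≠ 0) :
    ((S.filter (· ∣ H)).card : ℝ) ≤ 2 * Real.log H := by
  have h1 : ∏ q ∈ S.filter (· ∣ H), q ≤ H := by
    refine Nat.le_of_dvd (by omega) (Finset.prod_primes_dvd H (fun q hq => ?_) fun q hq => ?_)
    · exact (hS q (mem_filter.1 hq).1).prime
    · exact (mem_filter.1 hq).2
  have h2 : 2 ^ (S.filter (· ∣ H)).card ≤ H := by
    refine le_trans ?_ h1
    rw [← prod_const]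
    exact prod_le_prod' fun q hq => (hS q (mem_filter.1 hq).1).two_le
  have h3 : Real.log (2 ^ (S.filter (· ∣ H)).card) ≤ Real.log H :=
    Real.log_le_log (by positivity) (by exact_mod_cast h2)
  rw [Real.log_pow] at h3
  have : 1 / 2 ≤ Real.log 2 := by linarith [Real.log_two_gt_d9]
  have h4 : (0 : ℝ) ≤ (S.filter (· ∣ H)).card := by positivity
  nlinarith

/-- The condition that the prime `q` divides the cototient of `m * t` but not `m`, for `t` a prime
not dividing `m`. -/
def Hits (m q t : ℕ) : Prop := ¬q ∣ m ∧ q ∣ (m - m.totient) * t + m.totient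

instance (m q t : ℕ) : Decidable (Hits m q t) := inferInstanceAs (Decidable (_ ∧ _))

theorem hits_add_self (m q t : ℕ) : Hits m q (t + q) ↔ Hits m q t := by
  unfold Hits
  rw [show (m - m.totient) * (t + q) + m.totient
    = (m - m.totient) * t + m.totient + (m - m.totient) * q by ring,
    Nat.dvd_add_left (Dvd.intro_left _ rfl)]

theorem not_dvd_of_hits {m q t : ℕ} (h : Hits m q t) : ¬q ∣ m - m.totient := fun h' => by
  have h1 : q ∣ m.totient := (Nat.dvd_add_right (h'.mul_right t)).1 h.2
  exact h.1 ((Nat.sub_add_cancel m.totient_le) ▸ dvd_add h' h1)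

theorem hits_unique {m q s t : ℕ} (hq : q.Prime) (hs : Hits m q s) (ht : Hits m q t) :
    s ≡ t [MOD q] := by
  have hc : Nat.gcd q (m - m.totient) = 1 := (hq.coprime_iff_not_dvd).2 (not_dvd_of_hits hs)
  refine Nat.ModEq.cancel_left_of_coprime hc (Nat.ModEq.add_right_cancel' m.totient ?_)
  exact ((Nat.modEq_zero_iff_dvd).2 hs.2).trans ((Nat.modEq_zero_iff_dvd).2 ht.2).symm

theorem card_hits_le_one {m q : ℕ} (hq : q.Prime) : ((range q).filter (Hits m q)).card ≤ 1 := by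
  refine card_le_one.2 fun s hs t ht => ?_
  simp only [mem_filter, mem_range] at hs ht
  exact Nat.ModEq.eq_of_lt_of_lt (hits_unique hq hs.2 ht.2) hs.1 ht.1

theorem card_hits_eq_one {m q : ℕ} (hq : q.Prime) (h1 : ¬q ∣ m) (h2 : ¬q ∣ m - m.totient) :
    ((range q).filter (Hits m q)).card = 1 := by
  refine le_antisymm (card_hits_le_one hq) (card_pos.2 ?_)
  have := Fact.mk hq
  have h0 : ((m - m.totient : ℕ) : ZMod q) ≠ 0 := by rwa [Ne, ZMod.natCast_eq_zero_iff]
  refine ⟨(-(m.totient : ZMod q) / ((m - m.totient : ℕ) : ZMod q)).val, ?_⟩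
  rw [mem_filter, mem_range]
  refine ⟨ZMod.val_lt _, h1, ?_⟩
  rw [← ZMod.natCast_eq_zero_iff, Nat.cast_add, Nat.cast_mul, ZMod.natCast_zmod_val]
  field_simp
  ring

theorem dvd_resultant_of_hits {m n q t : ℕ} (hm : Hits m q t) (hn : Hits n q t) :
    q ∣ resultant m n := by
  refine Dvd.dvd.mul_left ?_ _
  rw [← Int.natCast_dvd]
  have h1 : (q : ℤ) ∣ ((m : ℤ) - m.totient) * t + m.totient := by
    have := Int.natCast_dvd_natCast.2 hm.2
    rwa [Nat.cast_add, Nat.cast_mul, Nat.cast_sub m.totient_le] at this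
  have h2 : (q : ℤ) ∣ ((n : ℤ) - n.totient) * t + n.totient := by
    have := Int.natCast_dvd_natCast.2 hn.2
    rwa [Nat.cast_add, Nat.cast_mul, Nat.cast_sub n.totient_le] at this
  have h3 : (m.totient * n : ℤ) - n.totient * m
    = ((n : ℤ) - n.totient) * (((m : ℤ) - m.totient) * t + m.totient)
      - ((m : ℤ) - m.totient) * (((n : ℤ) - n.totient) * t + n.totient) := by ring
  rw [h3]
  exact dvd_sub (h1.mul_left _) (h2.mul_left _)

theorem cototient_mul_prime {m P : ℕ} (hP : P.Prime) (h : ¬P ∣ m) :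
    m * P - (m * P).totient = (m - m.totient) * P + m.totient := by
  obtain ⟨k, rfl⟩ : ∃ k, P = k + 1 := ⟨P - 1, by have := hP.one_le; omega⟩
  rw [mul_comm m, Nat.totient_mul_of_prime_of_not_dvd hP h, Nat.add_sub_cancel, Nat.sub_mul]
  have h3 := Nat.mul_le_mul_left k m.totient_le
  have h4 := m.totient_le
  rw [show (k + 1) * m = k * m + m by ring, show m * (k + 1) = k * m + m by ring,
    show m.totient * (k + 1) = k * m.totient + m.totient by ring]
  omega

/-- The number of elements of `S` dividing `n`. -/
def weight (S : Finset ℕ) (n : ℕ) : ℕ := (S.filter (· ∣ n)).card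

/-- The sum of the reciprocals of the elements of `S`. -/
noncomputable def recipSum (S : Finset ℕ) : ℝ := ∑ p ∈ S, 1 / (p : ℝ)

theorem recipSum_nonneg (S : Finset ℕ) : 0 ≤ recipSum S := sum_nonneg fun _ _ => by positivity

theorem card_Icc_filter_dvd (X d : ℕ) : ((Icc 1 X).filter (d ∣ ·)).card = X / d := by
  rw [← Nat.Ioc_filter_dvd_card_eq_div X d]; rfl

theorem sum_weight_mul {R : Type*} [CommSemiring R] (S : Finset ℕ) (hP : ∀ p ∈ S, 0 < p)
    (X : ℕ) (g : ℕ → R) :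
    ∑ n ∈ Icc 1 X, (weight S n : R) * g n = ∑ p ∈ S, ∑ m ∈ Icc 1 (X / p), g (m * p) := by
  have h1 : ∀ n, (weight S n : R) * g n = ∑ p ∈ S, if p ∣ n then g n else 0 := fun n => by
    rw [← sum_filter, sum_const, nsmul_eq_mul, weight]
  rw [sum_congr rfl fun n _ => h1 n, sum_comm]
  refine sum_congr rfl fun p hp => ?_
  have hp0 := hP p hp
  rw [← sum_filter]
  symm
  refine sum_bij (fun m _ => m * p) ?_ ?_ ?_ ?_
  · intro m hm
    rw [mem_Icc] at hm
    rw [mem_filter, mem_Icc]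
    exact ⟨⟨Nat.mul_pos hm.1 hp0, (Nat.le_div_iff_mul_le hp0).1 hm.2⟩, Dvd.intro_left _ rfl⟩
  · intro m _ n _ h
    exact Nat.eq_of_mul_eq_mul_right hp0 h
  · intro n hn
    rw [mem_filter, mem_Icc] at hn
    obtain ⟨⟨h1, h2⟩, m, rfl⟩ := hn
    refine ⟨m, ?_, mul_comm _ _⟩
    rw [mem_Icc, Nat.le_div_iff_mul_le hp0, mul_comm m]
    exact ⟨Nat.pos_of_ne_zero (by rintro rfl; simp at h1), h2⟩
  · intro m _
    rfl

theorem sum_weight_sub_sq_le (S : Finset ℕ) (hP : ∀ p ∈ S, p.Prime) (X : ℕ) :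
    ∑ n ∈ Icc 1 X, ((weight S n : ℝ) - recipSum S) ^ 2
      ≤ X * recipSum S + 2 * recipSum S * S.card := by
  set E := recipSum S with hE
  have hE0 : 0 ≤ E := recipSum_nonneg S
  have h1 : X * E - S.card ≤ ∑ n ∈ Icc 1 X, (weight S n : ℝ) := by
    have := sum_weight_mul S (fun p hp => (hP p hp).pos) X (fun _ => (1 : ℝ))
    simp only [mul_one, sum_const, Nat.card_Icc, Nat.add_sub_cancel, nsmul_eq_mul] at this
    rw [this, hE, recipSum, mul_sum, card_eq_sum_ones, Nat.cast_sum, ← sum_sub_distrib]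
    refine sum_le_sum fun p _ => ?_
    rw [← Nat.floor_div_eq_div (K := ℝ), mul_one_div, Nat.cast_one]
    exact (Nat.sub_one_lt_floor _).le
  have h2 : ∑ n ∈ Icc 1 X, (weight S n : ℝ) ^ 2 ≤ X * E ^ 2 + X * E := by
    have e1 : ∀ n, (weight S n : ℝ) ^ 2
        = ∑ p ∈ S, ∑ q ∈ S, if p ∣ n ∧ q ∣ n then (1 : ℝ) else 0 := fun n => by
      have : (weight S n : ℝ) = ∑ p ∈ S, if p ∣ n then (1 : ℝ) else 0 := by
        rw [← sum_filter, sum_const, nsmul_eq_mul, mul_one, weight]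
      rw [this, sq, sum_mul_sum]
      refine sum_congr rfl fun p _ => sum_congr rfl fun q _ => ?_
      by_cases h1 : p ∣ n <;> by_cases h2 : q ∣ n <;> simp [h1, h2]
    rw [sum_congr rfl fun n _ => e1 n, sum_comm]
    have e2 : ∀ p ∈ S, ∀ q ∈ S, ∑ n ∈ Icc 1 X, (if p ∣ n ∧ q ∣ n then (1 : ℝ) else 0)
        ≤ X * (1 / p * (1 / q)) + if p = q then X * (1 / (p : ℝ)) else 0 := by
      intro p hp q hq
      rw [← sum_filter, sum_const, nsmul_eq_mul, mul_one]
      split_ifs with h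
      · subst h
        simp only [and_self]
        rw [card_Icc_filter_dvd, mul_one_div (X : ℝ) (p : ℝ)]
        have : ((X / p : ℕ) : ℝ) ≤ X / p := Nat.cast_div_le
        have : (0 : ℝ) ≤ X * (1 / p * (1 / p)) := by positivity
        linarith
      · have hc : Nat.Coprime p q := (Nat.coprime_primes (hP p hp) (hP q hq)).2 h
        have : (Icc 1 X).filter (fun n => p ∣ n ∧ q ∣ n) = (Icc 1 X).filter (p * q ∣ ·) := by
          refine filter_congr fun n _ => ⟨fun h => hc.mul_dvd_of_dvd_of_dvd h.1 h.2, fun h => ?_⟩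
          exact ⟨(Dvd.intro _ rfl).trans h, (Dvd.intro_left _ rfl).trans h⟩
        rw [this, card_Icc_filter_dvd, add_zero]
        refine (Nat.cast_div_le).trans_eq ?_
        push_cast
        rw [one_div_mul_one_div, mul_one_div]
    calc _ ≤ ∑ p ∈ S, ∑ q ∈ S,
          (X * (1 / p * (1 / q)) + if p = q then X * (1 / (p : ℝ)) else 0) := by
          refine sum_le_sum fun p hp => ?_
          rw [sum_comm]
          exact sum_le_sum fun q hq => e2 p hp q hq
      _ = _ := by
        simp only [sum_add_distrib, sum_ite_eq, ← mul_sum, sum_ite_mem, inter_self]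
        rw [← sum_mul, hE, recipSum, sq]
  have h3 : ∑ n ∈ Icc 1 X, ((weight S n : ℝ) - E) ^ 2
      = ∑ n ∈ Icc 1 X, (weight S n : ℝ) ^ 2 - 2 * E * ∑ n ∈ Icc 1 X, (weight S n : ℝ)
        + X * E ^ 2 := by
    rw [mul_sum, ← sum_sub_distrib]
    have : (X : ℝ) * E ^ 2 = ∑ n ∈ Icc 1 X, E ^ 2 := by simp
    rw [this, ← sum_add_distrib]
    exact sum_congr rfl fun n _ => by ring
  rw [h3]
  nlinarith

theorem norm_sum_sub_weighted_sum_le (S : Finset ℕ) (hP : ∀ p ∈ S, p.Prime) {X : ℕ}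
    (hX : ∀ p ∈ S, p ≤ X) (hE : 0 < recipSum S) {g : ℕ → ℂ} (hg : ∀ n, ‖g n‖ ≤ 1) :
    ‖∑ n ∈ Icc 1 X, g n - (∑ n ∈ Icc 1 X, (weight S n : ℂ) * g n) / recipSum S‖
      ≤ X * √(3 / recipSum S) := by
  set E := recipSum S with hE'
  have hEC : (E : ℂ) ≠ 0 := by exact_mod_cast hE.ne'
  have hcard : (S.card : ℝ) ≤ X := by
    have : S ⊆ Icc 1 X := fun p hp => mem_Icc.2 ⟨(hP p hp).one_le, hX p hp⟩
    have := card_le_card this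
    simp only [Nat.card_Icc, Nat.add_sub_cancel] at this
    exact_mod_cast this
  have h1 : ‖∑ n ∈ Icc 1 X, g n - (∑ n ∈ Icc 1 X, (weight S n : ℂ) * g n) / E‖
      ≤ (∑ n ∈ Icc 1 X, |(weight S n : ℝ) - E|) / E := by
    rw [sum_div, ← sum_sub_distrib, sum_div]
    refine norm_sum_le_of_le _ fun n _ => ?_
    have : g n - (weight S n : ℂ) * g n / E = -(((((weight S n : ℝ) - E : ℝ)) : ℂ) / E) * g n := by
      push_cast; field_simp; ring
    rw [this, norm_mul, norm_neg, norm_div, Complex.norm_real, Complex.norm_real, Real.norm_eq_abs,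
      Real.norm_of_nonneg hE.le]
    exact mul_le_of_le_one_right (by positivity) (hg n)
  refine h1.trans ?_
  rw [div_le_iff₀ hE]
  have h2 := sum_weight_sub_sq_le S hP X
  have h3 := sq_sum_le_card_mul_sum_sq (s := Icc 1 X) (f := fun n => |(weight S n : ℝ) - E|)
  simp only [Nat.card_Icc, Nat.add_sub_cancel, sq_abs] at h3
  refine le_of_pow_le_pow_left₀ two_ne_zero (by positivity) ?_
  have h4 : (X * √(3 / E) * E) ^ 2 = X * (X * (3 * E)) := by
    rw [mul_pow, mul_pow, Real.sq_sqrt (by positivity)]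
    field_simp
  rw [h4]
  refine h3.trans ?_
  gcongr
  refine h2.trans ?_
  nlinarith

/-- The Cauchy–Schwarz step in the dispersion method, on the dyadic block `(N, 2N]`. -/
theorem sq_sum_norm_sum_le {X N : ℕ} (hN : 1 ≤ N) {Φ : ℕ → ℕ → ℂ} {A ε : ℝ}
    (hA : ∀ m t, ‖Φ m t‖ ≤ A) (hε : 0 ≤ ε)
    (h : ∀ m n T, resultant m n ≠ 0 → m ≤ X → n ≤ X → N ≤ T → T ≤ 2 * N →
      (∑ t ∈ Ioc N T, Φ m t * (starRingEnd ℂ) (Φ n t)).re ≤ N * ε) :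
    (∑ t ∈ Ioc N (2 * N), ‖∑ m ∈ Icc 1 (X / t), Φ m t‖) ^ 2
      ≤ (X : ℝ) ^ 2 * (ε + A ^ 2 * (√(N / X) * (3 + Real.log X))) := by
  have hA0 : 0 ≤ A := (norm_nonneg _).trans (hA 0 0)
  set M := X / N with hM
  have hMX : (N : ℝ) * M ≤ X := by exact_mod_cast Nat.mul_div_le X N
  have hNR : (0 : ℝ) < N := by exact_mod_cast hN
  have h1 := sq_sum_le_card_mul_sum_sq (s := Ioc N (2 * N))
    (f := fun t => ‖∑ m ∈ Icc 1 (X / t), Φ m t‖)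
  have hc : (Ioc N (2 * N)).card = N := by simp; omega
  rw [hc] at h1
  have hcond : ∀ {m t}, 1 ≤ m → N < t → (m ≤ X / t ↔ t ≤ X / m) := fun hm ht => by
    rw [Nat.le_div_iff_mul_le (by omega), Nat.le_div_iff_mul_le (by omega), mul_comm]
  have h2 : ∑ t ∈ Ioc N (2 * N), ‖∑ m ∈ Icc 1 (X / t), Φ m t‖ ^ 2
      = ∑ p ∈ Icc 1 M ×ˢ Icc 1 M,
          (∑ t ∈ (Ioc N (2 * N)).filter (fun t => t ≤ X / p.1 ∧ t ≤ X / p.2),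
        Φ p.1 t * (starRingEnd ℂ) (Φ p.2 t)).re := by
    rw [← Complex.re_sum]
    have e1 : ∀ t ∈ Ioc N (2 * N), ((‖∑ m ∈ Icc 1 (X / t), Φ m t‖ ^ 2 : ℝ) : ℂ)
        = ∑ p ∈ Icc 1 M ×ˢ Icc 1 M, if t ≤ X / p.1 ∧ t ≤ X / p.2
          then Φ p.1 t * (starRingEnd ℂ) (Φ p.2 t) else 0 := by
      intro t ht
      rw [mem_Ioc] at ht
      have hI : Icc 1 (X / t) = (Icc 1 M).filter (fun m => t ≤ X / m) := by
        ext m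
        simp only [mem_filter, mem_Icc]
        constructor
        · rintro ⟨a, b⟩
          exact ⟨⟨a, b.trans (Nat.div_le_div_left ht.1.le hN)⟩, (hcond a ht.1).1 b⟩
        · rintro ⟨⟨a, _⟩, b⟩
          exact ⟨a, (hcond a ht.1).2 b⟩
      push_cast
      rw [← Complex.mul_conj', map_sum, sum_mul_sum, hI, ← sum_product', ← sum_filter]
      refine sum_congr ?_ fun _ _ => rfl
      ext p
      simp only [mem_product, mem_filter]
      tauto
    have e2 : ((∑ t ∈ Ioc N (2 * N), ‖∑ m ∈ Icc 1 (X / t), Φ m t‖ ^ 2 : ℝ) : ℂ)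
        = ∑ p ∈ Icc 1 M ×ˢ Icc 1 M,
          ∑ t ∈ (Ioc N (2 * N)).filter (fun t => t ≤ X / p.1 ∧ t ≤ X / p.2),
            Φ p.1 t * (starRingEnd ℂ) (Φ p.2 t) := by
      rw [Complex.ofReal_sum, sum_congr rfl e1, sum_comm]
      simp only [sum_filter]
    rw [← e2, Complex.ofReal_re]
  have hterm : ∀ p ∈ Icc 1 M ×ˢ Icc 1 M,
      (∑ t ∈ (Ioc N (2 * N)).filter (fun t => t ≤ X / p.1 ∧ t ≤ X / p.2),
        Φ p.1 t * (starRingEnd ℂ) (Φ p.2 t)).re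
      ≤ N * ε + if resultant p.1 p.2 = 0 then N * A ^ 2 else 0 := by
    rintro ⟨m, n⟩ hp
    simp only [mem_product, mem_Icc] at hp
    split_ifs with hr
    · refine (Complex.re_le_norm _).trans ((norm_sum_le _ _).trans ?_)
      have : ∀ t ∈ (Ioc N (2 * N)).filter (fun t => t ≤ X / m ∧ t ≤ X / n),
          ‖Φ m t * (starRingEnd ℂ) (Φ n t)‖ ≤ A ^ 2 := fun t _ => by
        rw [norm_mul, RCLike.norm_conj, sq]
        exact mul_le_mul (hA _ _) (hA _ _) (norm_nonneg _) hA0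
      refine (sum_le_card_nsmul _ _ _ this).trans ?_
      rw [nsmul_eq_mul]
      have hcN := card_filter_le (Ioc N (2 * N)) (fun t => t ≤ X / m ∧ t ≤ X / n)
      rw [hc] at hcN
      have : (((Ioc N (2 * N)).filter (fun t => t ≤ X / m ∧ t ≤ X / n)).card : ℝ) * A ^ 2
          ≤ N * A ^ 2 := by gcongr
      have : 0 ≤ N * ε := by positivity
      linarith
    · have hle : ∀ k, k ≤ M → k ≤ X := fun k hk => hk.trans (Nat.div_le_self _ _)
      rw [add_zero]
      rcases le_total N (min (2 * N) (min (X / m) (X / n))) with hT | hT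
      · have : (Ioc N (2 * N)).filter (fun t => t ≤ X / m ∧ t ≤ X / n)
            = Ioc N (min (2 * N) (min (X / m) (X / n))) := by
          ext t; simp only [mem_filter, mem_Ioc, le_min_iff]; tauto
        rw [this]
        exact h m n _ hr (hle m hp.1.2) (hle n hp.2.2) hT (min_le_left _ _)
      · have : (Ioc N (2 * N)).filter (fun t => t ≤ X / m ∧ t ≤ X / n) = ∅ := by
          refine filter_eq_empty_iff.2 fun t ht h' => ?_
          rw [mem_Ioc] at ht
          have : t ≤ min (2 * N) (min (X / m) (X / n)) := le_min ht.2 (le_min h'.1 h'.2)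
          omega
        rw [this]
        simpa using by positivity
  have hbad := card_filter_resultant_eq_zero_le M
  have h3 : ∑ t ∈ Ioc N (2 * N), ‖∑ m ∈ Icc 1 (X / t), Φ m t‖ ^ 2
      ≤ M ^ 2 * (N * ε) + Nat.sqrt M * (M * (3 + Real.log M)) * (N * A ^ 2) := by
    rw [h2]
    refine (sum_le_sum hterm).trans ?_
    rw [sum_add_distrib, sum_const, card_product, Nat.card_Icc, Nat.add_sub_cancel, ← sum_filter,
      sum_const, nsmul_eq_mul, nsmul_eq_mul, Nat.cast_mul, ← sq]
    gcongr
  refine h1.trans ((mul_le_mul_of_nonneg_left h3 hNR.le).trans ?_)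
  rcases Nat.eq_zero_or_pos M with hM0 | hM0
  · rw [hM0]
    have := Real.log_natCast_nonneg X
    simp only [Nat.cast_zero]
    norm_num
    positivity
  have hMR : (1 : ℝ) ≤ M := by exact_mod_cast hM0
  have hX0 : (0 : ℝ) < X := by nlinarith
  have hMX' : (M : ℝ) ≤ X := by exact_mod_cast Nat.div_le_self _ _
  have hlog : Real.log M ≤ Real.log X := Real.log_le_log (by linarith) hMX'
  have hlogM := Real.log_natCast_nonneg M
  have hsq : (N : ℝ) * Nat.sqrt M ≤ X * √(N / X) := by
    have h4 : (Nat.sqrt M : ℝ) ≤ √M := Real.nat_sqrt_le_real_sqrt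
    refine (mul_le_mul_of_nonneg_left h4 hNR.le).trans ?_
    refine le_of_pow_le_pow_left₀ two_ne_zero (by positivity) ?_
    rw [mul_pow, mul_pow, Real.sq_sqrt (by linarith), Real.sq_sqrt (by positivity)]
    calc (N : ℝ) ^ 2 * M = N * (N * M) := by ring
      _ ≤ N * X := by gcongr
      _ = _ := by field_simp
  calc (N : ℝ) * (M ^ 2 * (N * ε) + Nat.sqrt M * (M * (3 + Real.log M)) * (N * A ^ 2))
      = (N * M) ^ 2 * ε + A ^ 2 * ((N * Nat.sqrt M) * (N * M) * (3 + Real.log M)) := by ring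
    _ ≤ X ^ 2 * ε + A ^ 2 * ((X * √(N / X)) * X * (3 + Real.log X)) := by gcongr
    _ = _ := by ring

theorem norm_sum_sum_le {X N₀ R : ℕ} (hN₀ : 1 ≤ N₀) {S : Finset ℕ}
    (hS : S ⊆ Ioc N₀ (2 ^ R * N₀)) {Φ : ℕ → ℕ → ℂ} {A ε : ℝ}
    (hA : ∀ m t, ‖Φ m t‖ ≤ A) (hε : 0 ≤ ε)
    (h : ∀ N m n T, N₀ ≤ N → resultant m n ≠ 0 → m ≤ X → n ≤ X → N ≤ T → T ≤ 2 * N →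
      (∑ t ∈ Ioc N T, Φ m t * (starRingEnd ℂ) (Φ n t)).re ≤ N * ε) :
    ‖∑ p ∈ S, ∑ m ∈ Icc 1 (X / p), Φ m p‖
      ≤ R * (X * √(ε + A ^ 2 * (√((2 ^ R * N₀ : ℕ) / X) * (3 + Real.log X)))) := by
  have hlogX := Real.log_natCast_nonneg X
  refine (norm_sum_le _ _).trans ((sum_le_sum_of_subset_of_nonneg hS
    fun _ _ _ => norm_nonneg _).trans ?_)
  have key : ∀ r ≤ R, ∑ t ∈ Ioc N₀ (2 ^ r * N₀), ‖∑ m ∈ Icc 1 (X / t), Φ m t‖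
      ≤ r * (X * √(ε + A ^ 2 * (√((2 ^ R * N₀ : ℕ) / X) * (3 + Real.log X)))) := by
    intro r hr
    induction r with
    | zero => simp
    | succ r ih =>
      have hpos : 1 ≤ 2 ^ r * N₀ := Nat.mul_pos (by positivity) hN₀
      rw [show 2 ^ (r + 1) * N₀ = 2 * (2 ^ r * N₀) by ring,
        ← sum_Ioc_consecutive _ (n := 2 ^ r * N₀) (Nat.le_mul_of_pos_left _ (by positivity))
          (by omega)]
      have h1 := sq_sum_norm_sum_le (X := X) hpos hA hε fun m n T h1 h2 h3 h4 h5 =>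
        h _ m n T (Nat.le_mul_of_pos_left _ (by positivity)) h1 h2 h3 h4 h5
      have h2 : ∑ t ∈ Ioc (2 ^ r * N₀) (2 * (2 ^ r * N₀)), ‖∑ m ∈ Icc 1 (X / t), Φ m t‖
          ≤ X * √(ε + A ^ 2 * (√((2 ^ R * N₀ : ℕ) / X) * (3 + Real.log X))) := by
        refine le_of_pow_le_pow_left₀ two_ne_zero (by positivity) (h1.trans ?_)
        rw [mul_pow, Real.sq_sqrt (by positivity)]
        gcongr
        · norm_num
        · omega
      push_cast at *
      linarith [ih (by omega)]
  exact key R le_rfl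

theorem norm_weighted_sum_sub_le {X N₀ : ℕ} (hN₀ : 1 ≤ N₀) {S : Finset ℕ}
    (hS : ∀ p ∈ S, N₀ < p) {g : ℕ → ℂ} {G : ℕ → ℕ → ℂ} {A : ℝ} (hg : ∀ n, ‖g n‖ ≤ A)
    (hG : ∀ m p, ‖G m p‖ ≤ A) (h : ∀ m, ∀ p ∈ S, ¬p ∣ m → g (m * p) = G m p) :
    ‖∑ n ∈ Icc 1 X, (weight S n : ℂ) * g n - ∑ p ∈ S, ∑ m ∈ Icc 1 (X / p), G m p‖
      ≤ 2 * A * (X / N₀) := by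
  have hA0 : 0 ≤ A := (norm_nonneg _).trans (hg 0)
  have hN₀' : (0 : ℝ) < N₀ := by exact_mod_cast hN₀
  rw [sum_weight_mul S (fun p hp => (Nat.zero_le _).trans_lt (hS p hp)), ← sum_sub_distrib]
  have h1 : ∀ p ∈ S, ‖∑ m ∈ Icc 1 (X / p), g (m * p) - ∑ m ∈ Icc 1 (X / p), G m p‖
      ≤ 2 * A * X * (1 / (p : ℝ) ^ 2) := by
    intro p hp
    have hp0 : 0 < p := (Nat.zero_le _).trans_lt (hS p hp)
    rw [← sum_sub_distrib]
    have h2 : ∀ m ∈ Icc 1 (X / p), ‖g (m * p) - G m p‖ ≤ if p ∣ m then 2 * A else 0 := by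
      intro m _
      split_ifs with hd
      · refine (norm_sub_le _ _).trans ?_
        linarith [hg (m * p), hG m p]
      · rw [h m p hp hd, sub_self, norm_zero]
    refine (norm_sum_le_of_le _ h2).trans ?_
    rw [← sum_filter, sum_const, nsmul_eq_mul, card_Icc_filter_dvd, Nat.div_div_eq_div_mul]
    have : ((X / (p * p) : ℕ) : ℝ) ≤ X * (1 / (p : ℝ) ^ 2) := by
      refine Nat.cast_div_le.trans_eq ?_
      rw [mul_one_div, sq, Nat.cast_mul]
    nlinarith
  refine (norm_sum_le_of_le _ h1).trans ?_
  rw [← mul_sum, show 2 * A * (X / N₀ : ℝ) = 2 * A * X * (1 / N₀) by ring]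
  gcongr
  obtain ⟨B, hB⟩ : ∃ B, S ⊆ Ioc N₀ B := ⟨S.sup id, fun p hp =>
    mem_Ioc.2 ⟨hS p hp, le_sup (f := id) hp⟩⟩
  refine (sum_le_sum_of_subset_of_nonneg hB fun _ _ _ => by positivity).trans ?_
  have := sum_Ioc_inv_sq_le_sub (α := ℝ) (k := N₀) (n := max N₀ B) (by omega) (le_max_left _ _)
  simp only [one_div]
  refine (sum_le_sum_of_subset_of_nonneg (Ioc_subset_Ioc_right (le_max_right N₀ B))
    fun _ _ _ => by positivity).trans (this.trans ?_)
  simp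

/-- The number of primes `q ∈ Q` dividing the cototient of `n` but not `n`. -/
def cototientCount (Q : Finset ℕ) (n : ℕ) : ℕ := (Q.filter fun q => ¬q ∣ n ∧ q ∣ n - n.totient).card

/-- The number of primes `q ∈ Q` with `Hits m q t`. -/
def hitCount (Q : Finset ℕ) (m t : ℕ) : ℕ := (Q.filter fun q => Hits m q t).card

theorem cototientCount_mul {Q : Finset ℕ} (hQ : ∀ q ∈ Q, q.Prime) {m P : ℕ} (hP : P.Prime)
    (hPQ : P ∉ Q) (hPm : ¬P ∣ m) : cototientCount Q (m * P) = hitCount Q m P := by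
  unfold cototientCount hitCount
  congr 1
  refine filter_congr fun q hq => ?_
  rw [cototient_mul_prime hP hPm, Hits, (hQ q hq).dvd_mul]
  have : ¬q ∣ P := fun h => hPQ ((Nat.prime_dvd_prime_iff_eq (hQ q hq) hP).1 h ▸ hq)
  tauto

theorem exp_mul_hitCount (Q : Finset ℕ) (m t : ℕ) (u : ℂ) :
    Complex.exp (u * hitCount Q m t) = ∏ q ∈ Q, Complex.exp (if Hits m q t then u else 0) := by
  rw [← Complex.exp_sum, ← sum_filter, sum_const, nsmul_eq_mul, hitCount, mul_comm]

theorem sum_inv_sq_le {Q : Finset ℕ} {y : ℝ} (hy : 0 < y) (hQy : ∀ q ∈ Q, y < q) :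
    ∑ q ∈ Q, 1 / (q : ℝ) ^ 2 ≤ recipSum Q / y := by
  rw [recipSum, sum_div]
  refine sum_le_sum fun q hq => ?_
  have := hQy q hq
  rw [div_div]
  refine one_div_le_one_div_of_le (by nlinarith) (by nlinarith)

theorem sum_filter_dvd_inv_le {Q : Finset ℕ} (hQ : ∀ q ∈ Q, q.Prime) {y : ℝ} (hy : 0 < y)
    (hQy : ∀ q ∈ Q, y < q) {m n X : ℕ} (hmn : resultant m n ≠ 0) (hm : m ≤ X) (hn : n ≤ X) :
    ∑ q ∈ Q with q ∣ resultant m n, 1 / (q : ℝ) ≤ 12 * Real.log X / y := by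
  have h1 := card_filter_dvd_le hQ hmn
  have h2 : Real.log (resultant m n) ≤ 6 * Real.log X := by
    have := Real.log_le_log (by exact_mod_cast Nat.pos_of_ne_zero hmn)
      (show ((resultant m n : ℕ) : ℝ) ≤ ((X : ℝ)) ^ 6 by exact_mod_cast resultant_le hm hn)
    rwa [Real.log_pow] at this
  have h3 : ∑ q ∈ Q with q ∣ resultant m n, 1 / (q : ℝ)
      ≤ (Q.filter (· ∣ resultant m n)).card • (1 / y) :=
    sum_le_card_nsmul _ _ _ fun q hq =>
      one_div_le_one_div_of_le hy (hQy q (mem_filter.1 hq).1).le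
  rw [nsmul_eq_mul, mul_one_div] at h3
  refine h3.trans ?_
  gcongr
  linarith

theorem norm_exp_ofReal_mul_I_sub_one_le (τ : ℝ) : ‖Complex.exp (τ * Complex.I) - 1‖ ≤ 2 := by
  refine (norm_sub_le _ _).trans ?_
  rw [Complex.norm_exp_ofReal_mul_I, norm_one]
  norm_num

theorem re_exp_ofReal_mul_I_sub_one_nonpos (τ : ℝ) :
    (Complex.exp (τ * Complex.I) - 1).re ≤ 0 := by
  rw [Complex.sub_re, Complex.one_re, sub_nonpos, ← Complex.norm_exp_ofReal_mul_I τ]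
  exact Complex.re_le_norm _

section Correlation

variable {Q : Finset ℕ} {m n q : ℕ}

/-- The local factor at `q` of the correlation of two hit counts. -/
noncomputable def localFactor (m n : ℕ) (σ τ : ℝ) (q t : ℕ) : ℂ :=
  Complex.exp (if Hits m q t then (σ * Complex.I : ℂ) else 0)
    * Complex.exp (if Hits n q t then (τ * Complex.I : ℂ) else 0) - 1

theorem norm_one_add_localFactor (σ τ : ℝ) (q t : ℕ) : ‖1 + localFactor m n σ τ q t‖ ≤ 1 := by
  unfold localFactor
  rw [add_sub_cancel, norm_mul]
  split_ifs <;> simp [Complex.norm_exp_ofReal_mul_I]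

theorem norm_localFactor_le (σ τ : ℝ) (q t : ℕ) :
    ‖localFactor m n σ τ q t‖ ≤ (if Hits m q t then 2 else 0) + if Hits n q t then 2 else 0 := by
  have h1 := norm_exp_ofReal_mul_I_sub_one_le σ
  have h2 := norm_exp_ofReal_mul_I_sub_one_le τ
  unfold localFactor
  split_ifs
  · refine (norm_sub_le _ _).trans ?_
    rw [norm_mul, Complex.norm_exp_ofReal_mul_I, Complex.norm_exp_ofReal_mul_I, norm_one]
    norm_num
  · simpa using h1
  · simpa using h2
  · simp

theorem periodic_localFactor (σ τ : ℝ) (q : ℕ) :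
    Function.Periodic (localFactor m n σ τ q) q := fun t => by
  unfold localFactor
  simp only [hits_add_self]

theorem sum_norm_localFactor_le (hq : q.Prime) (σ τ : ℝ) :
    ∑ r ∈ range q, ‖localFactor m n σ τ q r‖ ≤ 4 := by
  refine (sum_le_sum fun r _ => norm_localFactor_le σ τ q r).trans ?_
  rw [sum_add_distrib, ← sum_filter, ← sum_filter, sum_const, sum_const, nsmul_eq_mul,
    nsmul_eq_mul]
  have h1 : (((range q).filter (Hits m q)).card : ℝ) ≤ 1 := by exact_mod_cast card_hits_le_one hq
  have h2 : (((range q).filter (Hits n q)).card : ℝ) ≤ 1 := by exact_mod_cast card_hits_le_one hq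
  linarith

theorem sum_localFactor_eq (hq : q.Prime) (h : ¬q ∣ resultant m n) (σ τ : ℝ) :
    ∑ r ∈ range q, localFactor m n σ τ q r
      = (Complex.exp (σ * Complex.I) - 1) + (Complex.exp (τ * Complex.I) - 1) := by
  have hd : ¬q ∣ m * (m - m.totient) * (n * (n - n.totient)) := fun h' => h (h'.mul_right _)
  simp only [hq.dvd_mul, not_or] at hd
  have h1 : ∀ r, localFactor m n σ τ q r
      = (if Hits m q r then Complex.exp (σ * Complex.I) - 1 else 0)
        + if Hits n q r then Complex.exp (τ * Complex.I) - 1 else 0 := fun r => by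
    have : ¬(Hits m q r ∧ Hits n q r) := fun h' => h (dvd_resultant_of_hits h'.1 h'.2)
    unfold localFactor
    by_cases a : Hits m q r <;> by_cases b : Hits n q r
    · exact absurd ⟨a, b⟩ this
    all_goals simp [a, b]
  simp only [h1, sum_add_distrib]
  rw [← sum_filter, ← sum_filter, sum_const, sum_const, card_hits_eq_one hq hd.1.1 hd.1.2,
    card_hits_eq_one hq hd.2.1 hd.2.2, one_smul, one_smul]

/-- The correlation over an interval of the twisted hit counts of `m` and `n`. -/
theorem norm_sum_exp_hitCount_sub_le (hQ : ∀ q ∈ Q, q.Prime) {y : ℝ} (hy : 4 ≤ y)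
    (hQy : ∀ q ∈ Q, y < q) {X : ℕ} (hmn : resultant m n ≠ 0) (hm : m ≤ X) (hn : n ≤ X)
    (σ τ : ℝ) (K A T : ℕ) :
    ‖∑ t ∈ Ico A (A + T), Complex.exp (σ * Complex.I * hitCount Q m t)
          * Complex.exp (τ * Complex.I * hitCount Q n t)
        - T * Complex.exp (recipSum Q * ((Complex.exp (σ * Complex.I) - 1)
          + (Complex.exp (τ * Complex.I) - 1)))‖
      ≤ T * (2 * ((4 * recipSum Q) ^ K / K.factorial)
          + (144 * Real.log X + 16 * recipSum Q) / y) + 2 * (1 + 4 * Q.card) ^ K := by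
  set w : ℂ := (Complex.exp (σ * Complex.I) - 1) + (Complex.exp (τ * Complex.I) - 1) with hw
  have hw4 : ‖w‖ ≤ 4 := (norm_add_le _ _).trans (by
    linarith [norm_exp_ofReal_mul_I_sub_one_le σ, norm_exp_ofReal_mul_I_sub_one_le τ])
  have hwre : w.re ≤ 0 := by
    rw [hw, Complex.add_re]
    linarith [re_exp_ofReal_mul_I_sub_one_nonpos σ, re_exp_ofReal_mul_I_sub_one_nonpos τ]
  have hy0 : 0 < y := by linarith
  have h1 := norm_sum_prod_one_add_sub_le hQ (g := localFactor m n σ τ)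
    (fun q _ => periodic_localFactor σ τ q) (fun q _ t => norm_one_add_localFactor σ τ q t)
    (C := 4) (by norm_num) (fun q hq => sum_norm_localFactor_le (hQ q hq) σ τ) K A T
  have h2 : ∀ t, ∏ q ∈ Q, (1 + localFactor m n σ τ q t)
      = Complex.exp (σ * Complex.I * hitCount Q m t)
          * Complex.exp (τ * Complex.I * hitCount Q n t) := fun t => by
    rw [exp_mul_hitCount, exp_mul_hitCount, ← prod_mul_distrib]
    exact prod_congr rfl fun q _ => by unfold localFactor; ring
  simp only [h2] at h1
  have hexp : Complex.exp (recipSum Q * w) = ∏ q ∈ Q, Complex.exp (w / q) := by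
    rw [← Complex.exp_sum, recipSum, Complex.ofReal_sum, sum_mul]
    congr 1
    exact sum_congr rfl fun q _ => by push_cast; ring
  have hqR : ∀ q ∈ Q, (4 : ℝ) < q := fun q hq => hy.trans_lt (hQy q hq)
  have hn1 : ∀ q ∈ Q, ‖(∑ r ∈ range q, localFactor m n σ τ q r) / q‖ ≤ 4 / q := fun q hq => by
    rw [norm_div, Complex.norm_natCast]
    gcongr
    exact (norm_sum_le _ _).trans (sum_norm_localFactor_le (hQ q hq) σ τ)
  have hwq : ∀ q ∈ Q, ‖w / q‖ ≤ 4 / q := fun q _ => by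
    rw [norm_div, Complex.norm_natCast]
    gcongr
  have hq1 : ∀ q ∈ Q, 4 / (q : ℝ) ≤ 1 := fun q hq => by
    have := hqR q hq
    rw [div_le_one (by linarith)]
    linarith
  have h3 : ‖∏ q ∈ Q, (1 + (∑ r ∈ range q, localFactor m n σ τ q r) / q)
      - Complex.exp (recipSum Q * w)‖ ≤ (144 * Real.log X + 16 * recipSum Q) / y := by
    rw [hexp]
    refine (norm_prod_sub_prod_le Q _ _ (fun q hq => ?_) (fun q hq => ?_)).trans ?_
    · have hq0 : (q : ℂ) ≠ 0 := by exact_mod_cast (hQ q hq).ne_zero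
      have hq0' : (0 : ℝ) < q := by exact_mod_cast (hQ q hq).pos
      have : 1 + (∑ r ∈ range q, localFactor m n σ τ q r) / q
          = (∑ r ∈ range q, (1 + localFactor m n σ τ q r)) / q := by
        rw [sum_add_distrib]; simp; field_simp
      rw [this, norm_div, Complex.norm_natCast, div_le_one hq0']
      exact (norm_sum_le _ _).trans
        ((sum_le_sum fun r _ => norm_one_add_localFactor σ τ q r).trans (by simp))
    · rw [Complex.norm_exp, Complex.div_natCast_re, Real.exp_le_one_iff]
      exact div_nonpos_of_nonpos_of_nonneg hwre (Nat.cast_nonneg _)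
    have h4 : ∀ q ∈ Q, ‖1 + (∑ r ∈ range q, localFactor m n σ τ q r) / q - Complex.exp (w / q)‖
        ≤ 16 * (1 / (q : ℝ) ^ 2) + if q ∣ resultant m n then 12 * (1 / (q : ℝ)) else 0 := by
      intro q hq
      split_ifs with hd
      · have e1 : 1 + (∑ r ∈ range q, localFactor m n σ τ q r) / q - Complex.exp (w / q)
            = (∑ r ∈ range q, localFactor m n σ τ q r) / q - (Complex.exp (w / q) - 1) := by ring
        rw [e1]
        have e2 := Complex.norm_exp_sub_one_le ((hwq q hq).trans (hq1 q hq))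
        have e3 := hwq q hq
        have e4 := hn1 q hq
        have e5 : 0 ≤ 16 * (1 / (q : ℝ) ^ 2) := by positivity
        refine (norm_sub_le _ _).trans ?_
        have e6 : 12 * (1 / (q : ℝ)) = 4 / q + 2 * (4 / q) := by ring
        linarith
      · rw [sum_localFactor_eq (hQ q hq) hd, ← hw]
        have e2 := Complex.norm_exp_sub_one_sub_id_le ((hwq q hq).trans (hq1 q hq))
        rw [← norm_neg, show -(1 + w / q - Complex.exp (w / q))
          = Complex.exp (w / q) - 1 - w / q by ring, add_zero]
        refine e2.trans ((pow_le_pow_left₀ (norm_nonneg _) (hwq q hq) 2).trans_eq ?_)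
        rw [div_pow]; ring
    refine (sum_le_sum h4).trans ?_
    rw [sum_add_distrib, ← sum_filter, ← mul_sum, ← mul_sum, add_div, add_comm]
    have e1 := sum_inv_sq_le hy0 hQy
    have e2 := sum_filter_dvd_inv_le hQ hy0 hQy hmn hm hn
    rw [show 144 * Real.log X / y = 12 * (12 * Real.log X / y) by ring,
      show 16 * recipSum Q / y = 16 * (recipSum Q / y) by ring]
    linarith
  have h5 : ‖(T : ℂ) * ∏ q ∈ Q, (1 + (∑ r ∈ range q, localFactor m n σ τ q r) / q)
      - T * Complex.exp (recipSum Q * w)‖ ≤ T * ((144 * Real.log X + 16 * recipSum Q) / y) := by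
    rw [← mul_sub, norm_mul, Complex.norm_natCast]
    gcongr
  refine (norm_sub_le_norm_sub_add_norm_sub _ _ _).trans ((add_le_add h1 h5).trans_eq ?_)
  rw [recipSum]
  ring

end Correlation

theorem norm_exp_recipSum_mul_le (Q : Finset ℕ) (τ : ℝ) :
    ‖Complex.exp (recipSum Q * (Complex.exp (τ * Complex.I) - 1))‖ ≤ 1 := by
  rw [Complex.norm_exp, Complex.re_ofReal_mul, Real.exp_le_one_iff]
  exact mul_nonpos_of_nonneg_of_nonpos (recipSum_nonneg Q) (re_exp_ofReal_mul_I_sub_one_nonpos τ)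

theorem conj_exp_I_mul (τ : ℝ) (k : ℂ) (hk : (starRingEnd ℂ) k = k) :
    (starRingEnd ℂ) (Complex.exp (τ * Complex.I * k))
      = Complex.exp ((-τ : ℝ) * Complex.I * k) := by
  rw [← Complex.exp_conj, map_mul, map_mul, Complex.conj_ofReal, Complex.conj_I, hk]
  push_cast; ring_nf

theorem re_sum_hitCount_dispersion_le {Q : Finset ℕ} (hQ : ∀ q ∈ Q, q.Prime) {y : ℝ} (hy : 4 ≤ y)
    (hQy : ∀ q ∈ Q, y < q) {X m n : ℕ} (hmn : resultant m n ≠ 0) (hm : m ≤ X) (hn : n ≤ X)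
    (τ : ℝ) (K A T : ℕ) :
    (∑ t ∈ Ico A (A + T), (Complex.exp (τ * Complex.I * hitCount Q m t)
        - Complex.exp (recipSum Q * (Complex.exp (τ * Complex.I) - 1)))
        * (starRingEnd ℂ) (Complex.exp (τ * Complex.I * hitCount Q n t)
          - Complex.exp (recipSum Q * (Complex.exp (τ * Complex.I) - 1)))).re
      ≤ 3 * (T * (2 * ((4 * recipSum Q) ^ K / K.factorial)
          + (144 * Real.log X + 16 * recipSum Q) / y) + 2 * (1 + 4 * Q.card) ^ K) := by
  set δ := T * (2 * ((4 * recipSum Q) ^ K / K.factorial)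
          + (144 * Real.log X + 16 * recipSum Q) / y) + 2 * (1 + 4 * Q.card : ℝ) ^ K with hδ
  set z := Complex.exp (τ * Complex.I) - 1 with hz
  set z' := Complex.exp ((-τ : ℝ) * Complex.I) - 1 with hz'
  set c := Complex.exp (recipSum Q * z) with hc
  have hzc : (starRingEnd ℂ) z = z' := by
    rw [hz, map_sub, map_one, hz']
    congr 1
    simpa using conj_exp_I_mul τ 1 (map_one _)
  have hcc : (starRingEnd ℂ) c = Complex.exp (recipSum Q * z') := by
    rw [hc, ← Complex.exp_conj, map_mul, Complex.conj_ofReal, hzc]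
  have hc1 : ‖c‖ ≤ 1 := norm_exp_recipSum_mul_le Q τ
  have hc1' : ‖(starRingEnd ℂ) c‖ ≤ 1 := by rwa [RCLike.norm_conj]
  have k1 := norm_sum_exp_hitCount_sub_le hQ hy hQy hmn hm hn τ (-τ) K A T
  have k2 := norm_sum_exp_hitCount_sub_le hQ hy hQy hmn hm hn τ 0 K A T
  have k3 := norm_sum_exp_hitCount_sub_le hQ hy hQy hmn hm hn 0 (-τ) K A T
  simp only [Complex.ofReal_zero, zero_mul, Complex.exp_zero, mul_one, one_mul, sub_self, add_zero,
    zero_add] at k2 k3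
  rw [← hz, ← hc] at k2
  rw [← hz', ← hcc] at k3
  rw [← hz, ← hz', mul_add, Complex.exp_add, ← hc, ← hcc] at k1
  rw [← hδ] at k1 k2 k3
  set S1 := ∑ t ∈ Ico A (A + T), Complex.exp (τ * Complex.I * hitCount Q m t)
    * Complex.exp ((-τ : ℝ) * Complex.I * hitCount Q n t)
  set S2 := ∑ t ∈ Ico A (A + T), Complex.exp (τ * Complex.I * hitCount Q m t)
  set S3 := ∑ t ∈ Ico A (A + T), Complex.exp ((-τ : ℝ) * Complex.I * hitCount Q n t)
  have e : ∑ t ∈ Ico A (A + T), (Complex.exp (τ * Complex.I * hitCount Q m t) - c)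
        * (starRingEnd ℂ) (Complex.exp (τ * Complex.I * hitCount Q n t) - c)
      = (S1 - T * (c * (starRingEnd ℂ) c)) - (S2 - T * c) * (starRingEnd ℂ) c
        - c * (S3 - T * (starRingEnd ℂ) c) := by
    have : ∀ t, (Complex.exp (τ * Complex.I * hitCount Q m t) - c)
        * (starRingEnd ℂ) (Complex.exp (τ * Complex.I * hitCount Q n t) - c)
        = Complex.exp (τ * Complex.I * hitCount Q m t)
            * Complex.exp ((-τ : ℝ) * Complex.I * hitCount Q n t)
          - Complex.exp (τ * Complex.I * hitCount Q m t) * (starRingEnd ℂ) c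
          - c * Complex.exp ((-τ : ℝ) * Complex.I * hitCount Q n t)
          + c * (starRingEnd ℂ) c := fun t => by
      rw [map_sub, conj_exp_I_mul τ _ (Complex.conj_natCast _)]
      ring
    simp only [this, sum_add_distrib, sum_sub_distrib, ← sum_mul, ← mul_sum, sum_const,
      Nat.card_Ico, Nat.add_sub_cancel_left, nsmul_eq_mul]
    ring
  rw [e]
  refine (Complex.re_le_norm _).trans ((norm_sub_le _ _).trans ?_)
  have a1 := norm_sub_le (S1 - T * (c * (starRingEnd ℂ) c)) ((S2 - T * c) * (starRingEnd ℂ) c)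
  have a2 : ‖(S2 - T * c) * (starRingEnd ℂ) c‖ ≤ δ := by
    rw [norm_mul]; exact (mul_le_of_le_one_right (norm_nonneg _) hc1').trans k2
  have a3 : ‖c * (S3 - T * (starRingEnd ℂ) c)‖ ≤ δ := by
    rw [norm_mul]; exact (mul_le_of_le_one_left (norm_nonneg _) hc1).trans k3
  linarith

theorem norm_sum_le_of_dispersion {X N₀ R : ℕ} (hN₀ : 1 ≤ N₀) {S : Finset ℕ}
    (hS : S ⊆ Ioc N₀ (2 ^ R * N₀))
    {g : ℕ → ℂ} {G : ℕ → ℕ → ℂ} {A ε : ℝ} (hg : ∀ n, ‖g n‖ ≤ A)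
    (hG : ∀ m p, ‖G m p‖ ≤ A) (hgG : ∀ m, ∀ p ∈ S, ¬p ∣ m → g (m * p) = G m p) (hε : 0 ≤ ε)
    (h : ∀ N m n T, N₀ ≤ N → resultant m n ≠ 0 → m ≤ X → n ≤ X → N ≤ T → T ≤ 2 * N →
      (∑ t ∈ Ioc N T, G m t * (starRingEnd ℂ) (G n t)).re ≤ N * ε) :
    ‖∑ n ∈ Icc 1 X, (weight S n : ℂ) * g n‖ ≤ 2 * A * (X / N₀)
      + R * (X * √(ε + A ^ 2 * (√((2 ^ R * N₀ : ℕ) / X) * (3 + Real.log X)))) := by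
  have h1 := norm_weighted_sum_sub_le (X := X) hN₀ (fun p hp => (mem_Ioc.1 (hS hp)).1) hg hG hgG
  have h2 := norm_sum_sum_le (X := X) hN₀ hS hG hε h
  have h3 := norm_le_norm_add_norm_sub' (∑ n ∈ Icc 1 X, (weight S n : ℂ) * g n)
    (∑ p ∈ S, ∑ m ∈ Icc 1 (X / p), G m p)
  linarith

theorem Ioc_eq_Ico_add {N T : ℕ} (h : N ≤ T) : Ioc N T = Ico (N + 1) (N + 1 + (T - N)) := by
  ext t; simp only [mem_Ioc, mem_Ico]; omega

/-- The characteristic function of `cototientCount Q` on `[1, X]` is close to that of a Poisson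
variable of mean `∑ q ∈ Q, 1 / q`. -/
theorem norm_sum_exp_cototientCount_sub_le {Q : Finset ℕ} (hQ : ∀ q ∈ Q, q.Prime) {y : ℝ}
    (hy : 4 ≤ y) (hQy : ∀ q ∈ Q, y < q) {X N₀ R : ℕ} (hN₀ : 1 ≤ N₀) {S : Finset ℕ}
    (hS : S ⊆ Ioc N₀ (2 ^ R * N₀)) (hP : ∀ p ∈ S, p.Prime) (hPQ : ∀ p ∈ S, p ∉ Q)
    (hX : ∀ p ∈ S, p ≤ X) (hE : 0 < recipSum S) (τ : ℝ) (K : ℕ) :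
    ‖∑ n ∈ Icc 1 X, Complex.exp (τ * Complex.I * cototientCount Q n)
        - X * Complex.exp (recipSum Q * (Complex.exp (τ * Complex.I) - 1))‖
      ≤ 2 * (X * √(3 / recipSum S)) + (4 * (X / N₀) + R * (X *
        √(3 * (2 * ((4 * recipSum Q) ^ K / K.factorial) + (144 * Real.log X + 16 * recipSum Q) / y
          + 2 * (1 + 4 * Q.card) ^ K / N₀)
        + 4 * (√((2 ^ R * N₀ : ℕ) / X) * (3 + Real.log X))))) / recipSum S := by
  set c := Complex.exp (recipSum Q * (Complex.exp (τ * Complex.I) - 1)) with hc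
  have hc1 : ‖c‖ ≤ 1 := norm_exp_recipSum_mul_le Q τ
  have hF1 : ∀ k : ℕ, ‖Complex.exp (τ * Complex.I * k)‖ = 1 := fun k => by
    rw [show (τ * Complex.I * k : ℂ) = ((τ * k : ℝ) : ℂ) * Complex.I by push_cast; ring]
    exact Complex.norm_exp_ofReal_mul_I _
  have hA : ∀ k : ℕ, ‖Complex.exp (τ * Complex.I * k) - c‖ ≤ 2 := fun k =>
    (norm_sub_le _ _).trans (by linarith [hF1 k])
  have hN₀' : (0 : ℝ) < N₀ := by exact_mod_cast hN₀
  have hlogX := Real.log_natCast_nonneg X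
  have hQ0 := recipSum_nonneg Q
  set δ := 2 * ((4 * recipSum Q) ^ K / K.factorial) + (144 * Real.log X + 16 * recipSum Q) / y
    with hδ
  have hδ0 : 0 ≤ δ := by positivity
  have h1 := norm_sum_le_of_dispersion (X := X) hN₀ hS
    (g := fun n => Complex.exp (τ * Complex.I * cototientCount Q n) - c)
    (G := fun m p => Complex.exp (τ * Complex.I * hitCount Q m p) - c)
    (A := 2) (ε := 3 * (δ + 2 * (1 + 4 * Q.card) ^ K / N₀))
    (fun n => hA _) (fun m p => hA _)
    (fun m p hp hpm => by
      show Complex.exp (τ * Complex.I * cototientCount Q (m * p)) - c = _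
      rw [cototientCount_mul hQ (hP p hp) (hPQ p hp) hpm])
    (by positivity) (fun N m n T hN hmn hm hn hT hT2 => by
      rw [Ioc_eq_Ico_add hT]
      refine (re_sum_hitCount_dispersion_le hQ hy hQy hmn hm hn τ K (N + 1) (T - N)).trans ?_
      rw [← hδ]
      have e1 : ((T - N : ℕ) : ℝ) ≤ N := by exact_mod_cast (by omega : T - N ≤ N)
      have e2 : (1 : ℝ) ≤ N / N₀ := by
        rw [le_div_iff₀ hN₀', one_mul]; exact_mod_cast hN
      have e3 : ((T - N : ℕ) : ℝ) * δ ≤ N * δ := by gcongr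
      have e4 : 2 * (1 + 4 * Q.card : ℝ) ^ K * 1 ≤ 2 * (1 + 4 * Q.card : ℝ) ^ K * (N / N₀) := by
        gcongr
      calc _ ≤ 3 * (N * δ + 2 * (1 + 4 * Q.card : ℝ) ^ K * (N / N₀)) := by linarith
        _ = _ := by ring)
  have h2 := norm_sum_sub_weighted_sum_le S hP hX hE
    (g := fun n => (Complex.exp (τ * Complex.I * cototientCount Q n) - c) / 2)
    (fun n => by
      rw [norm_div, Complex.norm_two]
      linarith [hA (cototientCount Q n)])
  set V₁ := ∑ n ∈ Icc 1 X, (weight S n : ℂ) *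
    (Complex.exp (τ * Complex.I * cototientCount Q n) - c) with hV₁
  have h3 : ∑ n ∈ Icc 1 X, (weight S n : ℂ) *
    ((Complex.exp (τ * Complex.I * cototientCount Q n) - c) / 2) = V₁ / 2 := by
    rw [hV₁, sum_div]; exact sum_congr rfl fun _ _ => by ring
  have h4 : ∑ n ∈ Icc 1 X, (Complex.exp (τ * Complex.I * cototientCount Q n) - c) / 2
      = (∑ n ∈ Icc 1 X, Complex.exp (τ * Complex.I * cototientCount Q n) - X * c) / 2 := by
    rw [← sum_div, sum_sub_distrib]; simp
  rw [h3, h4] at h2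
  set V := ∑ n ∈ Icc 1 X, Complex.exp (τ * Complex.I * cototientCount Q n) - X * c
  have h5 : ‖V‖ ≤ 2 * ‖V / 2 - V₁ / 2 / (recipSum S : ℂ)‖ + ‖V₁‖ / recipSum S := by
    have : V = 2 * (V / 2 - V₁ / 2 / (recipSum S : ℂ)) + V₁ / (recipSum S : ℂ) := by ring
    conv_lhs => rw [this]
    refine (norm_add_le _ _).trans_eq ?_
    rw [norm_mul, norm_div _ (recipSum S : ℂ), Complex.norm_two, Complex.norm_real,
      Real.norm_of_nonneg hE.le]
  refine h5.trans (add_le_add (by linarith) ?_)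
  gcongr
  refine h1.trans_eq ?_
  norm_num

/-- The indicator of `Hits m q t`. -/
def hitInd (m q t : ℕ) : ℝ := if Hits m q t then 1 else 0

theorem hitInd_nonneg (m q t : ℕ) : 0 ≤ hitInd m q t := by unfold hitInd; split_ifs <;> norm_num

theorem periodic_hitInd (m q : ℕ) : Function.Periodic (hitInd m q) q := fun t => by
  simp only [hitInd, hits_add_self]

theorem sum_hitInd (m q : ℕ) :
    ∑ r ∈ range q, hitInd m q r = ((range q).filter (Hits m q)).card := by
  simp [hitInd]

theorem sum_hitInd_le_one (m : ℕ) {q : ℕ} (hq : q.Prime) : ∑ r ∈ range q, hitInd m q r ≤ 1 := by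
  rw [sum_hitInd]; exact_mod_cast card_hits_le_one hq

theorem sum_norm_hitInd_le_one (m : ℕ) {q : ℕ} (hq : q.Prime) :
    ∑ r ∈ range q, ‖hitInd m q r‖ ≤ 1 := by
  simp only [Real.norm_of_nonneg (hitInd_nonneg _ _ _)]
  exact sum_hitInd_le_one m hq

theorem hitCount_eq_sum (Q : Finset ℕ) (m t : ℕ) :
    (hitCount Q m t : ℝ) = ∑ q ∈ Q, hitInd m q t := by
  simp [hitCount, hitInd]

theorem abs_sum_hitInd_sub_le (m : ℕ) {q : ℕ} (hq : q.Prime) (A T : ℕ) :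
    |∑ t ∈ Ico A (A + T), hitInd m q t - T * ((∑ r ∈ range q, hitInd m q r) / q)| ≤ 2 := by
  have h := norm_sum_Ico_periodic_sub_le hq.pos (periodic_hitInd m q) A T
  have := sum_norm_hitInd_le_one m hq
  rw [Real.norm_eq_abs] at h
  linarith

theorem sum_hitInd_mul_hitInd_le (m n : ℕ) {q q' : ℕ} (hq : q.Prime) (hq' : q'.Prime) (h : q ≠ q')
    (A T : ℕ) :
    ∑ t ∈ Ico A (A + T), hitInd m q t * hitInd n q' t ≤ T * (1 / q * (1 / q')) + 2 := by
  have h1 := norm_sum_Ico_prod_sub_le (S := {q, q'}) (h := fun p => if p = q then hitInd m q else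
    hitInd n q') (C := 1) (by simp [hq, hq'])
    (by simpa [h.symm] using ⟨periodic_hitInd m q, periodic_hitInd n q'⟩)
    (by simpa [h.symm] using ⟨sum_norm_hitInd_le_one m hq, sum_norm_hitInd_le_one n hq'⟩) A T
  simp only [prod_pair h, if_true, h.symm, if_false, one_pow, mul_one] at h1
  have h2 := (le_abs_self _).trans h1
  have h3 : (T : ℝ) * ((∑ r ∈ range q, hitInd m q r) / q * ((∑ r ∈ range q', hitInd n q' r) / q'))
      ≤ T * (1 / q * (1 / q')) := by
    have a := sum_hitInd_le_one m hq
    have b := sum_hitInd_le_one n hq'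
    have c : 0 ≤ ∑ r ∈ range q', hitInd n q' r := sum_nonneg fun _ _ => hitInd_nonneg _ _ _
    gcongr
  linarith

theorem sum_hitInd_mul_hitInd_self_le (m n : ℕ) {q : ℕ} (hq : q.Prime) (A T : ℕ) :
    ∑ t ∈ Ico A (A + T), hitInd m q t * hitInd n q t
      ≤ (if q ∣ resultant m n then (T : ℝ) * (1 / (q : ℝ)) else 0) + 2 := by
  split_ifs with hd
  · have h1 := (abs_le.1 (abs_sum_hitInd_sub_le m hq A T)).2
    have h2 : ∑ t ∈ Ico A (A + T), hitInd m q t * hitInd n q t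
        ≤ ∑ t ∈ Ico A (A + T), hitInd m q t := sum_le_sum fun t _ =>
      mul_le_of_le_one_right (hitInd_nonneg _ _ _) (by unfold hitInd; split_ifs <;> norm_num)
    have h3 : (T : ℝ) * ((∑ r ∈ range q, hitInd m q r) / q) ≤ T * (1 / q) := by
      have a := sum_hitInd_le_one m hq
      gcongr
    linarith
  · rw [sum_eq_zero]
    · norm_num
    · intro t _
      unfold hitInd
      by_cases a : Hits m q t
      · by_cases b : Hits n q t
        · exact absurd (dvd_resultant_of_hits a b) hd
        · simp [b]
      · simp [a]

theorem sum_hitCount_dispersion_le {Q : Finset ℕ} (hQ : ∀ q ∈ Q, q.Prime) {y : ℝ} (hy : 1 ≤ y)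
    (hQy : ∀ q ∈ Q, y < q) {X m n : ℕ} (hmn : resultant m n ≠ 0) (hm : m ≤ X) (hn : n ≤ X)
    (A T : ℕ) :
    ∑ t ∈ Ico A (A + T), ((hitCount Q m t : ℝ) - recipSum Q) * (hitCount Q n t - recipSum Q)
      ≤ T * ((1 + 2 * recipSum Q) * (12 * Real.log X / y)) + 8 * (Q.card : ℝ) ^ 2 := by
  have hρ := sum_filter_dvd_inv_le hQ (by linarith) hQy hmn hm hn
  set ρ := ∑ q ∈ Q with q ∣ resultant m n, 1 / (q : ℝ) with hρdef
  set μ := recipSum Q with hμ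
  have hμ0 : 0 ≤ μ := recipSum_nonneg Q
  have hμc : μ ≤ Q.card := by
    refine (sum_le_card_nsmul Q _ 1 fun q hq => ?_).trans_eq (by simp)
    have := hQy q hq
    rw [div_le_one (by linarith)]; linarith
  have hT : (0 : ℝ) ≤ T := Nat.cast_nonneg T
  have hρT : ∑ q ∈ Q, (if q ∣ resultant m n then T * (1 / (q : ℝ)) else 0) = T * ρ := by
    rw [← sum_filter, ← mul_sum]
  have hμT : ∑ q ∈ Q, T * (1 / (q : ℝ)) = T * μ := by rw [← mul_sum]; rfl
  have hdiv : ∀ q, q.Prime → (q ∣ m ∨ q ∣ m - m.totient → q ∣ resultant m n)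
      ∧ (q ∣ n ∨ q ∣ n - n.totient → q ∣ resultant m n) := fun q hq => by
    unfold resultant
    simp only [hq.dvd_mul]
    tauto
  have low : ∀ k, (∀ q, q.Prime → (q ∣ k ∨ q ∣ k - k.totient → q ∣ resultant m n)) →
      T * μ - T * ρ - 2 * Q.card ≤ ∑ t ∈ Ico A (A + T), (hitCount Q k t : ℝ) := by
    intro k hk
    simp only [hitCount_eq_sum]
    rw [sum_comm, ← hμT, ← hρT, ← sum_sub_distrib, mul_comm, ← nsmul_eq_mul, ← sum_const,
      ← sum_sub_distrib]
    refine sum_le_sum fun q hq => ?_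
    split_ifs with h
    · have : 0 ≤ ∑ t ∈ Ico A (A + T), hitInd k q t := sum_nonneg fun _ _ => hitInd_nonneg _ _ _
      linarith
    · have h1 := (abs_le.1 (abs_sum_hitInd_sub_le k (hQ q hq) A T)).1
      have h2 := mt (hk q (hQ q hq)) h
      rw [not_or] at h2
      rw [sum_hitInd, card_hits_eq_one (hQ q hq) h2.1 h2.2, Nat.cast_one] at h1
      linarith
  have l1 := low m fun q hq => (hdiv q hq).1
  have l2 := low n fun q hq => (hdiv q hq).2
  have up : ∑ t ∈ Ico A (A + T), (hitCount Q m t : ℝ) * hitCount Q n t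
      ≤ T * μ ^ 2 + T * ρ + 2 * (Q.card : ℝ) ^ 2 := by
    simp only [hitCount_eq_sum, sum_mul_sum]
    rw [sum_comm]
    have e1 : T * μ ^ 2 + T * ρ + 2 * (Q.card : ℝ) ^ 2
        = ∑ q ∈ Q, ∑ q' ∈ Q, (T * (1 / (q : ℝ) * (1 / (q' : ℝ))) + 2 +
          if q = q' then (if q ∣ resultant m n then T * (1 / (q : ℝ)) else 0) else 0) := by
      simp only [sum_add_distrib, sum_const, nsmul_eq_mul, ← mul_sum, sum_ite_eq, ← sum_mul]
      have : ∑ q ∈ Q, (if q ∈ Q then (if q ∣ resultant m n then T * (1 / (q : ℝ)) else 0) else 0)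
          = T * ρ := by
        rw [← hρT]; exact sum_congr rfl fun q hq => by rw [if_pos hq]
      rw [this, hμ, recipSum]
      ring
    rw [e1]
    refine sum_le_sum fun q hq => ?_
    rw [sum_comm]
    refine sum_le_sum fun q' hq' => ?_
    by_cases h : q = q'
    · subst h
      have h1 := sum_hitInd_mul_hitInd_self_le m n (hQ q hq) A T
      have h2 : 0 ≤ T * (1 / (q : ℝ) * (1 / (q : ℝ))) := by positivity
      rw [if_pos rfl]
      linarith
    · have h1 := sum_hitInd_mul_hitInd_le m n (hQ q hq) (hQ q' hq') h A T
      rw [if_neg h, add_zero]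
      exact h1
  have e : ∑ t ∈ Ico A (A + T), ((hitCount Q m t : ℝ) - μ) * (hitCount Q n t - μ)
      = ∑ t ∈ Ico A (A + T), (hitCount Q m t : ℝ) * hitCount Q n t
        - μ * ∑ t ∈ Ico A (A + T), (hitCount Q m t : ℝ)
        - μ * ∑ t ∈ Ico A (A + T), (hitCount Q n t : ℝ) + T * μ ^ 2 := by
    have : ∀ t, ((hitCount Q m t : ℝ) - μ) * (hitCount Q n t - μ)
      = (hitCount Q m t : ℝ) * hitCount Q n t - μ * hitCount Q m t - μ * hitCount Q n t + μ ^ 2 :=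
      fun t => by ring
    simp only [this, sum_add_distrib, sum_sub_distrib, ← mul_sum, sum_const, Nat.card_Ico,
      Nat.add_sub_cancel_left, nsmul_eq_mul]
  rw [e]
  have b1 := mul_le_mul_of_nonneg_left l1 hμ0
  have b2 := mul_le_mul_of_nonneg_left l2 hμ0
  have b3 : μ * Q.card ≤ (Q.card : ℝ) ^ 2 := by rw [sq]; gcongr
  have b4 : T * ((1 + 2 * μ) * ρ) ≤ T * ((1 + 2 * μ) * (12 * Real.log X / y)) := by gcongr
  nlinarith [sq_nonneg (Q.card : ℝ)]

/-- A first moment bound for `cototientCount Q` under the weight `weight S`. -/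
theorem sum_weight_mul_cototientCount_le {Q : Finset ℕ} (hQ : ∀ q ∈ Q, q.Prime) {y : ℝ}
    (hy : 1 ≤ y) (hQy : ∀ q ∈ Q, y < q) {X N₀ R : ℕ} (hN₀ : 1 ≤ N₀) {S : Finset ℕ}
    (hS : S ⊆ Ioc N₀ (2 ^ R * N₀)) (hP : ∀ p ∈ S, p.Prime) (hPQ : ∀ p ∈ S, p ∉ Q) :
    ∑ n ∈ Icc 1 X, (weight S n : ℝ) * cototientCount Q n
      ≤ X * recipSum S * recipSum Q + (2 * Q.card * (X / N₀) + R * (X *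
        √((1 + 2 * recipSum Q) * (12 * Real.log X / y) + 8 * Q.card ^ 2 / N₀
        + Q.card ^ 2 * (√((2 ^ R * N₀ : ℕ) / X) * (3 + Real.log X))))) := by
  have hN₀' : (0 : ℝ) < N₀ := by exact_mod_cast hN₀
  have hlogX := Real.log_natCast_nonneg X
  have hQ0 := recipSum_nonneg Q
  have hμc : recipSum Q ≤ Q.card := by
    refine (sum_le_card_nsmul Q _ 1 fun q hq => ?_).trans_eq (by simp)
    have := hQy q hq
    rw [div_le_one (by linarith)]; linarith
  have hA : ∀ k : ℕ, k ≤ Q.card → ‖((k : ℂ) - (recipSum Q : ℂ))‖ ≤ Q.card := fun k hk => by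
    rw [show (k : ℂ) - (recipSum Q : ℂ) = ((k - recipSum Q : ℝ) : ℂ) by push_cast; ring,
      Complex.norm_real, Real.norm_eq_abs, abs_le]
    have : (k : ℝ) ≤ Q.card := by exact_mod_cast hk
    constructor <;> linarith [(Nat.cast_nonneg k : (0 : ℝ) ≤ k)]
  have h1 := norm_sum_le_of_dispersion (X := X) hN₀ hS
    (g := fun n => (cototientCount Q n : ℂ) - (recipSum Q : ℂ))
    (G := fun m p => (hitCount Q m p : ℂ) - (recipSum Q : ℂ))
    (A := Q.card) (ε := (1 + 2 * recipSum Q) * (12 * Real.log X / y) + 8 * Q.card ^ 2 / N₀)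
    (fun n => hA _ (card_filter_le _ _)) (fun m p => hA _ (card_filter_le _ _))
    (fun m p hp hpm => by
      show (cototientCount Q (m * p) : ℂ) - (recipSum Q : ℂ) = _
      rw [cototientCount_mul hQ (hP p hp) (hPQ p hp) hpm])
    (by positivity) (fun N m n T hN hmn hm hn hT hT2 => by
      rw [Ioc_eq_Ico_add hT]
      have e0 : ∀ t, ((hitCount Q m t : ℂ) - (recipSum Q : ℂ))
          * (starRingEnd ℂ) ((hitCount Q n t : ℂ) - (recipSum Q : ℂ))
          = ((((hitCount Q m t : ℝ) - recipSum Q) * (hitCount Q n t - recipSum Q) : ℝ) : ℂ) := by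
        intro t
        rw [map_sub, Complex.conj_natCast, Complex.conj_ofReal]
        push_cast; ring
      simp only [e0]
      rw [← Complex.ofReal_sum, Complex.ofReal_re]
      refine (sum_hitCount_dispersion_le hQ hy hQy hmn hm hn (N + 1) (T - N)).trans ?_
      have e1 : ((T - N : ℕ) : ℝ) ≤ N := by exact_mod_cast (by omega : T - N ≤ N)
      have e2 : (1 : ℝ) ≤ N / N₀ := by
        rw [le_div_iff₀ hN₀', one_mul]; exact_mod_cast hN
      have e3 : ((T - N : ℕ) : ℝ) * ((1 + 2 * recipSum Q) * (12 * Real.log X / y))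
          ≤ N * ((1 + 2 * recipSum Q) * (12 * Real.log X / y)) := by gcongr
      have e4 : 8 * (Q.card : ℝ) ^ 2 * 1 ≤ 8 * (Q.card : ℝ) ^ 2 * (N / N₀) := by
        gcongr
      calc _ ≤ N * ((1 + 2 * recipSum Q) * (12 * Real.log X / y))
            + 8 * (Q.card : ℝ) ^ 2 * (N / N₀) := by linarith
        _ = _ := by ring)
  have h2 : ∑ n ∈ Icc 1 X, (weight S n : ℝ) ≤ X * recipSum S := by
    have := sum_weight_mul S (fun p hp => (hP p hp).pos) X (fun _ => (1 : ℝ))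
    simp only [mul_one] at this
    rw [this, recipSum, mul_sum]
    refine sum_le_sum fun p _ => ?_
    simp only [sum_const, Nat.card_Icc, Nat.add_sub_cancel, nsmul_eq_mul, mul_one]
    exact Nat.cast_div_le.trans_eq (by ring)
  have h3 : ∑ n ∈ Icc 1 X, (weight S n : ℂ) * ((cototientCount Q n : ℂ) - (recipSum Q : ℂ))
      = ((∑ n ∈ Icc 1 X, (weight S n : ℝ) * cototientCount Q n
        - (∑ n ∈ Icc 1 X, (weight S n : ℝ)) * recipSum Q : ℝ) : ℂ) := by
    push_cast
    rw [sum_mul, ← sum_sub_distrib]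
    exact sum_congr rfl fun _ _ => by ring
  rw [h3, Complex.norm_real] at h1
  have h4 := (le_abs_self _).trans h1
  have h5 := mul_le_mul_of_nonneg_right h2 hQ0
  linarith

theorem card_range_filter_dvd_add_mul {r q : ℕ} (hr : r.Prime) (hq : q.Prime) (hrq : r ≠ q)
    (c : ℕ) :
    ((range r).filter (fun s => r ∣ c + q * s)).card = 1 := by
  have hc : Nat.Coprime r q := (Nat.coprime_primes hr hq).2 hrq
  refine le_antisymm (card_le_one.2 fun s hs t ht => ?_) (card_pos.2 ?_)
  · simp only [mem_filter, mem_range] at hs ht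
    refine Nat.ModEq.eq_of_lt_of_lt (Nat.ModEq.cancel_left_of_coprime (m := r) (c := q) hc
      (Nat.ModEq.add_left_cancel' c ?_)) hs.1 ht.1
    exact ((Nat.modEq_zero_iff_dvd).2 hs.2).trans ((Nat.modEq_zero_iff_dvd).2 ht.2).symm
  · have := Fact.mk hr
    have h0 : (q : ZMod r) ≠ 0 := by
      rw [Ne, ZMod.natCast_eq_zero_iff]
      exact hr.coprime_iff_not_dvd.1 hc
    refine ⟨(-(c : ZMod r) / (q : ZMod r)).val, ?_⟩
    rw [mem_filter, mem_range]
    refine ⟨ZMod.val_lt _, ?_⟩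
    rw [← ZMod.natCast_eq_zero_iff, Nat.cast_add, Nat.cast_mul, ZMod.natCast_zmod_val]
    field_simp
    ring

/-- Brun's pure sieve for an arithmetic progression with modulus `q` and the sieving primes `W`. -/
theorem card_filter_forall_not_dvd_le {W : Finset ℕ} (hW : ∀ r ∈ W, r.Prime) {q : ℕ} (hq : q.Prime)
    (hqW : q ∉ W) (c K A T : ℕ) :
    (((Ico A (A + T)).filter fun s => ∀ r ∈ W, ¬r ∣ c + q * s).card : ℝ)
      ≤ T * (Real.exp (-recipSum W) + 2 * (recipSum W ^ K / K.factorial))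
        + 2 * (1 + W.card) ^ K := by
  set g : ℕ → ℕ → ℂ := fun r s => if r ∣ c + q * s then -1 else 0 with hg
  have hcard : ∀ r ∈ W, ((range r).filter (fun s => r ∣ c + q * s)).card = 1 := fun r hr =>
    card_range_filter_dvd_add_mul (hW r hr) hq (fun h => hqW (h ▸ hr)) c
  have h1 := norm_sum_prod_one_add_sub_le hW (g := g)
    (fun r _ s => by
      simp only [hg, mul_add, ← add_assoc, Nat.dvd_add_left (Dvd.intro_left q rfl)])
    (fun r _ s => by simp only [hg]; split_ifs <;> simp) (C := 1) zero_le_one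
    (fun r hr => by
      have : ∀ s, ‖g r s‖ = if r ∣ c + q * s then 1 else 0 := fun s => by
        simp only [hg]; split_ifs <;> simp
      simp only [this]
      rw [sum_boole, hcard r hr, Nat.cast_one]) K A T
  have h2 : ∑ s ∈ Ico A (A + T), ∏ r ∈ W, (1 + g r s)
      = (((Ico A (A + T)).filter fun s => ∀ r ∈ W, ¬r ∣ c + q * s).card : ℂ) := by
    rw [← sum_boole]
    refine sum_congr rfl fun s _ => ?_
    split_ifs with h
    · exact prod_eq_one fun r hr => by simp [hg, h r hr]
    · push Not at h
      obtain ⟨r, hr, hd⟩ := h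
      exact prod_eq_zero hr (by simp [hg, hd])
  have h3 : ‖(T : ℂ) * ∏ r ∈ W, (1 + (∑ s ∈ range r, g r s) / r)‖
      ≤ T * Real.exp (-recipSum W) := by
    rw [norm_mul, Complex.norm_natCast, norm_prod, recipSum, ← sum_neg_distrib, Real.exp_sum]
    gcongr with r hr
    have hr2 : (1 : ℝ) < r := by exact_mod_cast (hW r hr).one_lt
    have : ∑ s ∈ range r, g r s = -1 := by
      have : ∀ s, g r s = -(if r ∣ c + q * s then 1 else 0) := fun s => by
        simp only [hg]; split_ifs <;> simp
      simp only [this, sum_neg_distrib]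
      rw [sum_boole, hcard r hr, Nat.cast_one]
    rw [this, show (1 : ℂ) + -1 / r = ((1 - 1 / r : ℝ) : ℂ) by push_cast; ring, Complex.norm_real,
      Real.norm_of_nonneg (by rw [sub_nonneg, div_le_one (by linarith)]; exact hr2.le)]
    linarith [Real.add_one_le_exp (-(1 / (r : ℝ)))]
  rw [h2] at h1
  have h4 := (norm_le_norm_add_norm_sub' _ _).trans (add_le_add h3 h1)
  rw [Complex.norm_natCast] at h4
  simp only [one_mul] at h4
  refine h4.trans_eq ?_
  rw [recipSum]
  ring

theorem card_primes_modEq_le {W : Finset ℕ} (hW : ∀ r ∈ W, r.Prime) {q N : ℕ} (hq : q.Prime)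
    (hqN : q ≤ N) (hWN : ∀ r ∈ W, r ≤ N) (c K : ℕ) :
    (((Ioc N (2 * N)).filter fun P => P.Prime ∧ P ≡ c [MOD q]).card : ℝ)
      ≤ 3 * N / q * (Real.exp (1 - recipSum W) + 2 * (recipSum W ^ K / K.factorial))
        + 2 * (1 + W.card) ^ K := by
  have hq0 := hq.pos
  have hq0' : (0 : ℝ) < q := by exact_mod_cast hq0
  have h1 := card_filter_forall_not_dvd_le (W := W.erase q)
    (fun r hr => hW r (mem_of_mem_erase hr)) hq (notMem_erase q W) (c % q) K (N / q)
    (2 * N / q - N / q + 1)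
  have hle : N / q ≤ 2 * N / q := Nat.div_le_div_right (by omega)
  have h2 : ((Ioc N (2 * N)).filter fun P => P.Prime ∧ P ≡ c [MOD q]).card
      ≤ ((Ico (N / q) (N / q + (2 * N / q - N / q + 1))).filter
        fun s => ∀ r ∈ W.erase q, ¬r ∣ c % q + q * s).card := by
    refine card_le_card_of_injOn (· / q) (fun P hP => ?_) (fun P hP P' hP' h => ?_)
    · simp only [coe_filter, mem_Ioc, Set.mem_ofPred_eq] at hP
      have hdec : c % q + q * (P / q) = P := by
        have := Nat.mod_add_div P q
        rwa [show P % q = c % q from hP.2.2] at this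
      simp only [coe_filter, mem_Ico, Set.mem_ofPred_eq]
      refine ⟨⟨Nat.div_le_div_right hP.1.1.le, ?_⟩, fun r hr hd => ?_⟩
      · have : P / q ≤ 2 * N / q := Nat.div_le_div_right hP.1.2
        omega
      · rw [hdec] at hd
        have hrW := mem_of_mem_erase hr
        have := (Nat.prime_dvd_prime_iff_eq (hW r hrW) hP.2.1).1 hd
        have := hWN r hrW
        omega
    · simp only [coe_filter, mem_Ioc, Set.mem_ofPred_eq] at hP hP'
      have a := Nat.mod_add_div P q
      have b := Nat.mod_add_div P' q
      rw [show P % q = c % q from hP.2.2] at a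
      rw [show P' % q = c % q from hP'.2.2] at b
      simp only at h
      rw [← a, ← b, h]
  have hT : ((2 * N / q - N / q + 1 : ℕ) : ℝ) ≤ 3 * N / q := by
    have a : ((2 * N / q : ℕ) : ℝ) ≤ 2 * N / q := by
      exact Nat.cast_div_le.trans_eq (by push_cast; ring)
    have b : (N : ℝ) / q < (N / q : ℕ) + 1 := by
      rw [div_lt_iff₀ hq0']
      have := Nat.lt_mul_div_succ N hq0
      rw [mul_comm] at this
      exact_mod_cast this
    have c : (1 : ℝ) ≤ N / q := by
      rw [le_div_iff₀ hq0', one_mul]; exact_mod_cast hqN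
    rw [Nat.cast_add, Nat.cast_sub hle, Nat.cast_one]
    rw [mul_div_assoc] at a ⊢
    linarith
  have hrec : recipSum W - 1 ≤ recipSum (W.erase q) := by
    by_cases h : q ∈ W
    · have : recipSum W = recipSum (W.erase q) + 1 / q := (sum_erase_add W _ h).symm
      have : 1 / (q : ℝ) ≤ 1 := by
        rw [div_le_one hq0']; exact_mod_cast hq.one_le
      linarith
    · rw [erase_eq_of_notMem h]; linarith
  have hrec' : recipSum (W.erase q) ≤ recipSum W :=
    sum_le_sum_of_subset_of_nonneg (erase_subset _ _) fun _ _ _ => by positivity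
  have hexp : Real.exp (-recipSum (W.erase q)) ≤ Real.exp (1 - recipSum W) :=
    Real.exp_le_exp.2 (by linarith)
  have h0 := recipSum_nonneg (W.erase q)
  have h0' := recipSum_nonneg W
  have hc : (((W.erase q).card : ℕ) : ℝ) ≤ W.card := by exact_mod_cast card_erase_le
  calc _ ≤ _ := Nat.cast_le.2 h2
    _ ≤ _ := h1
    _ ≤ _ := by gcongr

theorem sum_primes_sum_hitCount_le {Q W : Finset ℕ} (hQ : ∀ q ∈ Q, q.Prime)
    (hW : ∀ r ∈ W, r.Prime) {X N : ℕ} (hN : 1 ≤ N) (hQN : ∀ q ∈ Q, q ≤ N) (hWN : ∀ r ∈ W, r ≤ N)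
    (K : ℕ) :
    ∑ P ∈ Ioc N (2 * N) with P.Prime, ∑ m ∈ Icc 1 (X / P), (hitCount Q m P : ℝ)
      ≤ X * (3 * (Real.exp (1 - recipSum W) + 2 * (recipSum W ^ K / K.factorial)) * recipSum Q
        + 2 * Q.card * (1 + W.card) ^ K / N) := by
  set η := Real.exp (1 - recipSum W) + 2 * (recipSum W ^ K / K.factorial) with hη
  have hN' : (0 : ℝ) < N := by exact_mod_cast hN
  have hη0 : 0 ≤ η := by have := recipSum_nonneg W; positivity
  have hQ0 := recipSum_nonneg Q
  have h1 : ∀ m q, q ∈ Q → ∑ P ∈ Ioc N (2 * N) with P.Prime, (if Hits m q P then (1 : ℝ) else 0)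
      ≤ 3 * N / q * η + 2 * (1 + W.card) ^ K := by
    intro m q hq
    rw [sum_boole, filter_filter]
    rcases ((Ioc N (2 * N)).filter fun P => P.Prime ∧ Hits m q P).eq_empty_or_nonempty with h | h
    · rw [h, card_empty, Nat.cast_zero]; positivity
    · obtain ⟨c, hc⟩ := h
      refine le_trans ?_ (card_primes_modEq_le hW (hQ q hq) (hQN q hq) hWN c K)
      refine Nat.cast_le.2 (card_le_card fun P hP => ?_)
      rw [mem_filter] at hP hc ⊢
      exact ⟨hP.1, hP.2.1, hits_unique (hQ q hq) hP.2.2 hc.2.2⟩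
  have h2 : ∀ m, ∑ P ∈ Ioc N (2 * N) with P.Prime, (hitCount Q m P : ℝ)
      ≤ 3 * N * η * recipSum Q + 2 * Q.card * (1 + W.card) ^ K := by
    intro m
    simp only [hitCount, card_filter, Nat.cast_sum, Nat.cast_ite, Nat.cast_one, Nat.cast_zero]
    rw [sum_comm]
    refine (sum_le_sum fun q hq => h1 m q hq).trans_eq ?_
    rw [sum_add_distrib, sum_const, nsmul_eq_mul, recipSum, mul_sum]
    congr 1
    · exact sum_congr rfl fun q _ => by ring
    · ring
  calc ∑ P ∈ Ioc N (2 * N) with P.Prime, ∑ m ∈ Icc 1 (X / P), (hitCount Q m P : ℝ)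
      ≤ ∑ P ∈ Ioc N (2 * N) with P.Prime, ∑ m ∈ Icc 1 (X / N), (hitCount Q m P : ℝ) := by
        refine sum_le_sum fun P hP => sum_le_sum_of_subset_of_nonneg
          (Icc_subset_Icc_right ?_) fun _ _ _ => Nat.cast_nonneg _
        exact Nat.div_le_div_left (mem_Ioc.1 (mem_filter.1 hP).1).1.le hN
    _ = ∑ m ∈ Icc 1 (X / N), ∑ P ∈ Ioc N (2 * N) with P.Prime, (hitCount Q m P : ℝ) := sum_comm
    _ ≤ (X / N : ℕ) • (3 * N * η * recipSum Q + 2 * Q.card * (1 + W.card) ^ K) :=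
        (sum_le_card_nsmul _ _ _ fun m _ => h2 m).trans_eq (by simp)
    _ ≤ X / N * (3 * N * η * recipSum Q + 2 * Q.card * (1 + W.card) ^ K) := by
        rw [nsmul_eq_mul]
        gcongr
        exact Nat.cast_div_le
    _ = _ := by field_simp

/-- A first moment bound for `cototientCount Q`, for a set `Q` of small primes. -/
theorem sum_weight_mul_cototientCount_le_of_sieve {Q W : Finset ℕ} (hQ : ∀ q ∈ Q, q.Prime)
    (hW : ∀ r ∈ W, r.Prime) {X N₀ R : ℕ} (hN₀ : 1 ≤ N₀) (hQN : ∀ q ∈ Q, q ≤ N₀)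
    (hWN : ∀ r ∈ W, r ≤ N₀) {S : Finset ℕ} (hS : S ⊆ Ioc N₀ (2 ^ R * N₀))
    (hP : ∀ p ∈ S, p.Prime) (K : ℕ) :
    ∑ n ∈ Icc 1 X, (weight S n : ℝ) * cototientCount Q n
      ≤ 2 * Q.card * (X / N₀) + R * (X * (3 * (Real.exp (1 - recipSum W)
        + 2 * (recipSum W ^ K / K.factorial)) * recipSum Q
        + 2 * Q.card * (1 + W.card) ^ K / N₀)) := by
  have hN₀' : (0 : ℝ) < N₀ := by exact_mod_cast hN₀
  have hQ0 := recipSum_nonneg Q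
  have hW0 := recipSum_nonneg W
  set B := X * (3 * (Real.exp (1 - recipSum W) + 2 * (recipSum W ^ K / K.factorial)) * recipSum Q
    + 2 * Q.card * (1 + W.card) ^ K / N₀ : ℝ) with hB
  set f : ℕ → ℝ := fun P => ∑ m ∈ Icc 1 (X / P), (hitCount Q m P : ℝ) with hf
  have hf0 : ∀ P, 0 ≤ f P := fun P => sum_nonneg fun _ _ => Nat.cast_nonneg _
  have hcast : ∀ k : ℕ, k ≤ Q.card → ‖(k : ℂ)‖ ≤ Q.card := fun k hk => by
    rw [Complex.norm_natCast]; exact_mod_cast hk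
  have h1 := norm_weighted_sum_sub_le (X := X) hN₀ (fun p hp => (mem_Ioc.1 (hS hp)).1)
    (g := fun n => (cototientCount Q n : ℂ)) (G := fun m p => (hitCount Q m p : ℂ))
    (A := Q.card) (fun n => hcast _ (card_filter_le _ _)) (fun m p => hcast _ (card_filter_le _ _))
    (fun m p hp hpm => by
      show (cototientCount Q (m * p) : ℂ) = _
      rw [cototientCount_mul hQ (hP p hp)
        (fun h => absurd (hQN p h) (not_le.2 (mem_Ioc.1 (hS hp)).1)) hpm])
  have h2 : (∑ n ∈ Icc 1 X, (weight S n : ℂ) * (cototientCount Q n : ℂ)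
      - ∑ p ∈ S, ∑ m ∈ Icc 1 (X / p), (hitCount Q m p : ℂ))
      = ((∑ n ∈ Icc 1 X, (weight S n : ℝ) * cototientCount Q n - ∑ p ∈ S, f p : ℝ) : ℂ) := by
    simp only [hf]
    push_cast
    rfl
  rw [h2, Complex.norm_real] at h1
  have h3 := (le_abs_self _).trans h1
  have key : ∀ r : ℕ, ∑ P ∈ Ioc N₀ (2 ^ r * N₀) with P.Prime, f P ≤ r * B := by
    intro r
    induction r with
    | zero => simp
    | succ r ih =>
      have hle : N₀ ≤ 2 ^ r * N₀ := Nat.le_mul_of_pos_left _ (by positivity)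
      have hsplit : (Ioc N₀ (2 ^ (r + 1) * N₀)).filter Nat.Prime
          = (Ioc N₀ (2 ^ r * N₀)).filter Nat.Prime
            ∪ (Ioc (2 ^ r * N₀) (2 * (2 ^ r * N₀))).filter Nat.Prime := by
        rw [← filter_union, Ioc_union_Ioc_eq_Ioc hle (by omega), pow_succ]
        congr 2; ring
      have h4 := sum_primes_sum_hitCount_le (X := X) hQ hW (hN₀.trans hle)
        (fun q hq => (hQN q hq).trans hle) (fun q hq => (hWN q hq).trans hle) K
      have h5 : X * (3 * (Real.exp (1 - recipSum W) + 2 * (recipSum W ^ K / K.factorial))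
          * recipSum Q + 2 * Q.card * (1 + W.card) ^ K / (2 ^ r * N₀ : ℕ) : ℝ) ≤ B := by
        rw [hB]; gcongr
      rw [hsplit]
      refine (sum_union_inter (s₁ := (Ioc N₀ (2 ^ r * N₀)).filter Nat.Prime)
        (s₂ := (Ioc (2 ^ r * N₀) (2 * (2 ^ r * N₀))).filter Nat.Prime) (f := f) ▸
        le_add_of_nonneg_right (sum_nonneg fun _ _ => hf0 _)).trans ?_
      push_cast
      linarith
  have h4 : ∑ p ∈ S, f p ≤ R * B := by
    refine le_trans (sum_le_sum_of_subset_of_nonneg (fun p hp => ?_) fun _ _ _ => hf0 _) (key R)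
    exact mem_filter.2 ⟨hS hp, hP p hp⟩
  linarith

end

section

open Finset Filter Asymptotics

theorem pow_div_factorial_le_exp_neg {a : ℝ} (ha : 0 ≤ a) {K : ℕ} (h : 8 * a ≤ K) :
    a ^ K / K.factorial ≤ Real.exp (-K) := by
  have h1 := Real.pow_div_factorial_le_exp (8 * a) (by positivity) K
  have h2 : (8 : ℝ) ^ K * (a ^ K / K.factorial) ≤ Real.exp K := by
    rw [← mul_div_assoc, ← mul_pow]
    exact h1.trans (Real.exp_le_exp.2 h)
  have h3 : Real.exp K * Real.exp K ≤ 8 ^ K := by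
    rw [← Real.exp_add, ← mul_two, Real.exp_mul, ← Real.exp_one_rpow (K : ℝ)]
    rw [Real.rpow_natCast, Real.rpow_two, ← pow_mul, mul_comm, pow_mul]
    have := Real.exp_one_lt_d9
    have := Real.exp_pos 1
    gcongr
    nlinarith
  have hpos := Real.exp_pos (K : ℝ)
  rw [Real.exp_neg, ← one_div, le_div_iff₀ hpos]
  have h4 : 0 ≤ a ^ K / K.factorial := by positivity
  have h5 := mul_le_mul_of_nonneg_right h3 h4
  nlinarith

/-- The primes in the dyadic range `(⌊exp a⌋, 2 ^ ⌊b⌋ * ⌊exp a⌋]`. -/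
noncomputable def dyadicPrimes (a b : ℝ) : Finset ℕ :=
  primesIoc (⌊Real.exp a⌋₊ : ℕ) (2 ^ ⌊b⌋₊ * ⌊Real.exp a⌋₊ : ℕ)

theorem dyadicPrimes_subset (a b : ℝ) :
    dyadicPrimes a b ⊆ Ioc ⌊Real.exp a⌋₊ (2 ^ ⌊b⌋₊ * ⌊Real.exp a⌋₊) := by
  unfold dyadicPrimes primesIoc
  rw [Nat.floor_natCast, Nat.floor_natCast]
  exact filter_subset _ _

theorem two_le_floor_exp {a : ℝ} (ha : 1 ≤ a) : 2 ≤ ⌊Real.exp a⌋₊ :=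
  Nat.le_floor (by
    have := Real.exp_le_exp.2 ha
    have := Real.exp_one_gt_d9
    push_cast; linarith)

theorem exp_le_two_mul_floor {a : ℝ} (ha : 0 ≤ a) : Real.exp a ≤ 2 * ⌊Real.exp a⌋₊ := by
  have h1 := Nat.lt_floor_add_one (Real.exp a)
  have h2 : (1 : ℝ) ≤ ⌊Real.exp a⌋₊ := by
    exact_mod_cast Nat.le_floor (by simpa using ha)
  linarith

theorem two_pow_floor_mul_floor_exp_le {a b : ℝ} (hb : 0 ≤ b) :
    ((2 ^ ⌊b⌋₊ * ⌊Real.exp a⌋₊ : ℕ) : ℝ) ≤ Real.exp (a + b) := by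
  push_cast
  rw [add_comm, Real.exp_add]
  gcongr
  · calc (2 : ℝ) ^ ⌊b⌋₊ ≤ Real.exp 1 ^ ⌊b⌋₊ := by
          gcongr; linarith [Real.exp_one_gt_d9]
      _ = Real.exp ⌊b⌋₊ := by rw [← Real.exp_nat_mul, mul_one]
      _ ≤ Real.exp b := Real.exp_le_exp.2 (Nat.floor_le hb)
  · exact Nat.floor_le (Real.exp_pos _).le

theorem exists_le_recipSum_dyadicPrimes :
    ∃ C, ∀ a b : ℝ, 1 ≤ a → a ≤ b → 2 ≤ b → Real.log (b / a) - C ≤ recipSum (dyadicPrimes a b) := by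
  obtain ⟨C, hC0, hC⟩ := exists_abs_sum_primesIoc_le
  refine ⟨C + Real.log 4, fun a b ha hab hb => ?_⟩
  have hN : (2 : ℝ) ≤ ⌊Real.exp a⌋₊ := by exact_mod_cast two_le_floor_exp ha
  have hR := Nat.lt_floor_add_one b
  have h1 := (abs_le.1 (hC (⌊Real.exp a⌋₊ : ℕ) (2 ^ ⌊b⌋₊ * ⌊Real.exp a⌋₊ : ℕ) hN (by
    exact_mod_cast Nat.le_mul_of_pos_left _ (by positivity)))).1
  have h2 : Real.log (Real.log ⌊Real.exp a⌋₊) ≤ Real.log a := by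
    refine Real.log_le_log (Real.log_pos (by linarith)) ?_
    exact (Real.log_le_log (by linarith) (Nat.floor_le (Real.exp_pos a).le)).trans_eq
      (Real.log_exp a)
  have h3 : Real.log (b / 4) ≤ Real.log (Real.log (2 ^ ⌊b⌋₊ * ⌊Real.exp a⌋₊ : ℕ)) := by
    refine Real.log_le_log (by linarith) ?_
    push_cast
    rw [Real.log_mul (by positivity) (by positivity), Real.log_pow]
    have := Real.log_two_gt_d9
    have h4 : 0 ≤ Real.log ⌊Real.exp a⌋₊ := Real.log_natCast_nonneg _
    nlinarith
  rw [Real.log_div (by linarith) (by linarith)]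
  rw [Real.log_div (by linarith) (by norm_num)] at h3
  unfold recipSum dyadicPrimes
  linarith

/-- The scale `log x`, as a function of `s = (log log x) ^ (1 / 16)`. -/
noncomputable def logScale (s : ℝ) : ℝ := Real.exp (s ^ 16)

/-- The length `⌊x⌋` of the range, as a function of `s = (log log x) ^ (1 / 16)`. -/
noncomputable def range₀ (s : ℝ) : ℕ := ⌊Real.exp (logScale s)⌋₊

theorem logScale_pos (s : ℝ) : 0 < logScale s := Real.exp_pos _

theorem eventually_pow_le_exp (k : ℕ) : ∀ᶠ s : ℝ in atTop, s ^ k ≤ Real.exp s := by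
  have := (Real.isLittleO_pow_exp_atTop (n := k)).bound zero_lt_one
  filter_upwards [this, eventually_ge_atTop 0] with s h hs
  rwa [one_mul, Real.norm_of_nonneg (by positivity), Real.norm_of_nonneg (Real.exp_pos _).le] at h

theorem eventually_pow_le_logScale (k : ℕ) : ∀ᶠ s : ℝ in atTop, s ^ k ≤ logScale s := by
  filter_upwards [eventually_pow_le_exp k, eventually_ge_atTop 1] with s h hs
  exact h.trans (Real.exp_le_exp.2 (le_self_pow₀ hs (by norm_num)))

theorem log_range₀_le (s : ℝ) : Real.log (range₀ s) ≤ logScale s := by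
  have h : (1 : ℝ) ≤ range₀ s := by
    have : 1 ≤ range₀ s := Nat.le_floor (by simpa using (logScale_pos s).le)
    exact_mod_cast this
  have h2 : (range₀ s : ℝ) ≤ Real.exp (logScale s) := Nat.floor_le (Real.exp_pos _).le
  exact (Real.log_le_log (by linarith) h2).trans_eq (Real.log_exp _)

theorem tendsto_recipSum_dyadicPrimes {a b : ℝ → ℝ} (ha : ∀ᶠ s in atTop, 1 ≤ a s)
    (hab : Tendsto (fun s => b s / a s) atTop atTop) :
    Tendsto (fun s => recipSum (dyadicPrimes (a s) (b s))) atTop atTop := by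
  obtain ⟨C, hC⟩ := exists_le_recipSum_dyadicPrimes
  have h1 : Tendsto (fun s => Real.log (b s / a s) - C) atTop atTop :=
    tendsto_atTop_add_const_right _ _ (Real.tendsto_log_atTop.comp hab)
  refine tendsto_atTop_mono' _ ?_ h1
  filter_upwards [ha, hab.eventually_ge_atTop 2] with s h1 h2
  rw [le_div_iff₀ (by linarith)] at h2
  exact hC _ _ h1 (by linarith) (by linarith)

/-- The primes up to `exp (s ^ 32)`. -/
noncomputable def smallPrimes (s : ℝ) : Finset ℕ := primesIoc 0 (Real.exp (s ^ 32))

/-- The primes carrying the main contribution to the normal law. -/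
noncomputable def midPrimes (s : ℝ) : Finset ℕ :=
  primesIoc (Real.exp (s ^ 32)) (Real.exp (logScale s / s ^ 40))

/-- The primes between the main range and a small power of `x`. -/
noncomputable def largePrimes (s : ℝ) : Finset ℕ :=
  primesIoc (Real.exp (logScale s / s ^ 40)) (Real.exp (logScale s / s ^ 4))

/-- The primes used for sieving. -/
noncomputable def sievePrimes (s : ℝ) : Finset ℕ := primesIoc 0 (Real.exp (s ^ 38))

theorem eventually_log_le (A C : ℝ) (hA : 0 ≤ A) : ∀ᶠ s : ℝ in atTop, A * Real.log s + C ≤ s := by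
  have h1 := (Real.isLittleO_log_id_atTop.bound (show 0 < 1 / (2 * (A + 1)) by positivity))
  filter_upwards [h1, eventually_ge_atTop 1, eventually_ge_atTop (2 * C)] with s h hs hsC
  rw [Real.norm_of_nonneg (Real.log_nonneg hs), id, Real.norm_of_nonneg (by linarith)] at h
  have h2 : A * Real.log s ≤ A * (1 / (2 * (A + 1)) * s) := by gcongr
  have h3 : A * (1 / (2 * (A + 1)) * s) ≤ s / 2 := by
    rw [div_mul_eq_mul_div, mul_div_assoc', div_le_div_iff₀ (by positivity) (by norm_num)]
    nlinarith
  linarith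

theorem eventually_logScale_eq :
    ∀ᶠ s : ℝ in atTop, ∃ v : ℝ, s ^ 40 ≤ v ∧ logScale s = v * s ^ 40 := by
  filter_upwards [eventually_pow_le_logScale 80, eventually_ge_atTop 1] with s h hs
  have : 0 < s ^ 40 := by positivity
  refine ⟨logScale s / s ^ 40, ?_, by field_simp⟩
  rw [le_div_iff₀ this, ← pow_add]
  exact h

theorem log_logScale_div (s : ℝ) (hs : 1 ≤ s) (k : ℕ) :
    Real.log (logScale s / s ^ k) = s ^ 16 - k * Real.log s := by
  rw [Real.log_div (logScale_pos s).ne' (by positivity), logScale, Real.log_exp, Real.log_pow]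

theorem eventually_abs_recipSum_midPrimes_sub_le :
    ∀ᶠ s : ℝ in atTop, |recipSum (midPrimes s) - s ^ 16| ≤ s := by
  obtain ⟨C, hC0, hC⟩ := exists_abs_sum_primesIoc_le
  filter_upwards [eventually_ge_atTop 2, eventually_logScale_eq,
    eventually_log_le 72 C (by norm_num)]
    with s hs ⟨v, hv, hD⟩ hlog
  have hs1 : 1 ≤ s := by linarith
  have h32 : 1 ≤ s ^ 32 := one_le_pow₀ hs1
  have hsv : s ^ 32 ≤ logScale s / s ^ 40 := by
    rw [hD, mul_div_cancel_right₀ _ (by positivity)]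
    exact (pow_le_pow_right₀ hs1 (by norm_num)).trans hv
  have h := hC (Real.exp (s ^ 32)) (Real.exp (logScale s / s ^ 40))
    (by have := Real.exp_le_exp.2 h32; linarith [Real.exp_one_gt_d9]) (Real.exp_le_exp.2 hsv)
  rw [Real.log_exp, Real.log_exp, log_logScale_div s hs1, Real.log_pow] at h
  have hl := Real.log_nonneg hs1
  unfold recipSum midPrimes
  push_cast at h
  rw [abs_le] at h ⊢
  constructor <;> linarith [h.1, h.2]

theorem eventually_recipSum_largePrimes_le :
    ∀ᶠ s : ℝ in atTop, recipSum (largePrimes s) ≤ s := by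
  obtain ⟨C, hC0, hC⟩ := exists_abs_sum_primesIoc_le
  filter_upwards [eventually_ge_atTop 2, eventually_logScale_eq,
    eventually_log_le 36 C (by norm_num)]
    with s hs ⟨v, hv, hD⟩ hlog
  have hs1 : 1 ≤ s := by linarith
  have h40 : 1 ≤ s ^ 40 := one_le_pow₀ hs1
  have h := (abs_le.1 (hC (Real.exp (logScale s / s ^ 40)) (Real.exp (logScale s / s ^ 4))
    (by
      rw [hD, mul_div_cancel_right₀ _ (by positivity)]
      have := Real.exp_le_exp.2 (h40.trans hv)
      linarith [Real.exp_one_gt_d9])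
    (Real.exp_le_exp.2 (div_le_div_of_nonneg_left (logScale_pos s).le (by positivity)
      (pow_le_pow_right₀ hs1 (by norm_num)))))).2
  rw [Real.log_exp, Real.log_exp, log_logScale_div s hs1, log_logScale_div s hs1] at h
  unfold recipSum largePrimes
  push_cast at h
  linarith

theorem exists_abs_recipSum_primesIoc_zero_exp_sub_le :
    ∃ C, 0 ≤ C ∧ ∀ s : ℝ, 1 ≤ s → ∀ k : ℕ,
      |recipSum (primesIoc 0 (Real.exp (s ^ k))) - k * Real.log s| ≤ C := by
  obtain ⟨C, hC0, hC⟩ := exists_abs_sum_primesIoc_zero_le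
  refine ⟨C, hC0, fun s hs k => ?_⟩
  have h := hC (Real.exp (s ^ k)) (by
    have := Real.exp_le_exp.2 (one_le_pow₀ hs : 1 ≤ s ^ k)
    linarith [Real.exp_one_gt_d9])
  rwa [Real.log_exp, Real.log_pow] at h

theorem eventually_recipSum_smallPrimes_le :
    ∀ᶠ s : ℝ in atTop, recipSum (smallPrimes s) ≤ s := by
  obtain ⟨C, hC0, hC⟩ := exists_abs_recipSum_primesIoc_zero_exp_sub_le
  filter_upwards [eventually_ge_atTop 1, eventually_log_le 32 C (by norm_num)] with s hs hlog
  have := (abs_le.1 (hC s hs 32)).2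
  push_cast at this
  unfold smallPrimes
  linarith

theorem exists_eventually_sieve_factor_le : ∃ C, 0 ≤ C ∧ ∀ᶠ s : ℝ in atTop,
    Real.exp (1 - recipSum (sievePrimes s))
      + 2 * (recipSum (sievePrimes s) ^ ⌈s⌉₊ / (⌈s⌉₊).factorial) ≤ C / s ^ 38 := by
  obtain ⟨C, hC0, hC⟩ := exists_abs_recipSum_primesIoc_zero_exp_sub_le
  refine ⟨Real.exp (1 + C) + 2, by positivity, ?_⟩
  filter_upwards [eventually_ge_atTop 1, eventually_log_le (8 * 38) (8 * C) (by norm_num),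
    eventually_pow_le_exp 38] with s hs hlog hexp
  have hs0 : 0 < s := by linarith
  have h := abs_le.1 (hC s hs 38)
  push_cast at h
  have h1 : Real.exp (1 - recipSum (sievePrimes s)) ≤ Real.exp (1 + C) / s ^ 38 := by
    rw [le_div_iff₀ (by positivity), ← Real.exp_log hs0, ← Real.exp_nat_mul, ← Real.exp_add,
      Real.exp_log hs0, Real.exp_le_exp]
    unfold sievePrimes
    push_cast
    linarith [h.1]
  have h2 : recipSum (sievePrimes s) ^ ⌈s⌉₊ / (⌈s⌉₊).factorial ≤ 1 / s ^ 38 := by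
    refine (pow_div_factorial_le_exp_neg (recipSum_nonneg _) ?_).trans ?_
    · refine le_trans ?_ (Nat.le_ceil s)
      unfold sievePrimes
      linarith [h.2]
    · rw [Real.exp_neg, ← one_div]
      exact one_div_le_one_div_of_le (by positivity)
        (hexp.trans (Real.exp_le_exp.2 (Nat.le_ceil s)))
  rw [add_div]
  have : 2 * (1 / s ^ 38) = 2 / s ^ 38 := by ring
  linarith

theorem isBigO_exp_of_le {f g : ℝ → ℝ} {c : ℝ}
    (h : ∀ᶠ s in atTop, 0 ≤ f s ∧ f s ≤ c * Real.exp (g s))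
    (hg : ∀ᶠ s in atTop, g s ≤ -(3 * s ^ 16)) :
    f =O[atTop] fun s => Real.exp (-(3 * s ^ 16)) := by
  refine IsBigO.of_bound |c| ?_
  filter_upwards [h, hg] with s h1 h2
  rw [Real.norm_of_nonneg h1.1, Real.norm_of_nonneg (Real.exp_pos _).le]
  refine h1.2.trans ?_
  gcongr
  exact le_abs_self c

theorem tendsto_of_isBigO_exp {f : ℝ → ℝ} (h : f =O[atTop] fun s => Real.exp (-(3 * s ^ 16)))
    {k : ℕ} (hk : k ≤ 2) : Tendsto (fun s => logScale s ^ k * f s) atTop (nhds 0) := by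
  have h1 : (fun s => logScale s ^ k * f s) =O[atTop] fun s => Real.exp (-s ^ 16) := by
    have : (fun s => logScale s ^ k) =O[atTop] fun s => Real.exp (2 * s ^ 16) := by
      refine IsBigO.of_bound 1 (Eventually.of_forall fun s => ?_)
      rw [one_mul, norm_pow, Real.norm_of_nonneg (logScale_pos s).le,
        Real.norm_of_nonneg (Real.exp_pos _).le, logScale, ← Real.exp_nat_mul, Real.exp_le_exp]
      have : (k : ℝ) ≤ 2 := by exact_mod_cast hk
      have : 0 ≤ s ^ 16 := by positivity
      gcongr
    refine (this.mul h).congr_right fun s => ?_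
    rw [← Real.exp_add]; ring_nf
  refine h1.trans_tendsto ?_
  exact Real.tendsto_exp_neg_atTop_nhds_zero.comp (tendsto_pow_atTop (by norm_num))

theorem tendsto_mul_sqrt_of_isBigO {f R : ℝ → ℝ}
    (h : f =O[atTop] fun s => Real.exp (-(3 * s ^ 16))) (hR0 : ∀ s, 0 ≤ R s)
    (hR : ∀ s, R s ≤ logScale s) : Tendsto (fun s => R s * √(f s)) atTop (nhds 0) := by
  have h1 := (tendsto_of_isBigO_exp h le_rfl).sqrt
  rw [Real.sqrt_zero] at h1
  refine squeeze_zero (fun s => mul_nonneg (hR0 s) (Real.sqrt_nonneg _)) (fun s => ?_) h1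
  rw [Real.sqrt_mul (sq_nonneg _), Real.sqrt_sq (logScale_pos s).le]
  exact mul_le_mul_of_nonneg_right (hR s) (Real.sqrt_nonneg _)

theorem card_midPrimes_le (s : ℝ) : ((midPrimes s).card : ℝ) ≤ Real.exp (logScale s / s ^ 40) :=
  card_primesIoc_le (Real.exp_pos _).le

theorem card_largePrimes_le (s : ℝ) : ((largePrimes s).card : ℝ) ≤ Real.exp (logScale s / s ^ 4) :=
  card_primesIoc_le (Real.exp_pos _).le

theorem isBigO_pow_div_factorial : (fun s => (4 * recipSum (midPrimes s)) ^ ⌈s ^ 32⌉₊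
    / (⌈s ^ 32⌉₊).factorial) =O[atTop] fun s : ℝ => Real.exp (-(3 * s ^ 16)) := by
  refine isBigO_exp_of_le (c := 1) (g := fun s => -s ^ 32) ?_ ?_
  · filter_upwards [eventually_abs_recipSum_midPrimes_sub_le, eventually_ge_atTop 2] with s h hs
    have h0 := recipSum_nonneg (midPrimes s)
    refine ⟨by positivity, ?_⟩
    have hs1 : 1 ≤ s := by linarith
    have h16 : s ≤ s ^ 16 := le_self_pow₀ hs1 (by norm_num)
    have h2 : (64 : ℝ) ≤ s ^ 16 := (by norm_num : (64 : ℝ) ≤ 2 ^ 16).trans (by gcongr)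
    refine (pow_div_factorial_le_exp_neg (by positivity) ?_).trans ?_
    · refine le_trans ?_ (Nat.le_ceil _)
      have : s ^ 32 = s ^ 16 * s ^ 16 := by ring
      rw [this]
      have := (abs_le.1 h).2
      nlinarith
    · rw [one_mul, Real.exp_le_exp, neg_le_neg_iff]
      exact Nat.le_ceil _
  · filter_upwards [eventually_ge_atTop 2] with s hs
    have h2 : (3 : ℝ) ≤ s ^ 16 := (by norm_num : (3 : ℝ) ≤ 2 ^ 16).trans (by gcongr)
    have : s ^ 32 = s ^ 16 * s ^ 16 := by ring
    nlinarith

theorem isBigO_log_div_exp : (fun s => (144 * Real.log (range₀ s) + 16 * recipSum (midPrimes s))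
    / Real.exp (s ^ 32)) =O[atTop] fun s : ℝ => Real.exp (-(3 * s ^ 16)) := by
  refine isBigO_exp_of_le (c := 176) (g := fun s => s ^ 16 - s ^ 32) ?_ ?_
  · filter_upwards [eventually_abs_recipSum_midPrimes_sub_le, eventually_ge_atTop 2,
      eventually_pow_le_logScale 16] with s h hs hD
    have h0 := recipSum_nonneg (midPrimes s)
    have hl := Real.log_natCast_nonneg (range₀ s)
    refine ⟨by positivity, ?_⟩
    have hs1 : 1 ≤ s := by linarith
    have h16 : s ≤ s ^ 16 := le_self_pow₀ hs1 (by norm_num)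
    have := (abs_le.1 h).2
    have := log_range₀_le s
    rw [Real.exp_sub, ← mul_div_assoc]
    rw [show Real.exp (s ^ 16) = logScale s from rfl]
    gcongr
    linarith
  · filter_upwards [eventually_ge_atTop 2] with s hs
    have h2 : (4 : ℝ) ≤ s ^ 16 := (by norm_num : (4 : ℝ) ≤ 2 ^ 16).trans (by gcongr)
    have : s ^ 32 = s ^ 16 * s ^ 16 := by ring
    nlinarith

theorem div_floor_exp_le {x a : ℝ} (hx : 0 ≤ x) (ha : 0 ≤ a) :
    x / ⌊Real.exp a⌋₊ ≤ 2 * (x * Real.exp (-a)) := by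
  have h := exp_le_two_mul_floor ha
  have hp := Real.exp_pos a
  rw [Real.exp_neg, ← div_eq_mul_inv, div_le_iff₀ (by linarith), mul_comm 2, mul_assoc,
    div_mul_eq_mul_div, le_div_iff₀ hp]
  gcongr

theorem one_add_mul_pow_le {C v u : ℝ} {n : ℕ} (hC0 : 0 ≤ C) (hC : C ≤ 6) (hv : 2 ≤ v) (hu : 1 ≤ u)
    {c : ℝ} (hc0 : 0 ≤ c) (hc : c ≤ Real.exp v) (hn : (n : ℝ) ≤ u + 1) :
    (1 + C * c) ^ n ≤ Real.exp (4 * v * u) := by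
  have h1 : 1 + C * c ≤ Real.exp (2 * v) := by
    have e2 : (7 : ℝ) ≤ Real.exp 2 := by
      have := Real.exp_one_gt_d9
      rw [show (2 : ℝ) = 1 + 1 by norm_num, Real.exp_add]
      nlinarith
    have e3 : Real.exp 2 ≤ Real.exp v := Real.exp_le_exp.2 hv
    rw [two_mul, Real.exp_add]
    have : 1 ≤ Real.exp v := by linarith
    have : C * c ≤ 6 * Real.exp v := by gcongr
    nlinarith
  calc (1 + C * c) ^ n ≤ Real.exp (2 * v) ^ n := by gcongr
    _ = Real.exp (n * (2 * v)) := (Real.exp_nat_mul _ _).symm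
    _ ≤ _ := Real.exp_le_exp.2 (by nlinarith)

theorem isBigO_one_add_card_pow_div : (fun s => (1 + 4 * (midPrimes s).card : ℝ) ^ ⌈s ^ 32⌉₊
    / ⌊Real.exp (logScale s / s)⌋₊) =O[atTop] fun s : ℝ => Real.exp (-(3 * s ^ 16)) := by
  refine isBigO_exp_of_le (c := 2) (g := fun s => 4 * (logScale s / s ^ 40) * s ^ 32
    + -(logScale s / s)) ?_ ?_
  · filter_upwards [eventually_logScale_eq, eventually_ge_atTop 2] with s ⟨v, hv, hD⟩ hs
    have hs1 : 1 ≤ s := by linarith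
    have hDs : 0 ≤ logScale s / s := div_nonneg (logScale_pos s).le (by linarith)
    refine ⟨by positivity, (div_floor_exp_le (by positivity) hDs).trans ?_⟩
    rw [Real.exp_add]
    gcongr
    refine one_add_mul_pow_le (by norm_num) (by norm_num) ?_ (one_le_pow₀ hs1)
      (Nat.cast_nonneg _) (card_midPrimes_le s) (Nat.ceil_lt_add_one (by positivity)).le
    rw [hD, mul_div_cancel_right₀ _ (by positivity)]
    exact (hs.trans (le_self_pow₀ hs1 (by norm_num))).trans hv
  · filter_upwards [eventually_logScale_eq, eventually_ge_atTop 2] with s ⟨v, hv, hD⟩ hs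
    have hs1 : 1 ≤ s := by linarith
    have e1 : logScale s / s = v * s ^ 39 := by rw [hD]; field_simp
    have e2 : logScale s / s ^ 40 = v := by rw [hD]; field_simp
    rw [e1, e2]
    have h7 : (7 : ℝ) ≤ s ^ 7 := (by norm_num : (7 : ℝ) ≤ 2 ^ 7).trans (by gcongr)
    have e3 : s ^ 39 = s ^ 32 * s ^ 7 := by ring
    have h32 : 1 ≤ s ^ 32 := one_le_pow₀ hs1
    have h40 : s ^ 16 ≤ v := (pow_le_pow_right₀ hs1 (by norm_num)).trans hv
    have h16 : 0 ≤ s ^ 16 := by positivity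
    have hv0 : 0 ≤ v * s ^ 32 := by nlinarith
    have : v ≤ v * s ^ 32 := by nlinarith
    rw [e3]
    nlinarith

theorem sqrt_div_range₀_le {s : ℝ} (hs : 4 ≤ s) :
    √((2 ^ ⌊logScale s / 4⌋₊ * ⌊Real.exp (logScale s / s)⌋₊ : ℕ) / range₀ s)
      * (3 + Real.log (range₀ s)) ≤ 8 * Real.exp (s ^ 16 - logScale s / 4) := by
  have hD := logScale_pos s
  have h1 : ((2 ^ ⌊logScale s / 4⌋₊ * ⌊Real.exp (logScale s / s)⌋₊ : ℕ) : ℝ)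
      ≤ Real.exp (logScale s / 2) := by
    refine (two_pow_floor_mul_floor_exp_le (by positivity)).trans (Real.exp_le_exp.2 ?_)
    have : logScale s / s ≤ logScale s / 4 := div_le_div_of_nonneg_left hD.le (by norm_num) hs
    linarith
  have h2 : ((2 ^ ⌊logScale s / 4⌋₊ * ⌊Real.exp (logScale s / s)⌋₊ : ℕ) : ℝ) / range₀ s
      ≤ (2 * Real.exp (-(logScale s / 4))) ^ 2 := by
    refine (div_floor_exp_le (Nat.cast_nonneg _) hD.le).trans ?_
    have e : (2 * Real.exp (-(logScale s / 4))) ^ 2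
        = 4 * (Real.exp (logScale s / 2) * Real.exp (-logScale s)) := by
      rw [mul_pow, ← Real.exp_nat_mul, ← Real.exp_add]
      congr 1
      · norm_num
      · congr 1; push_cast; ring
    rw [e]
    have := mul_le_mul_of_nonneg_right h1 (Real.exp_pos (-logScale s)).le
    have : 0 ≤ Real.exp (logScale s / 2) * Real.exp (-logScale s) := by positivity
    linarith
  have h3 := Real.sqrt_le_left (by positivity) |>.2 h2
  have h4 : 3 + Real.log (range₀ s) ≤ 4 * logScale s := by
    have := log_range₀_le s
    have : 1 ≤ logScale s := Real.one_le_exp (by positivity)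
    linarith
  have h5 : 0 ≤ 3 + Real.log (range₀ s) := by
    linarith [Real.log_natCast_nonneg (range₀ s)]
  refine (mul_le_mul h3 h4 h5 (by positivity)).trans_eq ?_
  rw [show s ^ 16 - logScale s / 4 = -(logScale s / 4) + s ^ 16 by ring, Real.exp_add]
  rw [show Real.exp (s ^ 16) = logScale s from rfl]
  ring

theorem isBigO_sqrt_mul_log : (fun s =>
    √((2 ^ ⌊logScale s / 4⌋₊ * ⌊Real.exp (logScale s / s)⌋₊ : ℕ) / range₀ s)
      * (3 + Real.log (range₀ s))) =O[atTop] fun s : ℝ => Real.exp (-(3 * s ^ 16)) := by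
  refine isBigO_exp_of_le (c := 8) (g := fun s => s ^ 16 - logScale s / 4) ?_ ?_
  · filter_upwards [eventually_ge_atTop 4] with s hs
    have := Real.log_natCast_nonneg (range₀ s)
    exact ⟨by positivity, sqrt_div_range₀_le hs⟩
  · filter_upwards [eventually_pow_le_logScale 17, eventually_ge_atTop 16] with s h hs
    have : s ^ 17 = s ^ 16 * s := by ring
    have : 0 ≤ s ^ 16 := by positivity
    nlinarith

theorem isBigO_card_sq_mul_sqrt_mul_log : (fun s => ((largePrimes s).card : ℝ) ^ 2 *
    (√((2 ^ ⌊logScale s / 4⌋₊ * ⌊Real.exp (logScale s / s)⌋₊ : ℕ) / range₀ s)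
      * (3 + Real.log (range₀ s)))) =O[atTop] fun s : ℝ => Real.exp (-(3 * s ^ 16)) := by
  refine isBigO_exp_of_le (c := 8)
    (g := fun s => 2 * (logScale s / s ^ 4) + (s ^ 16 - logScale s / 4)) ?_ ?_
  · filter_upwards [eventually_ge_atTop 4] with s hs
    have := Real.log_natCast_nonneg (range₀ s)
    refine ⟨by positivity, ?_⟩
    have h1 : ((largePrimes s).card : ℝ) ^ 2 ≤ Real.exp (2 * (logScale s / s ^ 4)) := by
      rw [two_mul, Real.exp_add, ← sq]
      gcongr
      exact card_largePrimes_le s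
    rw [Real.exp_add]
    refine (mul_le_mul h1 (sqrt_div_range₀_le hs) (by positivity) (by positivity)).trans_eq ?_
    ring
  · filter_upwards [eventually_pow_le_logScale 17, eventually_ge_atTop 32] with s h hs
    have e : s ^ 17 = s ^ 16 * s := by ring
    have h0 : 0 ≤ s ^ 16 := by positivity
    have h4 : (16 : ℝ) ≤ s ^ 4 := (by norm_num : (16 : ℝ) ≤ 32 ^ 4).trans (by gcongr)
    have : logScale s / s ^ 4 ≤ logScale s / 16 :=
      div_le_div_of_nonneg_left (logScale_pos s).le (by norm_num) h4
    nlinarith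

theorem isBigO_card_sq_div : (fun s => ((largePrimes s).card : ℝ) ^ 2
    / ⌊Real.exp (logScale s / s)⌋₊) =O[atTop] fun s : ℝ => Real.exp (-(3 * s ^ 16)) := by
  refine isBigO_exp_of_le (c := 2) (g := fun s => 2 * (logScale s / s ^ 4)
    + -(logScale s / s)) ?_ ?_
  · filter_upwards [eventually_ge_atTop 1] with s hs
    have hDs : 0 ≤ logScale s / s := div_nonneg (logScale_pos s).le (by linarith)
    refine ⟨by positivity, (div_floor_exp_le (by positivity) hDs).trans ?_⟩
    rw [Real.exp_add, two_mul (logScale s / s ^ 4), Real.exp_add (logScale s / s ^ 4), ← sq]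
    gcongr
    exact card_largePrimes_le s
  · filter_upwards [eventually_logScale_eq, eventually_ge_atTop 3] with s ⟨v, hv, hD⟩ hs
    have hs1 : 1 ≤ s := by linarith
    have e1 : logScale s / s = v * s ^ 36 * s ^ 3 := by rw [hD]; field_simp
    have e2 : logScale s / s ^ 4 = v * s ^ 36 := by rw [hD]; field_simp
    rw [e1, e2]
    have h3 : (5 : ℝ) ≤ s ^ 3 := (by norm_num : (5 : ℝ) ≤ 3 ^ 3).trans (by gcongr)
    have h36 : 1 ≤ s ^ 36 := one_le_pow₀ hs1
    have h40 : s ^ 16 ≤ v := (pow_le_pow_right₀ hs1 (by norm_num)).trans hv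
    have h16 : 0 ≤ s ^ 16 := by positivity
    have : v ≤ v * s ^ 36 := by nlinarith
    nlinarith

theorem isBigO_one_div_floor : (fun s => 1 / (⌊Real.exp (logScale s / s)⌋₊ : ℝ))
    =O[atTop] fun s : ℝ => Real.exp (-(3 * s ^ 16)) := by
  refine isBigO_exp_of_le (c := 2) (g := fun s => -(logScale s / s)) ?_ ?_
  · filter_upwards [eventually_ge_atTop 1] with s hs
    have hDs : 0 ≤ logScale s / s := div_nonneg (logScale_pos s).le (by linarith)
    exact ⟨by positivity, (div_floor_exp_le zero_le_one hDs).trans_eq (by rw [one_mul])⟩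
  · filter_upwards [eventually_pow_le_logScale 18, eventually_ge_atTop 3] with s h hs
    rw [neg_le_neg_iff, le_div_iff₀ (by linarith)]
    refine le_trans ?_ h
    have : s ^ 18 = s ^ 16 * s * s := by ring
    have h0 : 0 ≤ s ^ 16 * s := by positivity
    nlinarith

theorem isBigO_log_div_exp_large : (fun s => (1 + 2 * recipSum (largePrimes s))
    * (12 * Real.log (range₀ s) / Real.exp (logScale s / s ^ 40)))
    =O[atTop] fun s : ℝ => Real.exp (-(3 * s ^ 16)) := by
  refine isBigO_exp_of_le (c := 12) (g := fun s => 2 * s + s ^ 16 + -(logScale s / s ^ 40)) ?_ ?_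
  · filter_upwards [eventually_recipSum_largePrimes_le, eventually_ge_atTop 1] with s h hs
    have h0 := recipSum_nonneg (largePrimes s)
    have hl := Real.log_natCast_nonneg (range₀ s)
    refine ⟨by positivity, ?_⟩
    have h1 : 1 + 2 * recipSum (largePrimes s) ≤ Real.exp (2 * s) := by
      linarith [Real.add_one_le_exp (2 * s)]
    rw [Real.exp_add, Real.exp_add, Real.exp_neg, ← div_eq_mul_inv]
    have h2 := log_range₀_le s
    calc _ ≤ Real.exp (2 * s) * (12 * logScale s / Real.exp (logScale s / s ^ 40)) := by gcongr
      _ = _ := by rw [show Real.exp (s ^ 16) = logScale s from rfl]; ring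
  · filter_upwards [eventually_logScale_eq, eventually_ge_atTop 2] with s ⟨v, hv, hD⟩ hs
    have hs1 : 1 ≤ s := by linarith
    rw [hD, mul_div_cancel_right₀ _ (by positivity)]
    have h24 : (6 : ℝ) ≤ s ^ 24 := (by norm_num : (6 : ℝ) ≤ 2 ^ 24).trans (by gcongr)
    have : s ^ 40 = s ^ 16 * s ^ 24 := by ring
    have h16 : s ≤ s ^ 16 := le_self_pow₀ hs1 (by norm_num)
    nlinarith

theorem isBigO_sieve_error : (fun s => ((smallPrimes s).card : ℝ)
    * (1 + (sievePrimes s).card) ^ ⌈s⌉₊ / ⌊Real.exp (s ^ 40)⌋₊)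
    =O[atTop] fun s : ℝ => Real.exp (-(3 * s ^ 16)) := by
  refine isBigO_exp_of_le (c := 2) (g := fun s => s ^ 32 + 4 * s ^ 38 * s + -s ^ 40) ?_ ?_
  · filter_upwards [eventually_ge_atTop 2] with s hs
    have hs1 : 1 ≤ s := by linarith
    have hpos : 0 ≤ s ^ 40 := by positivity
    refine ⟨by positivity, (div_floor_exp_le (by positivity) hpos).trans ?_⟩
    rw [Real.exp_add, Real.exp_add]
    gcongr
    · exact card_primesIoc_le (Real.exp_pos _).le
    · have := one_add_mul_pow_le (C := 1) (n := ⌈s⌉₊) (by norm_num) (by norm_num)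
        (hs.trans (le_self_pow₀ hs1 (by norm_num : 38 ≠ 0))) hs1
        (Nat.cast_nonneg (sievePrimes s).card) (card_primesIoc_le (Real.exp_pos _).le)
        (Nat.ceil_lt_add_one (by positivity)).le
      rwa [one_mul] at this
  · filter_upwards [eventually_ge_atTop 16] with s hs
    have hs1 : 1 ≤ s := by linarith
    have h1 : s ^ 16 ≤ s ^ 38 := pow_le_pow_right₀ hs1 (by norm_num)
    have h2 : s ^ 32 ≤ s ^ 38 := pow_le_pow_right₀ hs1 (by norm_num)
    have e : s ^ 40 = s ^ 38 * s * s := by ring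
    have h0 : 0 ≤ s ^ 38 := by positivity
    have h3 : s ^ 38 * 16 ≤ s ^ 38 * s := by gcongr
    have h4 : s ^ 38 * s * 16 ≤ s ^ 38 * s * s := by gcongr
    rw [e]
    nlinarith

/-- The auxiliary primes used for averaging over the main and the large primes. -/
noncomputable def longPrimes (s : ℝ) : Finset ℕ := dyadicPrimes (logScale s / s) (logScale s / 4)

/-- The auxiliary primes used for averaging over the small primes. -/
noncomputable def shortPrimes (s : ℝ) : Finset ℕ := dyadicPrimes (s ^ 40) (s ^ 41)

theorem prime_of_mem_dyadicPrimes {a b : ℝ} {p : ℕ} (hp : p ∈ dyadicPrimes a b) : p.Prime :=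
  prime_of_mem_primesIoc hp

theorem le_range₀_of_mem_dyadicPrimes {a b s : ℝ} (hb : 0 ≤ b) (hab : a + b ≤ logScale s) {p : ℕ}
    (hp : p ∈ dyadicPrimes a b) : p ≤ range₀ s := by
  refine (mem_Ioc.1 (dyadicPrimes_subset a b hp)).2.trans (Nat.le_floor ?_)
  exact (two_pow_floor_mul_floor_exp_le hb).trans (Real.exp_le_exp.2 hab)

theorem le_floor_exp_of_mem_primesIoc {a b c : ℝ} (hbc : b ≤ c) {q : ℕ}
    (hq : q ∈ primesIoc a (Real.exp b)) : q ≤ ⌊Real.exp c⌋₊ :=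
  (mem_Ioc.1 (mem_filter.1 hq).1).2.trans (Nat.floor_mono (Real.exp_le_exp.2 hbc))

theorem notMem_of_mem_dyadicPrimes {a b c d : ℝ} (hbc : b ≤ c) {p : ℕ}
    (hp : p ∈ dyadicPrimes c d) : p ∉ primesIoc a (Real.exp b) := fun h =>
  absurd (mem_Ioc.1 (dyadicPrimes_subset c d hp)).1 (le_floor_exp_of_mem_primesIoc hbc h).not_gt

theorem tendsto_recipSum_longPrimes : Tendsto (fun s => recipSum (longPrimes s)) atTop atTop := by
  refine tendsto_recipSum_dyadicPrimes ?_ ?_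
  · filter_upwards [eventually_pow_le_logScale 1, eventually_gt_atTop 0] with s h hs
    rw [pow_one] at h
    rwa [le_div_iff₀ hs, one_mul]
  · refine (tendsto_id.atTop_div_const (show (0 : ℝ) < 4 by norm_num)).congr' ?_
    filter_upwards [eventually_gt_atTop 0] with s hs
    have := (logScale_pos s).ne'
    simp only [id]
    field_simp

theorem tendsto_recipSum_shortPrimes : Tendsto (fun s => recipSum (shortPrimes s)) atTop atTop := by
  refine tendsto_recipSum_dyadicPrimes ?_ ?_
  · filter_upwards [eventually_ge_atTop 1] with s hs using one_le_pow₀ hs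
  · refine tendsto_id.congr' ?_
    filter_upwards [eventually_gt_atTop 0] with s hs
    simp only [id]
    field_simp

theorem eventually_longPrimes_le : ∀ᶠ s in atTop, ∀ p ∈ longPrimes s, p ≤ range₀ s := by
  filter_upwards [eventually_ge_atTop 4] with s hs p hp
  have hD := logScale_pos s
  refine le_range₀_of_mem_dyadicPrimes (by positivity) ?_ hp
  have : logScale s / s ≤ logScale s / 4 := by gcongr
  linarith

theorem eventually_shortPrimes_le : ∀ᶠ s in atTop, ∀ p ∈ shortPrimes s, p ≤ range₀ s := by
  filter_upwards [eventually_ge_atTop 2, eventually_pow_le_logScale 42] with s hs h p hp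
  refine le_range₀_of_mem_dyadicPrimes (by positivity) (le_trans ?_ h) hp
  have h40 : 0 < s ^ 40 := by positivity
  rw [show s ^ 41 = s ^ 40 * s by ring, show s ^ 42 = s ^ 40 * s ^ 2 by ring]
  nlinarith [mul_nonneg h40.le (show 0 ≤ s ^ 2 - s - 1 by nlinarith)]

theorem one_le_range₀ (s : ℝ) : 1 ≤ range₀ s := Nat.le_floor (by simpa using (logScale_pos s).le)

theorem one_le_floor_exp {a : ℝ} (ha : 0 ≤ a) : 1 ≤ ⌊Real.exp a⌋₊ :=
  Nat.le_floor (by simpa using ha)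

theorem tendsto_inv_floor_exp :
    Tendsto (fun s => 1 / (⌊Real.exp (logScale s / s)⌋₊ : ℝ)) atTop (nhds 0) := by
  simpa using tendsto_of_isBigO_exp isBigO_one_div_floor (k := 0) (by norm_num)

theorem floor_logScale_div_le (s : ℝ) : (⌊logScale s / 4⌋₊ : ℝ) ≤ logScale s :=
  (Nat.floor_le (by have := logScale_pos s; positivity)).trans (by linarith [logScale_pos s])

/-- The characteristic function of the main part is that of a Poisson law. -/
theorem tendsto_exp_cototientCount_midPrimes (τ : ℝ → ℝ) :
    Tendsto (fun s => ‖(∑ n ∈ Icc 1 (range₀ s),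
        Complex.exp (τ s * Complex.I * cototientCount (midPrimes s) n)) / range₀ s
      - Complex.exp (recipSum (midPrimes s) * (Complex.exp (τ s * Complex.I) - 1))‖)
      atTop (nhds 0) := by
  have hE := tendsto_recipSum_longPrimes
  have h1 : Tendsto (fun s => 2 * √(3 / recipSum (longPrimes s))) atTop (nhds 0) := by
    simpa using (hE.const_div_atTop 3).sqrt.const_mul 2
  have h2 := tendsto_mul_sqrt_of_isBigO (R := fun s => ⌊logScale s / 4⌋₊)
    ((((isBigO_pow_div_factorial.const_mul_left 2).add isBigO_log_div_exp).add
      (isBigO_one_add_card_pow_div.const_mul_left 2)).const_mul_left 3 |>.add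
      (isBigO_sqrt_mul_log.const_mul_left 4)) (fun s => Nat.cast_nonneg _) floor_logScale_div_le
  have h3 := ((tendsto_inv_floor_exp.const_mul 4).add h2).mul hE.inv_tendsto_atTop
  have h4 := h1.add h3
  simp only [mul_zero, add_zero] at h4
  refine squeeze_zero' (Eventually.of_forall fun s => norm_nonneg _) ?_ h4
  filter_upwards [hE.eventually_gt_atTop 0, eventually_longPrimes_le, eventually_ge_atTop 2]
    with s hE hX hs
  have hD := logScale_pos s
  have hs1 : 1 ≤ s := by linarith
  have hX0 : (0 : ℝ) < range₀ s := by exact_mod_cast one_le_range₀ s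
  have key := norm_sum_exp_cototientCount_sub_le (Q := midPrimes s)
    (fun q hq => prime_of_mem_primesIoc hq) (y := Real.exp (s ^ 32))
    (by
      have h32 : (2 : ℝ) ^ 32 ≤ s ^ 32 := by gcongr
      linarith [Real.add_one_le_exp (s ^ 32)])
    (fun q hq => ((mem_primesIoc (Real.exp_pos _).le (Real.exp_pos _).le).1 hq).1.1)
    (one_le_floor_exp (show 0 ≤ logScale s / s by positivity)) (dyadicPrimes_subset _ _)
    (fun p hp => prime_of_mem_primesIoc hp)
    (fun p hp => notMem_of_mem_dyadicPrimes (div_le_div_of_nonneg_left hD.le (by positivity)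
      (le_self_pow₀ hs1 (by norm_num))) hp) hX hE (τ s) ⌈s ^ 32⌉₊
  have hrw : (∑ n ∈ Icc 1 (range₀ s),
        Complex.exp (τ s * Complex.I * cototientCount (midPrimes s) n)) / range₀ s
      - Complex.exp (recipSum (midPrimes s) * (Complex.exp (τ s * Complex.I) - 1))
      = (∑ n ∈ Icc 1 (range₀ s),
        Complex.exp (τ s * Complex.I * cototientCount (midPrimes s) n)
      - range₀ s * Complex.exp (recipSum (midPrimes s) * (Complex.exp (τ s * Complex.I) - 1)))
        / range₀ s := by
    have : (range₀ s : ℂ) ≠ 0 := by exact_mod_cast hX0.ne'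
    field_simp
  rw [hrw, norm_div, Complex.norm_natCast, div_le_iff₀ hX0]
  refine key.trans_eq ?_
  change _ = (_ + _ * (recipSum (longPrimes s))⁻¹) * _
  simp only [longPrimes]
  ring_nf

theorem tendsto_sum_weight_mul_largePrimes :
    Tendsto (fun s => (∑ n ∈ Icc 1 (range₀ s), (weight (longPrimes s) n : ℝ)
      * cototientCount (largePrimes s) n) / (range₀ s * recipSum (longPrimes s) * s ^ 7))
      atTop (nhds 0) := by
  have hE := tendsto_recipSum_longPrimes
  have h2 := tendsto_mul_sqrt_of_isBigO (R := fun s => ⌊logScale s / 4⌋₊)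
    ((isBigO_log_div_exp_large.add (isBigO_card_sq_div.const_mul_left 8)).add
      isBigO_card_sq_mul_sqrt_mul_log) (fun s => Nat.cast_nonneg _) floor_logScale_div_le
  have h3 : Tendsto (fun s => ((largePrimes s).card : ℝ) ^ 2 / ⌊Real.exp (logScale s / s)⌋₊)
      atTop (nhds 0) := by
    simpa using tendsto_of_isBigO_exp isBigO_card_sq_div (k := 0) (by norm_num)
  have h6 : Tendsto (fun s : ℝ => (s ^ 6)⁻¹) atTop (nhds 0) :=
    tendsto_inv_atTop_zero.comp (tendsto_pow_atTop (by norm_num))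
  have h4 := h6.add ((h3.const_mul 2).add h2)
  simp only [mul_zero, add_zero] at h4
  refine squeeze_zero' ?_ ?_ h4
  · filter_upwards [eventually_ge_atTop 0] with s hs
    have := recipSum_nonneg (longPrimes s)
    positivity
  filter_upwards [hE.eventually_ge_atTop 1, eventually_ge_atTop 1,
    eventually_recipSum_largePrimes_le] with s hE hs hμ
  have hD := logScale_pos s
  have hX0 : (0 : ℝ) < range₀ s := by exact_mod_cast one_le_range₀ s
  have key := sum_weight_mul_cototientCount_le (Q := largePrimes s)
    (fun q hq => prime_of_mem_primesIoc hq) (y := Real.exp (logScale s / s ^ 40))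
    (Real.one_le_exp (by positivity))
    (fun q hq => ((mem_primesIoc (Real.exp_pos _).le (Real.exp_pos _).le).1 hq).1.1)
    (X := range₀ s)
    (one_le_floor_exp (show 0 ≤ logScale s / s by positivity))
    (dyadicPrimes_subset (logScale s / s) (logScale s / 4))
    (fun p hp => prime_of_mem_primesIoc hp)
    (fun p hp => notMem_of_mem_dyadicPrimes (div_le_div_of_nonneg_left hD.le (by positivity)
      (le_self_pow₀ hs (by norm_num))) hp)
  have hs7 : 1 ≤ s ^ 7 := one_le_pow₀ hs
  rw [div_le_iff₀ (by positivity)]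
  refine key.trans ?_
  change _ * recipSum (longPrimes s) * _ + _ ≤ _
  rw [add_mul (s ^ 6)⁻¹]
  refine add_le_add ?_ ?_
  · have : (s ^ 6)⁻¹ * (range₀ s * recipSum (longPrimes s) * s ^ 7)
        = range₀ s * recipSum (longPrimes s) * s := by field_simp
    rw [this]
    gcongr
  · set r := √((1 + 2 * recipSum (largePrimes s)) *
      (12 * Real.log (range₀ s) / Real.exp (logScale s / s ^ 40))
      + 8 * ((largePrimes s).card : ℝ) ^ 2 / ⌊Real.exp (logScale s / s)⌋₊ +
      ((largePrimes s).card : ℝ) ^ 2 * (√((2 ^ ⌊logScale s / 4⌋₊ * ⌊Real.exp (logScale s / s)⌋₊ : ℕ)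
        / range₀ s) * (3 + Real.log (range₀ s)))) with hr
    simp only [← mul_div_assoc] at hr ⊢
    rw [← hr]
    have hc : ((largePrimes s).card : ℝ) ≤ ((largePrimes s).card : ℝ) ^ 2 := by
      exact_mod_cast Nat.le_self_pow (by norm_num) _
    have hB : (1 : ℝ) ≤ recipSum (longPrimes s) * s ^ 7 := by nlinarith
    have hr0 : 0 ≤ r := Real.sqrt_nonneg _
    calc _ ≤ range₀ s * (2 * ((largePrimes s).card : ℝ) ^ 2 / ⌊Real.exp (logScale s / s)⌋₊
          + ⌊logScale s / 4⌋₊ * r) * 1 := by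
          rw [mul_one, mul_add, ← mul_div_assoc]
          refine add_le_add ?_ (le_of_eq (by ring))
          gcongr ?_ / _
          nlinarith
      _ ≤ range₀ s * (2 * ((largePrimes s).card : ℝ) ^ 2 / ⌊Real.exp (logScale s / s)⌋₊
          + ⌊logScale s / 4⌋₊ * r) * (recipSum (longPrimes s) * s ^ 7) := by gcongr
      _ = _ := by ring

theorem tendsto_sum_weight_mul_smallPrimes :
    Tendsto (fun s => (∑ n ∈ Icc 1 (range₀ s), (weight (shortPrimes s) n : ℝ)
      * cototientCount (smallPrimes s) n) / (range₀ s * recipSum (shortPrimes s) * s ^ 7))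
      atTop (nhds 0) := by
  have hE := tendsto_recipSum_shortPrimes
  obtain ⟨C, hC0, hC⟩ := exists_eventually_sieve_factor_le
  have h2 := tendsto_of_isBigO_exp isBigO_sieve_error (k := 1) (by norm_num)
  simp only [pow_one] at h2
  have h6 : Tendsto (fun s : ℝ => 3 * C / s ^ 3) atTop (nhds 0) :=
    (tendsto_pow_atTop (by norm_num)).const_div_atTop _
  have h4 := h6.add (h2.const_mul 4)
  simp only [mul_zero, add_zero] at h4
  refine squeeze_zero' ?_ ?_ h4
  · filter_upwards [eventually_ge_atTop 0] with s hs
    have := recipSum_nonneg (shortPrimes s)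
    positivity
  filter_upwards [hE.eventually_ge_atTop 1, eventually_ge_atTop 1, hC,
    eventually_recipSum_smallPrimes_le, eventually_pow_le_logScale 41] with s hE hs hη hμ hD41
  have hX0 : (0 : ℝ) < range₀ s := by exact_mod_cast one_le_range₀ s
  have key := sum_weight_mul_cototientCount_le_of_sieve (Q := smallPrimes s) (W := sievePrimes s)
    (fun q hq => prime_of_mem_primesIoc hq) (fun q hq => prime_of_mem_primesIoc hq)
    (X := range₀ s)
    (one_le_floor_exp (show 0 ≤ s ^ 40 by positivity))
    (fun q hq => le_floor_exp_of_mem_primesIoc (pow_le_pow_right₀ hs (by norm_num)) hq)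
    (fun q hq => le_floor_exp_of_mem_primesIoc (pow_le_pow_right₀ hs (by norm_num)) hq)
    (dyadicPrimes_subset (s ^ 40) (s ^ 41))
    (fun p hp => prime_of_mem_primesIoc hp) ⌈s⌉₊
  have hs7 : 1 ≤ s ^ 7 := one_le_pow₀ hs
  have hR : (⌊s ^ 41⌋₊ : ℝ) ≤ s ^ 41 := Nat.floor_le (by positivity)
  have hB : s ^ 7 ≤ recipSum (shortPrimes s) * s ^ 7 := by nlinarith
  have hD1 : 1 ≤ logScale s := (one_le_pow₀ hs).trans hD41
  have hμ0 := recipSum_nonneg (smallPrimes s)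
  set N := ((⌊Real.exp (s ^ 40)⌋₊ : ℕ) : ℝ) with hN
  set c := ((smallPrimes s).card : ℝ) with hc
  set w : ℝ := (1 + (sievePrimes s).card) ^ ⌈s⌉₊ with hw
  have hw1 : 1 ≤ w :=
    one_le_pow₀ (by linarith [(Nat.cast_nonneg (sievePrimes s).card : (0 : ℝ) ≤ _)])
  have hc0 : 0 ≤ c := Nat.cast_nonneg _
  have hN0 : 0 < N := Nat.cast_pos.2 (one_le_floor_exp (show 0 ≤ s ^ 40 by positivity))
  set η := Real.exp (1 - recipSum (sievePrimes s))
      + 2 * (recipSum (sievePrimes s) ^ ⌈s⌉₊ / (⌈s⌉₊).factorial) with hηd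
  have hη0 : 0 ≤ η := by
    have := recipSum_nonneg (sievePrimes s)
    positivity
  rw [div_le_iff₀ (by positivity)]
  refine key.trans ?_
  calc 2 * c * (range₀ s / N) + ⌊s ^ 41⌋₊ * (range₀ s * (3 * η * recipSum (smallPrimes s)
        + 2 * c * w / N))
      ≤ 2 * c * (range₀ s / N) + s ^ 41 * (range₀ s * (3 * (C / s ^ 38) * s + 2 * c * w / N)) := by
        gcongr
    _ = range₀ s * (3 * C / s ^ 3 * s ^ 7 + (2 * (c * 1 * 1 / N) + 2 * s ^ 41 * (c * w / N))) := by
        field_simp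
        ring
    _ ≤ range₀ s * (3 * C / s ^ 3 * s ^ 7 + (2 * (c * w * logScale s / N)
          + 2 * logScale s * (c * w / N))) := by gcongr
    _ = range₀ s * (3 * C / s ^ 3 * s ^ 7 + 4 * (logScale s * (c * w / N)) * 1) := by ring
    _ ≤ range₀ s * (3 * C / s ^ 3 * s ^ 7 + 4 * (logScale s * (c * w / N)) * s ^ 7) := by
        have := logScale_pos s
        gcongr
    _ = range₀ s * ((3 * C / s ^ 3 + 4 * (logScale s * (c * w / N))) * s ^ 7) := by ring
    _ ≤ range₀ s * ((3 * C / s ^ 3 + 4 * (logScale s * (c * w / N)))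
          * (recipSum (shortPrimes s) * s ^ 7)) := by
        have := logScale_pos s
        gcongr
    _ = _ := by ring

end

section

open Finset

/-- The number of primes `q > y` dividing both `n` and its totient. -/
noncomputable def sharedCount (y : ℝ) (n : ℕ) : ℕ :=
  (n.primeFactors.filter fun q : ℕ => y < q ∧ q ∣ n.totient).card

theorem sq_dvd_or_exists_mul_dvd {q n : ℕ} (hq : q.Prime) (hn : n ≠ 0) (hqn : q ∣ n)
    (hφ : q ∣ n.totient) : q ^ 2 ∣ n ∨ ∃ k, 1 ≤ k ∧ q * (k * q + 1) ∣ n := by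
  rw [Nat.totient_eq_prod_factorization hn, Finsupp.prod] at hφ
  obtain ⟨p, hp, hqp⟩ := (hq.prime.dvd_finsetProd_iff _).1 hφ
  rw [Nat.support_factorization, Nat.mem_primeFactors] at hp
  by_cases h : q ∣ p - 1
  · obtain ⟨k, hk⟩ := h
    have hp2 := hp.1.two_le
    have hk1 : 1 ≤ k := Nat.pos_of_ne_zero fun h0 => by simp [h0] at hk; omega
    have hpk : p = k * q + 1 := by rw [mul_comm]; omega
    have hne : q ≠ p := fun h => by
      have := Nat.le_mul_of_pos_right q hk1
      omega
    exact Or.inr ⟨k, hk1,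
      hpk ▸ ((Nat.coprime_primes hq hp.1).2 hne).mul_dvd_of_dvd_of_dvd hqn hp.2.1⟩
  · left
    have h1 := (hq.dvd_mul.1 hqp).resolve_right h
    have hqp' := (Nat.prime_dvd_prime_iff_eq hq hp.1).1 (hq.dvd_of_dvd_pow h1)
    subst hqp'
    rw [hq.pow_dvd_iff_le_factorization hn]
    by_contra! h2
    rw [show n.factorization q - 1 = 0 by omega, pow_zero] at h1
    exact hq.one_lt.ne' (Nat.dvd_one.1 h1)

theorem sharedCount_le {X n : ℕ} (y : ℝ) (hn : n ∈ Icc 1 X) :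
    sharedCount y n ≤ ∑ q ∈ (Icc 1 X).filter (fun q : ℕ => q.Prime ∧ y < q),
      ((if q ^ 2 ∣ n then 1 else 0) + ∑ k ∈ Icc 1 X, if q * (k * q + 1) ∣ n then 1 else 0) := by
  rw [mem_Icc] at hn
  have hn0 : n ≠ 0 := by omega
  rw [sharedCount, card_eq_sum_ones]
  refine (sum_le_sum (g := fun q => (if q ^ 2 ∣ n then 1 else 0)
    + ∑ k ∈ Icc 1 X, if q * (k * q + 1) ∣ n then 1 else 0) fun q hq => ?_).trans
    (sum_le_sum_of_subset fun q hq => ?_)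
  · rw [mem_filter, Nat.mem_primeFactors] at hq
    rcases sq_dvd_or_exists_mul_dvd hq.1.1 hn0 hq.1.2.1 hq.2.2 with h | ⟨k, hk, h⟩
    · simp [h]
    · refine le_add_left ?_
      have hkX : k ∈ Icc 1 X := by
        refine mem_Icc.2 ⟨hk, ?_⟩
        have := Nat.le_of_dvd (by omega) h
        have h1 := hq.1.1.one_lt
        calc k ≤ k * q + 1 := by nlinarith
          _ ≤ q * (k * q + 1) := Nat.le_mul_of_pos_left _ hq.1.1.pos
          _ ≤ X := this.trans hn.2
      refine le_trans ?_ (single_le_sum (fun _ _ => Nat.zero_le _) hkX)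
      rw [if_pos h]
  · rw [mem_filter, Nat.mem_primeFactors] at hq
    rw [mem_filter, mem_Icc]
    exact ⟨⟨hq.1.1.one_lt.le, (Nat.le_of_dvd (by omega) hq.1.2.1).trans hn.2⟩, hq.1.1, hq.2.1⟩

theorem sum_Icc_inv_le (X : ℕ) : ∑ k ∈ Icc 1 X, 1 / (k : ℝ) ≤ 1 + Real.log X := by
  have := harmonic_le_one_add_log X
  rw [harmonic_eq_sum_Icc] at this
  push_cast at this
  simpa using this

theorem card_filter_dvd_le_div (X d : ℕ) : (((Icc 1 X).filter (d ∣ ·)).card : ℝ) ≤ X / d := by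
  rw [card_Icc_filter_dvd]
  exact Nat.cast_div_le

theorem sum_sharedCount_le (X : ℕ) {y : ℝ} (hy : 0 < y) :
    ∑ n ∈ Icc 1 X, (sharedCount y n : ℝ) ≤ X * (2 + Real.log X) ^ 2 / y := by
  have hl := Real.log_natCast_nonneg X
  set Q := (Icc 1 X).filter (fun q : ℕ => q.Prime ∧ y < q) with hQ
  have hQy : ∀ q ∈ Q, y < q := fun q hq => (mem_filter.1 hq).2.2
  have h1 : ∑ n ∈ Icc 1 X, (sharedCount y n : ℝ) ≤ ∑ q ∈ Q,
      ((((Icc 1 X).filter (q ^ 2 ∣ ·)).card : ℝ)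
        + ∑ k ∈ Icc 1 X, (((Icc 1 X).filter (q * (k * q + 1) ∣ ·)).card : ℝ)) := by
    have := sum_le_sum fun n (hn : n ∈ Icc 1 X) => sharedCount_le y hn
    rw [sum_comm] at this
    simp only [sum_add_distrib] at this
    have h2 : ∀ q : ℕ, ∑ n ∈ Icc 1 X, ∑ k ∈ Icc 1 X, (if q * (k * q + 1) ∣ n then 1 else 0)
        = ∑ k ∈ Icc 1 X, ((Icc 1 X).filter (q * (k * q + 1) ∣ ·)).card := fun q => by
      rw [sum_comm]
      exact sum_congr rfl fun k _ => (card_filter _ _).symm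
    simp only [h2] at this
    simp only [← card_filter] at this
    rw [sum_add_distrib]
    exact_mod_cast this
  have h3 : ∀ q ∈ Q, ((((Icc 1 X).filter (q ^ 2 ∣ ·)).card : ℝ)
        + ∑ k ∈ Icc 1 X, (((Icc 1 X).filter (q * (k * q + 1) ∣ ·)).card : ℝ))
      ≤ X * (2 + Real.log X) * (1 / (q : ℝ) ^ 2) := fun q hq => by
    have hq0 := hy.trans (hQy q hq)
    have h4 : ∀ k ∈ Icc 1 X, (((Icc 1 X).filter (q * (k * q + 1) ∣ ·)).card : ℝ)
        ≤ X / (q : ℝ) ^ 2 * (1 / k) := fun k hk => by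
      have hk0 : (0 : ℝ) < k := by exact_mod_cast (mem_Icc.1 hk).1
      refine (card_filter_dvd_le_div _ _).trans ?_
      rw [div_mul_div_comm, mul_one]
      push_cast
      exact div_le_div_of_nonneg_left (by positivity) (by positivity) (by nlinarith)
    have h5 := card_filter_dvd_le_div X (q ^ 2)
    have h6 := sum_le_sum h4
    rw [← mul_sum] at h6
    have h7 := mul_le_mul_of_nonneg_left (sum_Icc_inv_le X) (show 0 ≤ X / (q : ℝ) ^ 2 by positivity)
    push_cast at h5
    calc _ ≤ X / (q : ℝ) ^ 2 + X / (q : ℝ) ^ 2 * (1 + Real.log X) := by linarith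
      _ = _ := by ring
  refine h1.trans ((sum_le_sum h3).trans ?_)
  rw [← mul_sum]
  have h8 : recipSum Q ≤ 2 + Real.log X := by
    refine le_trans (sum_le_sum_of_subset_of_nonneg (filter_subset _ _)
      fun _ _ _ => by positivity) ((sum_Icc_inv_le X).trans (by linarith))
  calc _ ≤ X * (2 + Real.log X) * ((2 + Real.log X) / y) := by
        gcongr
        exact (sum_inv_sq_le hy hQy).trans (by gcongr)
    _ = _ := by ring

theorem cototientCount_le_card_primeFactors {Q : Finset ℕ} (hQ : ∀ q ∈ Q, q.Prime) {n : ℕ}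
    (hn : 2 ≤ n) : cototientCount Q n ≤ (n - n.totient).primeFactors.card := by
  refine card_le_card fun q hq => ?_
  rw [mem_filter] at hq
  have := Nat.totient_lt n hn
  exact Nat.mem_primeFactors.2 ⟨hQ q hq.1, hq.2.2, by omega⟩

theorem card_filter_lt_primeFactors_le {X m : ℕ} (hm0 : m ≠ 0) (hm : m ≤ X) {c : ℝ} (hc : 0 < c) :
    ((m.primeFactors.filter fun q : ℕ => Real.exp c < q).card : ℝ) ≤ Real.log X / c := by
  rw [le_div_iff₀ hc]
  have h1 : ∑ q ∈ m.primeFactors.filter (fun q : ℕ => Real.exp c < q), c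
      ≤ ∑ q ∈ m.primeFactors.filter (fun q : ℕ => Real.exp c < q), Real.log q :=
    sum_le_sum fun q hq => by
      have := (mem_filter.1 hq).2
      exact (Real.le_log_iff_exp_le ((Real.exp_pos c).trans this)).2 this.le
  rw [sum_const, nsmul_eq_mul] at h1
  refine h1.trans ?_
  refine (sum_le_sum_of_subset_of_nonneg (filter_subset _ _)
    fun _ _ _ => Real.log_natCast_nonneg _).trans ?_
  rw [← Real.log_prod fun q hq =>
    Nat.cast_ne_zero.2 (Nat.prime_of_mem_primeFactors hq).ne_zero, ← Nat.cast_prod]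
  have hpos : 0 < ∏ q ∈ m.primeFactors, q := Nat.pos_of_ne_zero (prod_ne_zero_iff.2 fun q hq =>
    (Nat.prime_of_mem_primeFactors hq).ne_zero)
  refine Real.log_le_log (by exact_mod_cast hpos) ?_
  exact_mod_cast (Nat.le_of_dvd (Nat.pos_of_ne_zero hm0) (Nat.prod_primeFactors_dvd m)).trans hm

theorem card_primeFactors_cototient_le {X n : ℕ} (hn : 2 ≤ n) (hnX : n ≤ X) {a b c : ℝ}
    (hc : 0 < c) :
    ((n - n.totient).primeFactors.card : ℝ) ≤ cototientCount (primesIoc (Real.exp a) (Real.exp b)) n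
      + (weight (primesIoc 0 (Real.exp a)) n + sharedCount (Real.exp a) n + Real.log X / c
      + cototientCount (primesIoc 0 (Real.exp a)) n
      + cototientCount (primesIoc (Real.exp b) (Real.exp c)) n) := by
  set m := n - n.totient with hm
  have hφ := Nat.totient_lt n hn
  have hm0 : m ≠ 0 := by omega
  have h1 := card_filter_lt_primeFactors_le hm0 (show m ≤ X by omega) hc
  have hsub : m.primeFactors ⊆ ((primesIoc (Real.exp a) (Real.exp b)).filter
        fun q => ¬q ∣ n ∧ q ∣ n - n.totient)
      ∪ (((primesIoc 0 (Real.exp a)).filter (· ∣ n))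
      ∪ (n.primeFactors.filter fun q : ℕ => Real.exp a < q ∧ q ∣ n.totient)
      ∪ (m.primeFactors.filter fun q : ℕ => Real.exp c < q)
      ∪ ((primesIoc 0 (Real.exp a)).filter fun q => ¬q ∣ n ∧ q ∣ n - n.totient)
      ∪ ((primesIoc (Real.exp b) (Real.exp c)).filter fun q => ¬q ∣ n ∧ q ∣ n - n.totient)) := by
    intro q hq
    have hq' := Nat.mem_primeFactors.1 hq
    have hq0 : (0 : ℝ) < q := by exact_mod_cast hq'.1.pos
    have hφ' : q ∣ n → q ∣ n.totient := fun h => by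
      have := Nat.dvd_sub h hq'.2.1
      rwa [hm, Nat.sub_sub_self hφ.le] at this
    simp only [mem_union, mem_filter, mem_primesIoc (Real.exp_pos _).le (Real.exp_pos _).le,
      mem_primesIoc le_rfl (Real.exp_pos _).le, Nat.mem_primeFactors, hq'.1, hq'.2.1, ← hm]
    have hn0 : n ≠ 0 := by omega
    rcases le_or_gt (q : ℝ) (Real.exp a) with ha | ha <;>
    rcases le_or_gt (q : ℝ) (Real.exp b) with hb | hb <;>
    rcases le_or_gt (q : ℝ) (Real.exp c) with hc | hc <;>
    by_cases h : q ∣ n <;> simp_all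
  have h2 := (card_le_card hsub).trans ((card_union_le _ _).trans (Nat.add_le_add_left
    ((card_union_le _ _).trans (Nat.add_le_add_right ((card_union_le _ _).trans
    (Nat.add_le_add_right ((card_union_le _ _).trans (Nat.add_le_add_right (card_union_le _ _)
      _)) _)) _)) _))
  have h3 : (m.primeFactors.card : ℝ) ≤ cototientCount (primesIoc (Real.exp a) (Real.exp b)) n
      + (weight (primesIoc 0 (Real.exp a)) n + sharedCount (Real.exp a) n
      + (m.primeFactors.filter fun q : ℕ => Real.exp c < q).card
      + cototientCount (primesIoc 0 (Real.exp a)) n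
      + cototientCount (primesIoc (Real.exp b) (Real.exp c)) n) := by exact_mod_cast h2
  linarith

theorem sum_weight_le (S : Finset ℕ) (hP : ∀ p ∈ S, 0 < p) (X : ℕ) :
    ∑ n ∈ Icc 1 X, (weight S n : ℝ) ≤ X * recipSum S := by
  have := sum_weight_mul S hP X (fun _ => (1 : ℝ))
  simp only [mul_one, sum_const, nsmul_eq_mul, Nat.card_Icc, Nat.add_sub_cancel] at this
  rw [this, recipSum, mul_sum]
  refine sum_le_sum fun p _ => ?_
  rw [mul_one_div]
  exact Nat.cast_div_le

theorem sum_min_le (S : Finset ℕ) (hP : ∀ p ∈ S, p.Prime) {X : ℕ} (hX : ∀ p ∈ S, p ≤ X)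
    (hE : 0 < recipSum S) {f : ℕ → ℝ} (hf : ∀ n, 0 ≤ f n) :
    ∑ n ∈ Icc 1 X, min 2 (f n) ≤ 2 * (X * √(3 / recipSum S))
      + (∑ n ∈ Icc 1 X, (weight S n : ℝ) * f n) / recipSum S := by
  have hg : ∀ n, ‖((min 2 (f n) / 2 : ℝ) : ℂ)‖ ≤ 1 := fun n => by
    have : 0 ≤ min 2 (f n) := le_min (by norm_num) (hf n)
    rw [Complex.norm_real, Real.norm_of_nonneg (by positivity)]
    linarith [min_le_left 2 (f n)]
  have h1 := norm_sum_sub_weighted_sum_le S hP hX hE hg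
  have h2 : (∑ n ∈ Icc 1 X, ((min 2 (f n) / 2 : ℝ) : ℂ)
      - (∑ n ∈ Icc 1 X, (weight S n : ℂ) * ((min 2 (f n) / 2 : ℝ) : ℂ)) / recipSum S)
      = ((∑ n ∈ Icc 1 X, (min 2 (f n) / 2)
        - (∑ n ∈ Icc 1 X, (weight S n : ℝ) * (min 2 (f n) / 2)) / recipSum S : ℝ) : ℂ) := by
    push_cast; rfl
  rw [h2, Complex.norm_real] at h1
  have h3 := (abs_le.1 h1).2
  have h4 : (∑ n ∈ Icc 1 X, (weight S n : ℝ) * (min 2 (f n) / 2)) / recipSum S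
      ≤ (∑ n ∈ Icc 1 X, (weight S n : ℝ) * (f n / 2)) / recipSum S := by
    gcongr
    exact min_le_right _ _
  simp only [← mul_div_assoc, ← sum_div] at h3 h4
  rw [div_right_comm _ _ (recipSum S)] at h3
  rw [div_right_comm _ 2 (recipSum S), div_right_comm _ 2 (recipSum S)] at h4
  linarith

end

section

open Finset Filter Asymptotics

theorem tendsto_range₀ : Tendsto range₀ atTop atTop :=
  tendsto_nat_floor_atTop.comp (Real.tendsto_exp_atTop.comp
    (Real.tendsto_exp_atTop.comp (tendsto_pow_atTop (by norm_num))))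

theorem norm_exp_sub_exp_le (x y : ℝ) :
    ‖Complex.exp (x * Complex.I) - Complex.exp (y * Complex.I)‖ ≤ min 2 |x - y| := by
  refine le_min ?_ ?_
  · refine (norm_sub_le _ _).trans ?_
    rw [Complex.norm_exp_ofReal_mul_I, Complex.norm_exp_ofReal_mul_I]
    norm_num
  · have h : Complex.exp (x * Complex.I) - Complex.exp (y * Complex.I)
        = Complex.exp (y * Complex.I) * (Complex.exp (Complex.I * (x - y : ℝ)) - 1) := by
      rw [mul_sub, ← Complex.exp_add, mul_one]
      congr 2
      push_cast
      ring
    rw [h, norm_mul, Complex.norm_exp_ofReal_mul_I, one_mul]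
    exact Real.norm_exp_I_mul_ofReal_sub_one_le

theorem norm_exp_card_primeFactors_sub_le {s : ℝ} (hs : 1 ≤ s) (a : ℝ) {n : ℕ}
    (hn : n ∈ Icc 1 (range₀ s)) :
    ‖Complex.exp ((a * (n - n.totient).primeFactors.card : ℝ) * Complex.I)
      - Complex.exp ((a * cototientCount (midPrimes s) n : ℝ) * Complex.I)‖
    ≤ (if n = 1 then 2 else 0) + |a| * (weight (smallPrimes s) n
        + sharedCount (Real.exp (s ^ 32)) n + s ^ 4)
      + min 2 (|a| * cototientCount (smallPrimes s) n)
      + min 2 (|a| * cototientCount (largePrimes s) n) := by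
  have hD := logScale_pos s
  rw [mem_Icc] at hn
  refine (norm_exp_sub_exp_le _ _).trans ?_
  rw [← mul_sub, abs_mul]
  have hm0 : ∀ k : ℕ, 0 ≤ min 2 (|a| * k) := fun k => le_min (by norm_num) (by positivity)
  have h1 := hm0 (cototientCount (smallPrimes s) n)
  have h2 := hm0 (cototientCount (largePrimes s) n)
  have h3 : 0 ≤ |a| * (weight (smallPrimes s) n + sharedCount (Real.exp (s ^ 32)) n + s ^ 4) := by
    positivity
  rcases eq_or_ne n 1 with h | h
  · rw [if_pos h]
    linarith [min_le_left (2 : ℝ) (|a| * |((n - n.totient).primeFactors.card : ℝ)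
      - cototientCount (midPrimes s) n|)]
  rw [if_neg h, zero_add]
  have hn2 : 2 ≤ n := by omega
  have hlow : (cototientCount (midPrimes s) n : ℝ) ≤ (n - n.totient).primeFactors.card := by
    exact_mod_cast cototientCount_le_card_primeFactors
      (fun q hq => prime_of_mem_primesIoc hq) hn2
  have hup := card_primeFactors_cototient_le hn2 hn.2 (a := s ^ 32) (b := logScale s / s ^ 40)
    (c := logScale s / s ^ 4) (by positivity)
  have hlog : Real.log (range₀ s) / (logScale s / s ^ 4) ≤ s ^ 4 := by
    rw [div_le_iff₀ (by positivity), mul_div_cancel₀ _ (by positivity)]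
    exact log_range₀_le s
  rw [abs_of_nonneg (sub_nonneg.2 hlow)]
  have h4 : |a| * (((n - n.totient).primeFactors.card : ℝ) - cototientCount (midPrimes s) n)
      ≤ |a| * (weight (smallPrimes s) n + sharedCount (Real.exp (s ^ 32)) n + s ^ 4)
        + |a| * cototientCount (smallPrimes s) n + |a| * cototientCount (largePrimes s) n := by
    rw [← mul_add, ← mul_add]
    refine mul_le_mul_of_nonneg_left ?_ (abs_nonneg a)
    unfold midPrimes smallPrimes largePrimes
    linarith
  have h5 : 0 ≤ |a| * (cototientCount (smallPrimes s) n : ℝ) := by positivity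
  have h6 : 0 ≤ |a| * (cototientCount (largePrimes s) n : ℝ) := by positivity
  rcases min_cases 2 (|a| * (cototientCount (smallPrimes s) n : ℝ)) with ⟨h7, -⟩ | ⟨h7, -⟩ <;>
  rcases min_cases 2 (|a| * (cototientCount (largePrimes s) n : ℝ)) with ⟨h8, -⟩ | ⟨h8, -⟩ <;>
  rw [h7, h8] <;> first
    | (refine (min_le_left _ _).trans ?_; linarith)
    | (refine (min_le_right _ _).trans ?_; linarith)

theorem eventually_sum_sharedCount_le : ∀ᶠ s : ℝ in atTop,
    ∑ n ∈ Icc 1 (range₀ s), (sharedCount (Real.exp (s ^ 32)) n : ℝ) ≤ range₀ s := by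
  filter_upwards [eventually_pow_le_logScale 1, eventually_ge_atTop 2] with s hD hs
  refine (sum_sharedCount_le _ (Real.exp_pos _)).trans ?_
  have hl := log_range₀_le s
  have hl0 := Real.log_natCast_nonneg (range₀ s)
  have h1 : (2 + Real.log (range₀ s)) ^ 2 ≤ Real.exp (s ^ 32) := by
    calc (2 + Real.log (range₀ s)) ^ 2 ≤ (2 * logScale s) ^ 2 := by
          gcongr
          rw [pow_one] at hD
          linarith
      _ ≤ (Real.exp 1 * logScale s) ^ 2 := by
          have := logScale_pos s
          gcongr
          linarith [Real.exp_one_gt_d9]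
      _ = Real.exp (2 * (1 + s ^ 16)) := by
          rw [logScale, ← Real.exp_add, ← Real.exp_nat_mul]; norm_num
      _ ≤ Real.exp (s ^ 32) := by
          rw [Real.exp_le_exp]
          have h2 : (2 : ℝ) ^ 16 ≤ s ^ 16 := by gcongr
          have h3 : s ^ 32 = s ^ 16 * s ^ 16 := by ring
          nlinarith
  rw [div_le_iff₀ (Real.exp_pos _)]
  gcongr

theorem tendsto_norm_sum_exp_sub (t : ℝ) :
    Tendsto (fun s : ℝ => ‖(∑ n ∈ Icc 1 (range₀ s),
        Complex.exp ((t / s ^ 8 * (n - n.totient).primeFactors.card : ℝ) * Complex.I)) / range₀ s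
      - (∑ n ∈ Icc 1 (range₀ s), Complex.exp ((t / s ^ 8 * cototientCount (midPrimes s) n : ℝ)
        * Complex.I)) / range₀ s‖) atTop (nhds 0) := by
  have hinv : Tendsto (fun s : ℝ => (s : ℝ)⁻¹) atTop (nhds 0) := tendsto_inv_atTop_zero
  have hX : Tendsto (fun s => 2 / (range₀ s : ℝ)) atTop (nhds 0) :=
    (tendsto_natCast_atTop_atTop.comp tendsto_range₀).const_div_atTop 2
  have hsq : ∀ E : ℝ → ℝ, Tendsto E atTop atTop →
      Tendsto (fun s => 2 * √(3 / E s)) atTop (nhds 0) := fun E hE => by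
    simpa using (hE.const_div_atTop 3).sqrt.const_mul 2
  have h := ((hX.add (hinv.const_mul (3 * |t|))).add
    ((hsq _ tendsto_recipSum_shortPrimes).add
      ((hinv.const_mul |t|).mul tendsto_sum_weight_mul_smallPrimes))).add
    ((hsq _ tendsto_recipSum_longPrimes).add
      ((hinv.const_mul |t|).mul tendsto_sum_weight_mul_largePrimes))
  simp only [mul_zero, add_zero] at h
  refine squeeze_zero' (Eventually.of_forall fun s => norm_nonneg _) ?_ h
  filter_upwards [eventually_ge_atTop 1, eventually_sum_sharedCount_le, eventually_longPrimes_le,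
    eventually_shortPrimes_le, eventually_recipSum_smallPrimes_le,
    tendsto_recipSum_shortPrimes.eventually_gt_atTop 0,
    tendsto_recipSum_longPrimes.eventually_gt_atTop 0] with s hs hB hlong hshort hμ hE2 hE1
  have hs0 : 0 < s := by linarith
  have hX0 : (0 : ℝ) < range₀ s := by exact_mod_cast one_le_range₀ s
  set a := t / s ^ 8 with ha
  have haabs : |a| = |t| / s ^ 8 := by rw [ha, abs_div, abs_of_pos (by positivity : 0 < s ^ 8)]
  rw [← sub_div, norm_div, Complex.norm_natCast, ← sum_sub_distrib, div_le_iff₀ hX0]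
  refine (norm_sum_le _ _).trans ((sum_le_sum fun n hn =>
    norm_exp_card_primeFactors_sub_le hs a hn).trans ?_)
  rw [sum_add_distrib, sum_add_distrib, sum_add_distrib, sum_ite_eq' (Icc 1 (range₀ s)) 1,
    if_pos (mem_Icc.2 ⟨le_rfl, one_le_range₀ s⟩), ← mul_sum, sum_add_distrib, sum_add_distrib]
  have h1 := sum_min_le (shortPrimes s) (fun p hp => prime_of_mem_dyadicPrimes hp) hshort hE2
    (f := fun n => |a| * cototientCount (smallPrimes s) n) (fun n => by positivity)
  have h2 := sum_min_le (longPrimes s) (fun p hp => prime_of_mem_dyadicPrimes hp) hlong hE1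
    (f := fun n => |a| * cototientCount (largePrimes s) n) (fun n => by positivity)
  have h3 := sum_weight_le (smallPrimes s)
    (fun p hp => (prime_of_mem_primesIoc hp).pos) (range₀ s)
  have h4 : (range₀ s : ℝ) * recipSum (smallPrimes s) ≤ range₀ s * s := by gcongr
  have h5 : ∑ _n ∈ Icc 1 (range₀ s), s ^ 4 = range₀ s * s ^ 4 := by
    rw [sum_const, nsmul_eq_mul, Nat.card_Icc, Nat.add_sub_cancel]
  have h6 : |a| * (∑ n ∈ Icc 1 (range₀ s), (weight (smallPrimes s) n : ℝ)
      + ∑ n ∈ Icc 1 (range₀ s), (sharedCount (Real.exp (s ^ 32)) n : ℝ)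
      + ∑ _n ∈ Icc 1 (range₀ s), s ^ 4) ≤ 3 * |t| * s⁻¹ * range₀ s := by
    calc _ ≤ |a| * (range₀ s * s ^ 7 + range₀ s * s ^ 7 + range₀ s * s ^ 7) := by
          refine mul_le_mul_of_nonneg_left ?_ (abs_nonneg a)
          have hp : ∀ k, k ≤ 7 → (range₀ s : ℝ) * s ^ k ≤ range₀ s * s ^ 7 := fun k hk => by
            gcongr
          have := hp 0 (by norm_num)
          have := hp 1 (by norm_num)
          have := hp 4 (by norm_num)
          rw [h5]
          simp only [pow_zero, pow_one, mul_one] at *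
          linarith
      _ = _ := by
          rw [haabs]
          field_simp
          ring
  have h7 : ∀ (S Q : Finset ℕ), 0 < recipSum S →
      (∑ n ∈ Icc 1 (range₀ s), (weight S n : ℝ) * (|a| * cototientCount Q n)) / recipSum S
      = |t| * s⁻¹ * ((∑ n ∈ Icc 1 (range₀ s), (weight S n : ℝ) * cototientCount Q n)
        / (range₀ s * recipSum S * s ^ 7)) * range₀ s := fun S Q hS => by
    have : ∑ n ∈ Icc 1 (range₀ s), (weight S n : ℝ) * (|a| * cototientCount Q n)
        = |a| * ∑ n ∈ Icc 1 (range₀ s), (weight S n : ℝ) * cototientCount Q n := by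
      rw [mul_sum]; exact sum_congr rfl fun n _ => by ring
    rw [this, haabs]
    field_simp
  rw [h7 _ _ hE2] at h1
  rw [h7 _ _ hE1] at h2
  have h8 : 2 / (range₀ s : ℝ) * range₀ s = 2 := by field_simp
  simp only [add_mul, h8]
  linarith

theorem norm_exponent_add_le {t s μ : ℝ} (hs : 1 ≤ s) (hts : |t| ≤ s ^ 8) (hμ : |μ - s ^ 16| ≤ s) :
    ‖(μ * (Complex.exp ((t / s ^ 8 : ℝ) * Complex.I) - 1) - (t / s ^ 8 : ℝ) * s ^ 16 * Complex.I)
      - (-t ^ 2 / 2)‖ ≤ (t ^ 2 + |t| ^ 3 + |t|) * s⁻¹ := by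
  have hs0 : 0 < s := by linarith
  set a := t / s ^ 8 with ha
  have haabs : |a| = |t| / s ^ 8 := by rw [ha, abs_div, abs_of_pos (by positivity : 0 < s ^ 8)]
  have hn : ‖(a : ℂ) * Complex.I‖ = |a| := by
    rw [norm_mul, Complex.norm_I, mul_one, Complex.norm_real, Real.norm_eq_abs]
  have ha1 : |a| ≤ 1 := by rw [haabs, div_le_one (by positivity)]; exact hts
  set z := (a : ℂ) * Complex.I with hz
  have h1 : ‖Complex.exp z - 1 - z‖ ≤ |a| ^ 2 := by
    rw [← hn]; exact Complex.norm_exp_sub_one_sub_id_le (by rw [hn]; exact ha1)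
  have h2 : ‖Complex.exp z - 1 - z - z ^ 2 / 2‖ ≤ |a| ^ 3 := by
    have := Complex.exp_bound (x := z) (by rw [hn]; exact ha1) (n := 3) (by norm_num)
    rw [hn] at this
    simp only [sum_range_succ, range_zero, sum_empty] at this
    norm_num [Nat.factorial] at this
    rw [show Complex.exp z - 1 - z - z ^ 2 / 2 = Complex.exp z - (1 + z + z ^ 2 / 2) by ring]
    have : 0 ≤ |a| ^ 3 := by positivity
    linarith
  have h3 : z ^ 2 * s ^ 16 = -t ^ 2 := by
    rw [hz, mul_pow, Complex.I_sq, ha]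
    have : (s : ℂ) ≠ 0 := by exact_mod_cast hs0.ne'
    push_cast
    field_simp
  have h4 : (μ * (Complex.exp z - 1) - a * s ^ 16 * Complex.I) - (-(t : ℂ) ^ 2 / 2)
      = ((μ - s ^ 16 : ℝ) : ℂ) * (Complex.exp z - 1 - z)
        + ((s ^ 16 : ℝ) : ℂ) * (Complex.exp z - 1 - z - z ^ 2 / 2)
        + ((μ - s ^ 16 : ℝ) : ℂ) * z := by
    rw [← h3, hz]
    push_cast
    ring
  rw [h4]
  refine (norm_add₃_le).trans ?_
  rw [norm_mul, norm_mul, norm_mul, Complex.norm_real, Complex.norm_real, Real.norm_eq_abs,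
    Real.norm_of_nonneg (by positivity), hn]
  have hinv : ∀ k, 1 ≤ k → (s ^ k)⁻¹ ≤ s⁻¹ := fun k hk =>
    inv_anti₀ hs0 (le_self_pow₀ hs (by omega))
  calc _ ≤ s * |a| ^ 2 + s ^ 16 * |a| ^ 3 + s * |a| := by gcongr
    _ = t ^ 2 * (s ^ 15)⁻¹ + |t| ^ 3 * (s ^ 8)⁻¹ + |t| * (s ^ 7)⁻¹ := by
        rw [haabs, ← sq_abs t]
        field_simp
    _ ≤ t ^ 2 * s⁻¹ + |t| ^ 3 * s⁻¹ + |t| * s⁻¹ := by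
        exact add_le_add (add_le_add
          (mul_le_mul_of_nonneg_left (hinv 15 (by norm_num)) (by positivity))
          (mul_le_mul_of_nonneg_left (hinv 8 (by norm_num)) (by positivity)))
          (mul_le_mul_of_nonneg_left (hinv 7 (by norm_num)) (by positivity))
    _ = _ := by ring

/-- Convergence of the characteristic functions. -/
theorem tendsto_sum_exp (t : ℝ) :
    Tendsto (fun s : ℝ => (∑ n ∈ Icc 1 (range₀ s), Complex.exp
      ((t * (((n - n.totient).primeFactors.card - s ^ 16) / s ^ 8) : ℝ) * Complex.I)) / range₀ s)
      atTop (nhds (Complex.exp (-(t : ℂ) ^ 2 / 2))) := by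
  have h1 := tendsto_norm_sum_exp_sub t
  have h2 := tendsto_exp_cototientCount_midPrimes fun s => t / s ^ 8
  have h3 : Tendsto (fun s : ℝ => recipSum (midPrimes s) *
      (Complex.exp ((t / s ^ 8 : ℝ) * Complex.I) - 1) - (t / s ^ 8 : ℝ) * s ^ 16 * Complex.I)
      atTop (nhds (-(t : ℂ) ^ 2 / 2)) := by
    rw [tendsto_iff_norm_sub_tendsto_zero]
    have hinv : Tendsto (fun s : ℝ => (t ^ 2 + |t| ^ 3 + |t|) * s⁻¹) atTop (nhds 0) := by
      simpa using tendsto_inv_atTop_zero.const_mul (t ^ 2 + |t| ^ 3 + |t|)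
    refine squeeze_zero' (Eventually.of_forall fun s => norm_nonneg _) ?_ hinv
    filter_upwards [eventually_ge_atTop 1, eventually_ge_atTop |t|,
      eventually_abs_recipSum_midPrimes_sub_le] with s hs hst hμ
    exact norm_exponent_add_le hs (hst.trans (le_self_pow₀ hs (by norm_num))) hμ
  have h4 := (Complex.continuous_exp.tendsto _).comp h3
  rw [tendsto_iff_norm_sub_tendsto_zero] at h4 ⊢
  have h5 := (h1.add h2).add h4
  simp only [add_zero] at h5
  refine squeeze_zero' (Eventually.of_forall fun s => norm_nonneg _) ?_ h5
  filter_upwards [eventually_gt_atTop 0] with s hs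
  simp only [Function.comp_apply]
  set a := t / s ^ 8 with ha
  set c := Complex.exp ((-(a * s ^ 16) : ℝ) * Complex.I) with hc
  have hc1 : ‖c‖ = 1 := Complex.norm_exp_ofReal_mul_I _
  set A := (∑ n ∈ Icc 1 (range₀ s),
        Complex.exp ((a * (n - n.totient).primeFactors.card : ℝ) * Complex.I)) / range₀ s with hA
  set B := (∑ n ∈ Icc 1 (range₀ s), Complex.exp ((a * cototientCount (midPrimes s) n : ℝ)
        * Complex.I)) / range₀ s with hB
  have hA' : (∑ n ∈ Icc 1 (range₀ s), Complex.exp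
      ((t * (((n - n.totient).primeFactors.card - s ^ 16) / s ^ 8) : ℝ) * Complex.I)) / range₀ s
      = c * A := by
    rw [hA, ← mul_div_assoc, mul_sum]
    congr 1
    refine sum_congr rfl fun n _ => ?_
    rw [hc, ← Complex.exp_add, ← add_mul, ← Complex.ofReal_add, ha]
    congr 3
    ring
  have hB' : (∑ n ∈ Icc 1 (range₀ s),
        Complex.exp ((a : ℝ) * Complex.I * cototientCount (midPrimes s) n)) / range₀ s = B := by
    rw [hB]
    congr 1
    refine sum_congr rfl fun n _ => ?_
    congr 1
    push_cast
    ring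
  have hC : ∀ w : ℂ, Complex.exp (w - a * s ^ 16 * Complex.I) = c * Complex.exp w := fun w => by
    rw [hc, ← Complex.exp_add]
    congr 1
    push_cast
    ring
  rw [hA', hB']
  rw [hC]
  set M := Complex.exp (recipSum (midPrimes s) * (Complex.exp ((a : ℝ) * Complex.I) - 1))
  have hn : ∀ z : ℂ, ‖z‖ = ‖c * z‖ := fun z => by rw [norm_mul, hc1, one_mul]
  rw [hn (A - B), hn (B - M)]
  refine le_trans (le_of_eq ?_) norm_add₃_le
  congr 1
  ring

end

section

open Filter MeasureTheory ProbabilityTheory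

/-- A family of finite samples of real numbers whose characteristic functions converge to that of
the standard Gaussian has empirical distribution functions converging to the Gaussian one. -/
theorem tendsto_card_filter_div_of_tendsto_sum_exp (X : ℝ → ℕ) (hX : ∀ s, 1 ≤ X s)
    (f : ℝ → ℕ → ℝ)
    (hf : ∀ t : ℝ, Tendsto (fun s => (∑ n ∈ Finset.Icc 1 (X s),
      Complex.exp ((t * f s n : ℝ) * Complex.I)) / X s) atTop
      (nhds (Complex.exp (-(t : ℂ) ^ 2 / 2)))) (u : ℝ) :
    Tendsto (fun s => (((Finset.Icc 1 (X s)).filter fun n => f s n ≤ u).card : ℝ) / X s) atTop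
      (nhds ((gaussianReal 0 1).real (Set.Iic u))) := by
  let ν (s : ℝ) : Measure ℝ := ∑ n ∈ Finset.Icc 1 (X s), (X s : ENNReal)⁻¹ • Measure.dirac (f s n)
  have hX0 (s) : (X s : ENNReal) ≠ 0 := by
    have := hX s
    simp; omega
  have hν (s) : IsProbabilityMeasure (ν s) := ⟨by
    simp only [ν, Measure.coe_finsetSum, Finset.sum_apply, Measure.smul_apply, measure_univ,
      smul_eq_mul, mul_one, Finset.sum_const, Nat.card_Icc, nsmul_eq_mul, Nat.add_sub_cancel]
    exact ENNReal.mul_inv_cancel (hX0 s) (by simp)⟩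
  have hchar (s t) : charFun (ν s) t = (∑ n ∈ Finset.Icc 1 (X s),
      Complex.exp ((t * f s n : ℝ) * Complex.I)) / X s := by
    rw [charFun_apply_real]
    simp only [ν]
    rw [integral_finsetSum_measure]
    · rw [Finset.sum_div]
      refine Finset.sum_congr rfl fun n _ => ?_
      rw [integral_smul_measure, integral_dirac]
      simp [div_eq_inv_mul]
    · intro n _
      refine Integrable.smul_measure ?_ (by simp [hX0 s])
      exact integrable_dirac (by simp)
  have hreal (s) : (ν s).real (Set.Iic u) =
      (((Finset.Icc 1 (X s)).filter fun n => f s n ≤ u).card : ℝ) / X s := by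
    have h (n) : (X s : ENNReal)⁻¹ * (Set.Iic u).indicator 1 (f s n) ≠ ⊤ := by
      refine ENNReal.mul_ne_top (by simp [hX0 s]) ?_
      by_cases hn : f s n ≤ u <;> simp [hn]
    simp only [ν, measureReal_def, Measure.coe_finsetSum, Finset.sum_apply, Measure.smul_apply,
      smul_eq_mul, Measure.dirac_apply]
    rw [ENNReal.toReal_sum fun n _ => h n, Finset.card_filter, Nat.cast_sum, Finset.sum_div]
    refine Finset.sum_congr rfl fun n _ => ?_
    by_cases hn : f s n ≤ u <;> simp [hn]
  refine tendsto_of_seq_tendsto fun v hv => ?_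
  let μ (k : ℕ) : ProbabilityMeasure ℝ := ⟨ν (v k), hν _⟩
  let μ₀ : ProbabilityMeasure ℝ := ⟨gaussianReal 0 1, inferInstance⟩
  have hconv : Tendsto μ atTop (nhds μ₀) := by
    rw [ProbabilityMeasure.tendsto_iff_tendsto_charFun]
    intro t
    have h0 : charFun (gaussianReal 0 1) t = Complex.exp (-(t : ℂ) ^ 2 / 2) := by
      rw [charFun_gaussianReal]
      simp [neg_div]
    simpa only [μ, μ₀, ProbabilityMeasure.coe_mk, h0, hchar, Function.comp_def] using (hf t).comp hv
  have := ProbabilityMeasure.tendsto_measure_of_null_frontier_of_tendsto' hconv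
    (E := Set.Iic u) (by
      simp only [frontier_Iic, μ₀, ProbabilityMeasure.coe_mk]
      have := nullSingletonClass_gaussianReal (μ := 0) (v := 1) one_ne_zero
      simp)
  have h2 := (ENNReal.tendsto_toReal (by simp)).comp this
  refine (h2.congr fun k => ?_)
  exact hreal _

theorem gaussianReal_real_Iic (u : ℝ) : (gaussianReal 0 1).real (Set.Iic u) =
    (Real.sqrt (2 * Real.pi))⁻¹ * ∫ t in Set.Iic u, Real.exp (-t ^ 2 / 2) := by
  rw [measureReal_def, gaussianReal_apply_eq_integral _ one_ne_zero,
    ENNReal.toReal_ofReal (integral_nonneg fun x => gaussianPDFReal_nonneg _ _ _),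
    ← integral_const_mul]
  refine integral_congr_ae (Eventually.of_forall fun x => ?_)
  simp [gaussianPDFReal]

/-- The condition for the integer `1` changes the count by at most one. -/
theorem tendsto_card_filter_Icc_two {X : ℝ → ℕ} (hX : Tendsto X atTop atTop)
    (p : ℝ → ℕ → Prop) [∀ s, DecidablePred (p s)] {L : ℝ}
    (h : Tendsto (fun s => (((Finset.Icc 1 (X s)).filter (p s)).card : ℝ) / X s) atTop (nhds L)) :
    Tendsto (fun s => (((Finset.Icc 2 (X s)).filter (p s)).card : ℝ) / X s) atTop (nhds L) := by
  have h1 : Tendsto (fun s => (1 : ℝ) / X s) atTop (nhds 0) :=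
    tendsto_const_nhds.div_atTop (tendsto_natCast_atTop_atTop.comp hX)
  refine tendsto_of_tendsto_of_tendsto_of_le_of_le (by simpa only [sub_zero] using h.sub h1) h
    (fun s => ?_) fun s => ?_
  · rw [← sub_div]
    simp only
    gcongr
    rw [sub_le_iff_le_add]
    have : (Finset.Icc 1 (X s)).filter (p s) ⊆ insert 1 ((Finset.Icc 2 (X s)).filter (p s)) := by
      intro n
      simp only [Finset.mem_filter, Finset.mem_Icc, Finset.mem_insert]
      rintro ⟨⟨h1, h2⟩, h3⟩
      by_cases hn : n = 1
      · exact Or.inl hn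
      · exact Or.inr ⟨⟨by omega, h2⟩, h3⟩
    exact_mod_cast (Finset.card_le_card this).trans (Finset.card_insert_le _ _)
  · simp only
    gcongr
    norm_num

end

end CototientLaw

open Filter

/-- Erdős–Kac law for ω(n − φ(n)), the cototient. (n = 1 is excluded by 1 < n.) -/
theorem erdosKac_cototient (u : ℝ) :
    Tendsto (fun x : ℝ =>
      (((Finset.Icc 2 ⌊x⌋₊).filter (fun n : ℕ =>
        ((((n - n.totient).primeFactors.card : ℝ) : ℝ)) - Real.log (Real.log x)
          ≤ u * Real.sqrt (Real.log (Real.log x)))).card : ℝ) / x)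
      atTop
      (nhds ((Real.sqrt (2 * Real.pi))⁻¹ * ∫ t in Set.Iic u, Real.exp (-t ^ 2 / 2))) := by
  have h1 := CototientLaw.tendsto_card_filter_Icc_two CototientLaw.tendsto_range₀ _
    (CototientLaw.tendsto_card_filter_div_of_tendsto_sum_exp CototientLaw.range₀
      CototientLaw.one_le_range₀ _ CototientLaw.tendsto_sum_exp u)
  rw [CototientLaw.gaussianReal_real_Iic] at h1
  have hσ : Tendsto (fun x : ℝ => (Real.log (Real.log x)) ^ (1 / 16 : ℝ)) atTop atTop :=
    (tendsto_rpow_atTop (by norm_num)).comp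
      (Real.tendsto_log_atTop.comp Real.tendsto_log_atTop)
  have h2 := (h1.comp hσ).mul (tendsto_nat_floor_div_atTop (R := ℝ))
  rw [mul_one] at h2
  refine h2.congr' ?_
  filter_upwards [eventually_ge_atTop 1, Real.tendsto_log_atTop.eventually_gt_atTop 0,
    (Real.tendsto_log_atTop.comp Real.tendsto_log_atTop).eventually_gt_atTop 0] with x hx hx1 hx2
  simp only [Function.comp_apply] at hx2 ⊢
  set s := (Real.log (Real.log x)) ^ (1 / 16 : ℝ) with hs
  have hs0 : 0 < s := Real.rpow_pos_of_pos hx2 _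
  have hs16 : s ^ 16 = Real.log (Real.log x) := by
    rw [hs, ← Real.rpow_natCast, ← Real.rpow_mul hx2.le]
    norm_num
  have hs8 : Real.sqrt (Real.log (Real.log x)) = s ^ 8 := by
    rw [← hs16, show s ^ 16 = (s ^ 8) ^ 2 by ring, Real.sqrt_sq (by positivity)]
  have hX : CototientLaw.range₀ s = ⌊x⌋₊ := by
    rw [CototientLaw.range₀, CototientLaw.logScale, hs16,
      Real.exp_log hx1, Real.exp_log (by linarith)]
  have hfl : (⌊x⌋₊ : ℝ) ≠ 0 := by
    have := Nat.floor_pos.mpr hx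
    positivity
  rw [hX, hs8, ← hs16, div_mul_div_cancel₀ hfl]
  simp only [div_le_iff₀ (pow_pos hs0 8)]
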